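/- There is a universal constant c > 0 such that for all integers 1 ≤ r < R < R', for the frontier loop soup 𝓛^b_{R'} of the random walk loop soup in B_{R'} with intensity 1, the probability that some loop frontier in 𝓛^b_{R'} crosses A_{r,R} is at most c·(r/R)^{1/2}. -/

import Mathlib

open MeasureTheory Set
open scoped ENNReal NNReal

noncomputable section

namespace RWLSPaper

open scoped Classical

/-- Vertices of the square lattice `ℤ²`. -/
abbrev Lat : Type := ℤ × ℤ

/-- The plane `ℝ²`, with the Euclidean metric. -/
abbrev Plane : Type := EuclideanSpace ℝ (Fin 2)

/-- Embedding of the lattice into the plane. -/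
def emb (z : Lat) : Plane := (WithLp.equiv 2 (Fin 2 → ℝ)).symm ![(z.1 : ℝ), (z.2 : ℝ)]

/-- Lattice adjacency: Euclidean distance one. -/
def Adj (a b : Lat) : Prop := (a.1 - b.1) ^ 2 + (a.2 - b.2) ^ 2 = 1

/-- ℓ∞ norm on the lattice. -/
def linf (a : Lat) : ℤ := max |a.1| |a.2|

/-- The box `B_R(z) = {w : |w - z|_∞ ≤ R}`. -/
def box (z : Lat) (R : ℤ) : Set Lat := {w | linf (w - z) ≤ R}

/-- Inner vertex boundary of a set of vertices. -/
def bdry (A : Set Lat) : Set Lat := {z | z ∈ A ∧ ∃ w, w ∉ A ∧ linf (z - w) = 1}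

/-- A set of vertices, embedded in the plane. -/
def embS (A : Set Lat) : Set Plane := emb '' A

/-- The boundary of the box `B_R(z)`, embedded in the plane. -/
def bdryE (z : Lat) (R : ℤ) : Set Plane := embS (bdry (box z R))

/-- The solid box `z + [-R,R]²` in the plane. -/
def boxP (z : Lat) (R : ℤ) : Set Plane :=
  {p | |p 0 - (z.1 : ℝ)| ≤ (R : ℝ) ∧ |p 1 - (z.2 : ℝ)| ≤ (R : ℝ)}

/-- Trace of a list of vertices: the vertices, together with the segments joining
consecutive ones. -/
def traceL (l : List Lat) : Set Plane :=
  (⋃ z ∈ l, {emb z}) ∪ ⋃ p ∈ l.zip l.tail, segment ℝ (emb p.1) (emb p.2)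

/-- Nearest-neighbour paths: nonempty lists of successively adjacent vertices. -/
def IsPath (l : List Lat) : Prop := l ≠ [] ∧ l.Chain' Adj

/-- Number of steps of a path. -/
def steps (l : List Lat) : ℕ := l.length - 1

/-- Paths from `z` to `w` with at least one step. -/
def PathsBetween (z w : Lat) : Set (List Lat) :=
  {l | IsPath l ∧ l.head? = some z ∧ l.getLast? = some w ∧ 2 ≤ l.length}

/-- Total mass of a set of paths under the measure giving weight `4^{-|η|}` to each
path `η`. -/
def pathMass (M : Set (List Lat)) : ℝ≥0∞ :=
  ∑' l : M, (4 : ℝ≥0∞)⁻¹ ^ steps l.1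

/-- `A` disconnects `B` from `C` in the plane: every continuous path joining a point
of `B` to a point of `C` meets `A`. -/
def Disconnects (A B C : Set Plane) : Prop :=
  ∀ γ : ℝ → Plane, ContinuousOn γ (Icc 0 1) → γ 0 ∈ B → γ 1 ∈ C →
    ∃ t ∈ Icc (0 : ℝ) 1, γ t ∈ A

/-- The set `M^{z,w}_{r,R}` of paths from `z` to `w` which intersect `∂B_R` and do
not disconnect `B_r` from `∂B_R`. -/
def MSet (z w : Lat) (r R : ℤ) : Set (List Lat) :=
  {l | l ∈ PathsBetween z w ∧ (traceL l ∩ bdryE 0 R).Nonempty ∧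
    ¬ Disconnects (traceL l) (embS (box 0 r)) (bdryE 0 R)}

/-- Nearest-neighbour walks from `u` to `v` staying in `D`. -/
def WalksIn (D : Set Lat) (u v : Lat) : Set (List Lat) :=
  {l | IsPath l ∧ l.head? = some u ∧ l.getLast? = some v ∧ ∀ x ∈ l, x ∈ D}

/-- The Green's function of simple random walk killed upon exiting `D`, through the
path-sum formula `G_D(u,v) = Σ_{η : u → v, η ⊆ D} 4^{-|η|}`. -/
def green (D : Set Lat) (u v : Lat) : ℝ≥0∞ :=
  ∑' l : WalksIn D u v, (4 : ℝ≥0∞)⁻¹ ^ steps l.1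

/-! ### Loops -/

/-- A rooted loop, encoded by its cyclic word: a nonempty list of vertices which,
cyclically, are successively adjacent. -/
structure RootedLoop where
  word : List Lat
  ne : word ≠ []
  adj : (word ++ word.take 1).Chain' Adj

/-- Rerooting (cyclic relabeling) relation on rooted loops. -/
def loopRot (l l' : RootedLoop) : Prop := ∃ k, l'.word = l.word.rotate k

/-- Unrooted loops: rooted loops modulo rerooting. -/
def ULoop : Type := Quot loopRot

/-- A representative of an unrooted loop. -/
def ULoop.out (γ : ULoop) : RootedLoop := Quot.out γ

/-- Number of steps of a loop. -/
def ULoop.steps (γ : ULoop) : ℕ := γ.out.word.length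

/-- Vertices visited by a loop. -/
def ULoop.verts (γ : ULoop) : Set Lat := {x | x ∈ γ.out.word}

/-- The trace of a loop in the plane. -/
def ULoop.trace (γ : ULoop) : Set Plane := traceL (γ.out.word ++ γ.out.word.take 1)

/-- The multiplicity `J(γ)`: the largest `j` such that `γ` is the concatenation of
`j` copies of a single loop. -/
def ULoop.mult (γ : ULoop) : ℕ :=
  sSup {j : ℕ | ∃ u : List Lat, u ≠ [] ∧ γ.out.word = (List.replicate j u).flatten}

/-- The unrooted loop measure: `ν(γ) = 4^{-|γ|} / J(γ)`. -/
def loopWeight (γ : ULoop) : ℝ≥0 := (4 : ℝ≥0)⁻¹ ^ γ.steps / (γ.mult : ℝ≥0)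

/-- Total `ν`-mass of a set of loops. -/
def nuMass (S : Set ULoop) : ℝ≥0∞ := ∑' γ : S, (loopWeight γ.1 : ℝ≥0∞)

/-- `ν(γ)` if `γ` is contained in `D`, and `0` otherwise. -/
def nuD (D : Set Lat) (γ : ULoop) : ℝ≥0 := if ULoop.verts γ ⊆ D then loopWeight γ else 0

/-! ### The random walk loop soup -/

/-- Loop configurations: multiplicity functions on unrooted loops. -/
abbrev Config : Type := ULoop → ℕ

/-- The set of loops appearing in a configuration. -/
def Config.loops (ω : Config) : Set ULoop := {γ | ω γ ≠ 0}

/-- The Poisson probability mass function with mean `r`. -/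
def poissonProb (r : ℝ≥0) (k : ℕ) : ℝ≥0∞ :=
  ENNReal.ofReal (Real.exp (-(r : ℝ)) * (r : ℝ) ^ k / k.factorial)

/-- `P` is the law of the random walk loop soup in `D` with intensity `α`: a Poisson
point process with intensity `α·ν` restricted to loops contained in `D`; equivalently,
the multiplicities of the various loops are independent, the multiplicity of a loop
`γ ⊆ D` being Poisson-distributed with mean `α ν(γ)`. -/
def IsLoopSoup (D : Set Lat) (α : ℝ) (P : Measure Config) : Prop :=
  IsProbabilityMeasure P ∧
  ∀ (s : Finset ULoop) (m : ULoop → ℕ),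
    P {ω | ∀ γ ∈ s, ω γ = m γ} = ∏ γ ∈ s, poissonProb (α.toNNReal * nuD D γ) (m γ)

/-- Decreasing events of the loop soup. -/
def DecreasingEvent (E : Set Config) : Prop :=
  ∀ ω ω' : Config, (∀ γ, ω' γ ≤ ω γ) → ω ∈ E → ω' ∈ E

/-! ### Clusters -/

/-- Two loops are adjacent when they intersect. -/
def Touches (γ γ' : ULoop) : Prop := (ULoop.verts γ ∩ ULoop.verts γ').Nonempty

/-- Connection of loops within a family `L` of loops: transitive closure of adjacency. -/
def linkedL (L : Set ULoop) : ULoop → ULoop → Prop :=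
  Relation.ReflTransGen (fun a b => a ∈ L ∧ b ∈ L ∧ Touches a b)

/-- The cluster of `γ` in `L`, as a set of loops. -/
def clusterClass (L : Set ULoop) (γ : ULoop) : Set ULoop := {γ' | γ' ∈ L ∧ linkedL L γ γ'}

/-- The subset of the plane covered by a family of loops. -/
def classTrace (K : Set ULoop) : Set Plane := ⋃ γ ∈ K, ULoop.trace γ

/-- The clusters of a loop configuration, regarded as subsets of the plane. -/
def clusters (L : Set ULoop) : Set (Set Plane) :=
  {C | ∃ γ ∈ L, C = classTrace (clusterClass L γ)}

/-- `Λ(A, L)`: the union of `A` with all the clusters of `L` meeting `A`. -/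
def LamL (A : Set Plane) (L : Set ULoop) : Set Plane :=
  A ∪ ⋃ C ∈ {C | C ∈ clusters L ∧ (C ∩ A).Nonempty}, C

/-- Connection within an arbitrary family of subsets of the plane (two members being
adjacent when they intersect). -/
def linkedS (F : Set (Set Plane)) : Set Plane → Set Plane → Prop :=
  Relation.ReflTransGen (fun a b => a ∈ F ∧ b ∈ F ∧ (a ∩ b).Nonempty)

/-- Clusters of a family of subsets of the plane. -/
def clustersS (F : Set (Set Plane)) : Set (Set Plane) :=
  {C | ∃ S ∈ F, C = ⋃ S' ∈ {S' | S' ∈ F ∧ linkedS F S S'}, S'}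

/-- `Λ(A, F)` for a family `F` of subsets of the plane. -/
def LamS (A : Set Plane) (F : Set (Set Plane)) : Set Plane :=
  A ∪ ⋃ C ∈ {C | C ∈ clustersS F ∧ (C ∩ A).Nonempty}, C

/-- The traces of a family of loops. -/
def traces (L : Set ULoop) : Set (Set Plane) := ULoop.trace '' L

/-! ### Filling, frontier, outermost clusters, crossings -/

/-- The filling of a set: the complement of the union of all unbounded connected
subsets of the complement of its closure. -/
def Fill (A : Set Plane) : Set Plane :=
  {x | ∀ C : Set Plane, C ⊆ (closure A)ᶜ → IsConnected C → x ∈ C → Bornology.IsBounded C}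

/-- The frontier of a loop: the topological boundary of the filling of its trace. -/
def loopFrontier (γ : ULoop) : Set Plane := frontier (Fill (ULoop.trace γ))

/-- The frontiers of the loops of a family. -/
def frontiers (L : Set ULoop) : Set (Set Plane) := loopFrontier '' L

/-- An outermost cluster of `L`. -/
def Outermost (L : Set ULoop) (C : Set Plane) : Prop :=
  C ∈ clusters L ∧ ∀ C' ∈ clusters L, C' ≠ C → ¬ Fill C ⊆ Fill C'

/-- `S` crosses the annulus `A_{r,R}(z)`: it meets both `∂B_r(z)` and `∂B_R(z)`. -/
def CrossesAnn (S : Set Plane) (z : Lat) (r R : ℤ) : Prop :=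
  (S ∩ bdryE z r).Nonempty ∧ (S ∩ bdryE z R).Nonempty

/-! ### Arm events -/

/-- The four-arm event: at least two distinct outermost clusters cross `A_{l,d}(z)`. -/
def fourArm (z : Lat) (l d : ℤ) (L : Set ULoop) : Prop :=
  ∃ C1 C2 : Set Plane, Outermost L C1 ∧ Outermost L C2 ∧ C1 ≠ C2 ∧
    CrossesAnn C1 z l d ∧ CrossesAnn C2 z l d

/-- The four-arm event, as a set of configurations. -/
def A4 (z : Lat) (l d : ℤ) : Set Config := {ω | fourArm z l d ω.loops}

/-- The truncated four-arm event `→𝒜(z;l,d)`. -/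
def A4trunc (z : Lat) (l d : ℤ) : Set Config :=
  {ω | fourArm z l d ω.loops ∧ LamL (embS (box z l)) ω.loops ⊆ boxP z (2 * d)}

/-- The truncated inward four-arm event `←𝒜(z;l,d)`. -/
def A4in (z : Lat) (l d : ℤ) : Set Config :=
  {ω | fourArm z l d ω.loops ∧
    LamL (embS (bdry (box z d))) ω.loops ∩ embS (box z (l / 2)) = ∅}

/-- Lattice points in the open upper half-plane `ℍ`. -/
def upperLat : Set Lat := {w | 0 < w.2}

/-- The upper part of the boundary of `B_R`, embedded in the plane. -/
def bdryEP (R : ℤ) : Set Plane := embS (bdry (box 0 R) ∩ upperLat)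

/-- `S` crosses the half-annulus `A^+_{r,R}`. -/
def CrossesAnnP (S : Set Plane) (r R : ℤ) : Prop :=
  (S ∩ bdryEP r).Nonempty ∧ (S ∩ bdryEP R).Nonempty

/-- The interior two-arm event: some outermost cluster has a frontier crossing `A_{l,d}`. -/
def A2 (l d : ℤ) : Set Config :=
  {ω | ∃ C, Outermost ω.loops C ∧ CrossesAnn (frontier (Fill C)) 0 l d}

/-- The boundary two-arm event. -/
def A2P (l d : ℤ) : Set Config :=
  {ω | ∃ C, Outermost ω.loops C ∧ CrossesAnnP (frontier (Fill C)) l d}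

/-- The boundary four-arm event. -/
def A4P (l d : ℤ) : Set Config :=
  {ω | ∃ C1 C2, Outermost ω.loops C1 ∧ Outermost ω.loops C2 ∧ C1 ≠ C2 ∧
    CrossesAnnP C1 l d ∧ CrossesAnnP C2 l d}

/-- Outward truncation condition: `Λ(B_l, ·) ⊆ B_{2d}`. -/
def TruncOut (l d : ℤ) (ω : Config) : Prop :=
  LamL (embS (box 0 l)) ω.loops ⊆ boxP 0 (2 * d)

/-- Inward truncation condition: `Λ(∂B_d, ·) ∩ B_{⌊l/2⌋} = ∅`. -/
def TruncIn (l d : ℤ) (ω : Config) : Prop :=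
  LamL (embS (bdry (box 0 d))) ω.loops ∩ embS (box 0 (l / 2)) = ∅

/-! ### Random walks and qualities -/

/-- `μ` is the law of the simple random walk on `ℤ²` started at `z`, as a measure on
`ℕ → ℤ²`. -/
def IsSRW (z : Lat) (μ : Measure (ℕ → Lat)) : Prop :=
  IsProbabilityMeasure μ ∧
  ∀ (n : ℕ) (f : ℕ → Lat), f 0 = z → (∀ i < n, Adj (f i) (f (i + 1))) →
    μ {w | ∀ i ≤ n, w i = f i} = (4 : ℝ≥0∞)⁻¹ ^ n

/-- First hitting time of a set of vertices by a walk. -/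
def hitTime (w : ℕ → Lat) (A : Set Lat) : ℕ := sInf {i | w i ∈ A}

/-- Position of a walk at its first hitting of `A`. -/
def hitPt (w : ℕ → Lat) (A : Set Lat) : Lat := w (hitTime w A)

/-- Trace of a walk, stopped at its first hitting of `A`. -/
def stoppedTrace (w : ℕ → Lat) (A : Set Lat) : Set Plane :=
  traceL ((List.range (hitTime w A + 1)).map w)

/-- The walk stays in `D` up to its first hitting of `A`. -/
def StaysIn (w : ℕ → Lat) (D A : Set Lat) : Prop := ∀ i ≤ hitTime w A, w i ∈ D

/-- `μ` is the law of the simple random walk started at `z`, conditioned to stay in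
`D` until it first hits `A`. -/
def IsCondSRW (z : Lat) (D A : Set Lat) (μ : Measure (ℕ → Lat)) : Prop :=
  ∃ ν : Measure (ℕ → Lat), IsSRW z ν ∧
    μ = (ν {w | StaysIn w D A})⁻¹ • ν.restrict {w | StaysIn w D A}

/-- Lattice ball of real radius (ℓ∞ distance). -/
def ballV (c : Lat) (ρ : ℝ) : Set Lat := {w | ((linf (w - c) : ℤ) : ℝ) ≤ ρ}

/-- Union of the stopped traces of a packet of walks. -/
def packTrace {j : ℕ} (ws : Fin j → ℕ → Lat) (A : Set Lat) : Set Plane :=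
  ⋃ i, stoppedTrace (ws i) A

/-- Union of the balls of radius `ρ` around the hitting points of a packet of walks. -/
def packBalls {j : ℕ} (ws : Fin j → ℕ → Lat) (A : Set Lat) (ρ : ℝ) : Set Plane :=
  ⋃ i, embS (ballV (hitPt (ws i) A) ρ)

/-- The frontiers of the loops of `ω` not contained in `B_r`. -/
def outerFrontiers (r : ℤ) (ω : Config) : Set (Set Plane) :=
  frontiers {γ | γ ∈ ω.loops ∧ ¬ ULoop.verts γ ⊆ box 0 r}

/-- The frontiers of the loops of `ω` meeting `B_R`. -/
def meetFrontiers (R : ℤ) (ω : Config) : Set (Set Plane) :=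
  frontiers {γ | γ ∈ ω.loops ∧ (ULoop.verts γ ∩ box 0 R).Nonempty}

/-- Quality at scale `s` for two packets of walks inside a loop soup, with initial
configuration `(Lr, V1, V2)` at scale `r`. -/
def qualityJK (Lr : Set ULoop) (V1 V2 : Set Lat) (r : ℤ) {j k : ℕ}
    (w1 : Fin j → ℕ → Lat) (w2 : Fin k → ℕ → Lat) (ω : Config) (s : ℤ) : ℝ :=
  sSup {δ : ℝ | 0 ≤ δ ∧
    LamS (embS V1 ∪ packTrace w1 (bdry (box 0 s)) ∪ packBalls w1 (bdry (box 0 s)) (δ * (s : ℝ)))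
        (traces Lr ∪ outerFrontiers r ω) ∩
      (embS V2 ∪ packTrace w2 (bdry (box 0 s)) ∪
        packBalls w2 (bdry (box 0 s)) (δ * (s : ℝ))) = ∅}

/-- Quality at scale `s` for a single pair of walks. -/
def qualityPair (Lr : Set ULoop) (V1 V2 : Set Lat) (r : ℤ)
    (w1 w2 : ℕ → Lat) (ω : Config) (s : ℤ) : ℝ :=
  qualityJK Lr V1 V2 r (fun _ : Fin 1 => w1) (fun _ : Fin 1 => w2) ω s

/-- Reversed quality at scale `s`, for two packets walking inward from `∂B_R`. -/
def qualityRev (L : Set ULoop) (V1 V2 : Set Lat) (R : ℤ) {j k : ℕ}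
    (w1 : Fin j → ℕ → Lat) (w2 : Fin k → ℕ → Lat) (ω : Config) (s : ℤ) : ℝ :=
  sSup {δ : ℝ | 0 ≤ δ ∧
    LamS (embS V1 ∪ packTrace w1 (bdry (box 0 s)) ∪ packBalls w1 (bdry (box 0 s)) (δ * (s : ℝ)))
        (traces L ∪ meetFrontiers R ω) ∩
      (embS V2 ∪ packTrace w2 (bdry (box 0 s)) ∪
        packBalls w2 (bdry (box 0 s)) (δ * (s : ℝ))) = ∅}

/-- Quality at scale `s` for one packet of walks, with non-disconnection of `U`. -/
def qualityDisc (Lr : Set ULoop) (U : Set Lat) (r : ℤ) {j : ℕ}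
    (ws : Fin j → ℕ → Lat) (ω : Config) (s : ℤ) : ℝ :=
  sSup {δ : ℝ | 0 ≤ δ ∧
    embS U ∩ Fill (LamS
      (packTrace ws (bdry (box 0 s)) ∪ packBalls ws (bdry (box 0 s)) (δ * (s : ℝ)))
      (traces Lr ∪ outerFrontiers r ω)) = ∅}

/-! ### Crossing loops and bad clusters -/

/-- Crossing loops: loops contained in `D` which cross `A_{d,k}` without
disconnecting `B_d` from `∂B_k`. -/
def crossingLoops (D : Set Lat) (d k : ℤ) : Set ULoop :=
  {γ | ULoop.verts γ ⊆ D ∧ CrossesAnn (ULoop.trace γ) 0 d k ∧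
    ¬ Disconnects (ULoop.trace γ) (embS (box 0 d)) (bdryE 0 k)}

/-- `K` is a bad cluster of `L` for the annulus `A_{l,d}`, relative to the set `CL` of
crossing loops: an outermost cluster crossing `A_{l,d}` which no longer crosses it
once its crossing loops are removed. -/
def IsBad (CL : Set ULoop) (l d : ℤ) (L : Set ULoop) (K : Set ULoop) : Prop :=
  (∃ γ ∈ L, K = clusterClass L γ) ∧
  Outermost L (classTrace K) ∧ CrossesAnn (classTrace K) 0 l d ∧
  ¬ CrossesAnn (classTrace (K \ CL)) 0 l d

/-- `E_1`: the four-arm event holds, with exactly one bad cluster. -/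
def E1 (CL : Set ULoop) (l d : ℤ) : Set Config :=
  {ω | fourArm 0 l d ω.loops ∧ ∃! K : Set ULoop, IsBad CL l d ω.loops K}

/-- `E_2`: the four-arm event holds, with at least two bad clusters. -/
def E2 (CL : Set ULoop) (l d : ℤ) : Set Config :=
  {ω | fourArm 0 l d ω.loops ∧
    ∃ K K' : Set ULoop, K ≠ K' ∧ IsBad CL l d ω.loops K ∧ IsBad CL l d ω.loops K'}

/-- Number of crossing loops of a configuration, counted with multiplicity. -/
def crossingCount (CL : Set ULoop) (ω : Config) : ℝ≥0∞ := ∑' γ : CL, (ω γ.1 : ℝ≥0∞)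

/-! ### Arcs of the square -/

/-- The square curve `{‖p‖_∞ = n}`: the closed polygonal curve through `∂B_n`. -/
def sqCurve (n : ℤ) : Set Plane := {p | max |p 0| |p 1| = (n : ℝ)}

/-- `J` is one of the two arcs of the closed curve `∂B_n` with endpoints `x` and `y`. -/
def IsArc (n : ℤ) (x y : Lat) (J : Set Plane) : Prop :=
  IsClosed J ∧ IsConnected J ∧ J ⊆ sqCurve n ∧ emb x ∈ J ∧ emb y ∈ J ∧
  IsConnected ((sqCurve n \ J) ∪ {emb x, emb y})


section

/-! ### Generic walk sums -/

lemma tsum_le_join {A B : Type*} (F : A → ℝ≥0∞) (G : B → ℝ≥0∞) (j : B → A)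
    (h : ∀ a, F a ≠ 0 → ∃ b, j b = a ∧ F a ≤ G b) : ∑' a, F a ≤ ∑' b, G b := by
  choose f hf1 hf2 using h
  have h1 : ∑' a, F a = ∑' a : Function.support F, F a := (tsum_subtype_support F).symm
  rw [h1]
  have hinj : Function.Injective (fun a : Function.support F => f a.1 a.2) := by
    intro a b hab
    apply Subtype.ext
    exact (hf1 a.1 a.2).symm.trans ((congrArg j hab).trans (hf1 b.1 b.2))
  calc ∑' a : Function.support F, F a ≤ ∑' a : Function.support F, G (f a.1 a.2) :=
        ENNReal.tsum_le_tsum (fun a => hf2 a.1 a.2)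
    _ ≤ ∑' b, G b := ENNReal.tsum_comp_le_tsum_of_injective hinj G

/-- weight of a list of vertices -/
def wt {V : Type*} (l : List V) : ℝ≥0∞ := (4 : ℝ≥0∞)⁻¹ ^ l.length

lemma wt_append {V : Type*} (l l' : List V) : wt (l ++ l') = wt l * wt l' := by
  simp [wt, pow_add]

lemma wt_cons {V : Type*} (x : V) (l : List V) : wt (x :: l) = 4⁻¹ * wt l := by
  simp [wt, pow_succ, mul_comm]

lemma wt_reverse {V : Type*} (l : List V) : wt l.reverse = wt l := by simp [wt]

lemma wt_map {V V' : Type*} (f : V → V') (l : List V) : wt (l.map f) = wt l := by simp [wt]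

/-- walks in `S` from a point to another point -/
inductive Walk {V : Type*} (nb : Fin 4 → V → V) (S : Set V) : V → V → List V → Prop
  | one {x : V} : x ∈ S → Walk nb S x x [x]
  | cons {x y : V} {l : List V} (d : Fin 4) : x ∈ S → Walk nb S (nb d x) y l →
      Walk nb S x y (x :: l)

namespace Walk

variable {V : Type*} {nb : Fin 4 → V → V} {S T : Set V} {a b c : V} {l l' : List V}

lemma mem (h : Walk nb S a b l) : ∀ v ∈ l, v ∈ S := by
  induction h with
  | one h => simpa using h
  | cons d h _ ih =>
    intro v hv
    rcases List.mem_cons.1 hv with rfl | hv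
    · exact h
    · exact ih v hv

lemma start_mem (h : Walk nb S a b l) : a ∈ l := by
  cases h <;> simp

lemma end_mem (h : Walk nb S a b l) : b ∈ l := by
  induction h with
  | one h => simp
  | cons d h _ ih => exact List.mem_cons_of_mem _ ih

lemma start_in (h : Walk nb S a b l) : a ∈ S := h.mem _ h.start_mem

lemma end_in (h : Walk nb S a b l) : b ∈ S := h.mem _ h.end_mem

lemma mono (h : Walk nb S a b l) (hT : ∀ v ∈ l, v ∈ T) : Walk nb T a b l := by
  induction h with
  | one h => exact .one (hT _ (by simp))
  | cons d h _ ih =>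
    exact .cons d (hT _ (by simp)) (ih (fun v hv => hT v (by simp [hv])))

lemma mono' (h : Walk nb S a b l) (hT : S ⊆ T) : Walk nb T a b l :=
  h.mono (fun v hv => hT (h.mem v hv))

lemma append {d : Fin 4} (h : Walk nb S a b l) (h' : Walk nb S (nb d b) c l') :
    Walk nb S a c (l ++ l') := by
  induction h with
  | one h => exact .cons d h h'
  | cons d' h _ ih => exact .cons d' h (ih h')

lemma join (h : Walk nb S a b l) (h' : Walk nb S b c l') :
    Walk nb S a c (l ++ l'.tail) := by
  cases h' with
  | one h' => simpa using h
  | cons d hx h' => simpa using h.append h'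

lemma ne_nil (h : Walk nb S a b l) : l ≠ [] := by
  cases h <;> simp

lemma head? (h : Walk nb S a b l) : l.head? = some a := by
  cases h <;> simp

lemma getLast? (h : Walk nb S a b l) : l.getLast? = some b := by
  induction h with
  | one h => simp
  | @cons x y l d h h' ih =>
    have := h'.ne_nil
    rw [List.getLast?_cons, ih]; simp

/-- decomposition at the last visit -/
lemma last_visit (h : Walk nb S c b l) (hab : a ≠ b) :
    (a ∈ l → ∃ C d X, l = C ++ X ∧ Walk nb S c a C ∧ Walk nb (S \ {a}) (nb d a) b X) ∧
    (a ∉ l → Walk nb (S \ {a}) c b l) := by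
  induction h with
  | @one x hx =>
    constructor
    · intro h; simp at h; exact absurd h hab
    · intro h; exact .one ⟨hx, fun h' => by simp at h'; simp [h'] at h⟩
  | @cons x y l d hx hw ih =>
    obtain ⟨ih1, ih2⟩ := ih hab
    constructor
    · intro h
      by_cases hal : a ∈ l
      · obtain ⟨C, d', X, rfl, h1, h2⟩ := ih1 hal
        exact ⟨x :: C, d', X, rfl, .cons d hx h1, h2⟩
      · have hxa : a = x := by simpa [hal] using h
        subst hxa
        exact ⟨[a], d, l, rfl, .one hx, ih2 hal⟩
    · intro h
      simp at h
      refine .cons d ⟨hx, fun h' => h.1 ?_⟩ (ih2 h.2)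
      simpa using h'.symm

end Walk

lemma quarter_four : ∑ _d : Fin 4, (4 : ℝ≥0∞)⁻¹ = 1 := by
  simp
  exact ENNReal.mul_inv_cancel (by norm_num) (by norm_num)

lemma walk_sum {V : Type*} (nb : Fin 4 → V → V) (S : Set V) (ψ φ : V → ℝ≥0∞)
    (h : ∀ x ∈ S, 4⁻¹ * ψ x + ∑ d, 4⁻¹ * (if nb d x ∈ S then φ (nb d x) else 0) ≤ φ x) (x : V)
    (hx : x ∈ S) :
    ∑' p : List V × V, (if Walk nb S x p.2 p.1 then wt p.1 * ψ p.2 else 0) ≤ φ x := by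
  have key : ∀ n : ℕ, ∀ x, ∑' p : List V × V,
      (if Walk nb S x p.2 p.1 ∧ p.1.length ≤ n then wt p.1 * ψ p.2 else 0) ≤
        if x ∈ S then φ x else 0 := by
    intro n
    induction n with
    | zero =>
      intro x
      have : ∀ p : List V × V,
        (if Walk nb S x p.2 p.1 ∧ p.1.length ≤ 0 then wt p.1 * ψ p.2 else 0) = 0 := by
        intro p
        rw [if_neg]
        rintro ⟨h1, h2⟩
        exact h1.ne_nil (List.length_eq_zero_iff.1 (by omega))
      simp only [this, tsum_zero]
      exact zero_le
    | succ n ih =>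
      intro x
      by_cases hx : x ∈ S
      · rw [if_pos hx]
        refine le_trans ?_ (h x hx)
        let G : Unit ⊕ (Fin 4 × (List V × V)) → ℝ≥0∞ := Sum.elim (fun _ => 4⁻¹ * ψ x)
          (fun q => 4⁻¹ * (if Walk nb S (nb q.1 x) q.2.2 q.2.1 ∧ q.2.1.length ≤ n then
            wt q.2.1 * ψ q.2.2 else 0))
        let j : Unit ⊕ (Fin 4 × (List V × V)) → List V × V := Sum.elim (fun _ => ([x], x))
          (fun q => (x :: q.2.1, q.2.2))
        refine le_trans (tsum_le_join _ G j ?_) ?_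
        · rintro ⟨l, y⟩ hne
          have hc := (ite_ne_right_iff.1 hne).1
          obtain ⟨hw, hl⟩ := hc
          simp only at hw hl
          rw [if_pos ⟨hw, hl⟩]
          cases hw with
          | one h' => exact ⟨Sum.inl (), rfl, by simp [G, wt]⟩
          | @cons _ _ l d h' hw =>
            refine ⟨Sum.inr (d, (l, y)), rfl, ?_⟩
            have : l.length ≤ n := by simpa using hl
            simp only [G, Sum.elim_inr]
            rw [if_pos ⟨hw, this⟩, wt_cons, mul_assoc]
        · rw [ENNReal.summable.tsum_sum ENNReal.summable]
          simp only [G, Sum.elim_inl, Sum.elim_inr, tsum_fintype, Finset.univ_unique,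
            Finset.sum_const, Finset.card_singleton, one_smul]
          gcongr
          rw [ENNReal.tsum_prod', tsum_fintype]
          apply Finset.sum_le_sum
          intro d _
          rw [ENNReal.tsum_mul_left]
          gcongr
          exact ih (nb d x)
      · have : ∀ p : List V × V,
          (if Walk nb S x p.2 p.1 ∧ p.1.length ≤ n + 1 then wt p.1 * ψ p.2 else 0) = 0 := by
          intro p
          rw [if_neg]
          rintro ⟨h1, h2⟩
          exact hx h1.start_in
        simp [this]
  rw [ENNReal.tsum_eq_iSup_sum]
  apply iSup_le
  intro s
  obtain ⟨n, hn⟩ : ∃ n, ∀ p ∈ s, p.1.length ≤ n :=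
    ⟨s.sup (fun p => p.1.length), fun p hp => Finset.le_sup (f := fun p => p.1.length) hp⟩
  calc ∑ p ∈ s, (if Walk nb S x p.2 p.1 then wt p.1 * ψ p.2 else 0)
      = ∑ p ∈ s, (if Walk nb S x p.2 p.1 ∧ p.1.length ≤ n then wt p.1 * ψ p.2 else 0) := by
        apply Finset.sum_congr rfl
        intro p hp
        simp [hn p hp]
    _ ≤ _ := ENNReal.sum_le_tsum s
    _ ≤ _ := key n x
    _ = φ x := if_pos hx

/-- Walk sum with fixed end point. -/
lemma walk_sum_to {V : Type*} (nb : Fin 4 → V → V) (S : Set V) (y : V) (φ : V → ℝ≥0∞)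
    (h : ∀ x ∈ S, 4⁻¹ * (if x = y then 1 else 0) +
      ∑ d, 4⁻¹ * (if nb d x ∈ S then φ (nb d x) else 0) ≤ φ x) (x : V) (hx : x ∈ S) :
    ∑' l : List V, (if Walk nb S x y l then wt l else 0) ≤ φ x := by
  refine le_trans ?_ (walk_sum nb S (fun x => if x = y then 1 else 0) φ h x hx)
  refine tsum_le_join _ _ (fun p : List V × V => p.1) ?_
  intro l hl
  have hw := (ite_ne_right_iff.1 hl).1
  exact ⟨(l, y), rfl, by simp [hw]⟩

end

section

/-! ### Signed graphs and their Green functions -/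

/-- A finite signed 4-regular graph with killing, satisfying the maximum principle. -/
structure SG (V : Type*) where
  nb : Fin 4 → V → V
  sg : Fin 4 → V → ℝ
  U : Finset V
  inv : Fin 4 → Fin 4
  sg_abs : ∀ d x, sg d x = 1 ∨ sg d x = -1
  inv_inv : ∀ d, inv (inv d) = d
  back : ∀ d x, x ∈ U → nb d x ∈ U → nb (inv d) (nb d x) = x
  sback : ∀ d x, x ∈ U → nb d x ∈ U → sg (inv d) (nb d x) = sg d x
  mp : ∀ m : V → ℝ, ∀ W ⊆ U, (∀ x ∉ W, m x ≤ 0) →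
    (∀ x ∈ W, m x ≤ ∑ d, 4⁻¹ * m (nb d x)) → ∀ x, m x ≤ 0

namespace SG

variable {V : Type*} (G : SG V)

/-- signed kernel -/
def K (f : V → ℝ) (x : V) : ℝ := ∑ d, G.sg d x * 4⁻¹ * f (G.nb d x)

lemma sg_mul_self (d x) : G.sg d x * G.sg d x = 1 := by
  rcases G.sg_abs d x with h | h <;> rw [h] <;> norm_num

lemma abs_sg (d x) : |G.sg d x| = 1 := by
  rcases G.sg_abs d x with h | h <;> rw [h] <;> norm_num

lemma abs_K_le (f : V → ℝ) (x : V) : |G.K f x| ≤ ∑ d, 4⁻¹ * |f (G.nb d x)| := by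
  unfold K
  refine (Finset.abs_sum_le_sum_abs _ _).trans (le_of_eq ?_)
  refine Finset.sum_congr rfl fun d _ => ?_
  rw [abs_mul, abs_mul, abs_sg]; norm_num

lemma uniq {W : Finset V} (hW : W ⊆ G.U) (f : V → ℝ) (h0 : ∀ x ∉ W, f x = 0)
    (h1 : ∀ x ∈ W, f x = G.K f x) : ∀ x, f x = 0 := by
  intro x
  have := G.mp (fun x => |f x|) W hW (fun x hx => by simp [h0 x hx])
    (fun x hx => by rw [h1 x hx]; exact G.abs_K_le f x) x
  exact abs_eq_zero.1 (le_antisymm this (abs_nonneg _))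

lemma exists_green {W : Finset V} (hW : W ⊆ G.U) (y : V) : ∃ f : V → ℝ, (∀ x ∉ W, f x = 0) ∧
    ∀ x ∈ W, f x = G.K f x + if x = y then 1 else 0 := by
  let ext : (W → ℝ) →ₗ[ℝ] (V → ℝ) :=
    { toFun := fun f v => if h : v ∈ W then f ⟨v, h⟩ else 0
      map_add' := by intro f g; ext v; by_cases h : v ∈ W <;> simp [h]
      map_smul' := by intro c f; ext v; by_cases h : v ∈ W <;> simp [h] }
  have ext0 : ∀ f x, x ∉ W → ext f x = 0 := by intro f x hx; simp [ext, hx]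
  have ext1 : ∀ f (x : W), ext f x = f x := by intro f x; simp [ext]
  let T : (W → ℝ) →ₗ[ℝ] (W → ℝ) :=
    { toFun := fun f x => f x - G.K (ext f) x
      map_add' := by
        intro f g; ext v
        simp only [map_add, Pi.add_apply, K, mul_add, Finset.sum_add_distrib]; ring
      map_smul' := by
        intro c f; ext v
        simp only [map_smul, Pi.smul_apply, K, smul_eq_mul, RingHom.id_apply, mul_sub,
          Finset.mul_sum]
        congr 1
        exact Finset.sum_congr rfl fun d _ => by ring }
  have hT : Function.Injective T := by
    rw [← LinearMap.ker_eq_bot, LinearMap.ker_eq_bot']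
    intro f hf
    have := G.uniq hW (ext f) (ext0 f) (fun x hx => by
      have := congrFun hf ⟨x, hx⟩
      simp only [T, LinearMap.coe_mk, AddHom.coe_mk, Pi.zero_apply] at this
      rw [ext1 f ⟨x, hx⟩]; linarith)
    ext x
    rw [← ext1 f x, this]; rfl
  obtain ⟨f, hf⟩ := LinearMap.injective_iff_surjective.1 hT (fun x => if x.1 = y then 1 else 0)
  refine ⟨ext f, ext0 f, fun x hx => ?_⟩
  have := congrFun hf ⟨x, hx⟩
  simp only [T, LinearMap.coe_mk, AddHom.coe_mk] at this
  rw [ext1 f ⟨x, hx⟩]; linarith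

/-- signed Green function -/
def g (W : Finset V) (x y : V) : ℝ :=
  if h : W ⊆ G.U ∧ y ∈ W then (G.exists_green h.1 y).choose x else 0

variable {G} {W : Finset V}


lemma g_eq (hW : W ⊆ G.U) {x y : V} (hx : x ∈ W) (hy : y ∈ W) :
    G.g W x y = G.K (fun x => G.g W x y) x + if x = y then 1 else 0 := by
  have := (G.exists_green hW y).choose_spec.2 x hx
  unfold g
  simpa [hW, hy] using this

lemma g_right {x y : V} (hy : y ∉ W) : G.g W x y = 0 := by
  simp [g, hy]

lemma g_left (hW : W ⊆ G.U) {x y : V} (hx : x ∉ W) : G.g W x y = 0 := by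
  by_cases hy : y ∈ W
  · have := (G.exists_green hW y).choose_spec.1 x hx
    unfold g
    simpa [hW, hy] using this
  · exact g_right hy

lemma g_unique (hW : W ⊆ G.U) (f : V → ℝ) {y : V} (hy : y ∈ W) (h0 : ∀ x ∉ W, f x = 0)
    (h1 : ∀ x ∈ W, f x = G.K f x + if x = y then 1 else 0) (x : V) : f x = G.g W x y := by
  have := G.uniq hW (fun x => f x - G.g W x y) (fun x hx => by simp [h0 x hx, g_left hW hx])
    (fun x hx => by
      rw [h1 x hx, g_eq hW hx hy]
      simp only [K, mul_sub, Finset.sum_sub_distrib]; ring) x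
  linarith

lemma K_symm (hW : W ⊆ G.U) (f h : V → ℝ) (hf : ∀ x ∉ W, f x = 0) (hh : ∀ x ∉ W, h x = 0) :
    ∑ x ∈ W, f x * G.K h x = ∑ x ∈ W, h x * G.K f x := by
  have e : ∀ f h : V → ℝ, (∀ x ∉ W, f x = 0) → (∀ x ∉ W, h x = 0) → ∑ x ∈ W, f x * G.K h x =
      ∑ p ∈ (W ×ˢ (Finset.univ : Finset (Fin 4))).filter (fun p => G.nb p.2 p.1 ∈ W),
        f p.1 * (G.sg p.2 p.1 * 4⁻¹ * h (G.nb p.2 p.1)) := by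
    intro f h hf hh
    rw [Finset.sum_filter_of_ne, Finset.sum_product]
    · simp only [K, Finset.mul_sum]
    · intro p _ hp
      by_contra hc
      apply hp
      rw [hh _ hc]; ring
  rw [e f h hf hh, e h f hh hf]
  refine Finset.sum_nbij' (fun p => (G.nb p.2 p.1, G.inv p.2)) (fun p => (G.nb p.2 p.1, G.inv p.2))
    ?_ ?_ ?_ ?_ ?_
  · rintro ⟨x, d⟩ h
    simp only [Finset.mem_filter, Finset.mem_product, Finset.mem_univ, and_true] at h ⊢
    exact ⟨h.2, by rw [G.back d x (hW h.1) (hW h.2)]; exact h.1⟩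
  · rintro ⟨x, d⟩ h
    simp only [Finset.mem_filter, Finset.mem_product, Finset.mem_univ, and_true] at h ⊢
    exact ⟨h.2, by rw [G.back d x (hW h.1) (hW h.2)]; exact h.1⟩
  · rintro ⟨x, d⟩ h
    simp only [Finset.mem_filter, Finset.mem_product, Finset.mem_univ, and_true] at h ⊢
    rw [G.back d x (hW h.1) (hW h.2), G.inv_inv]
  · rintro ⟨x, d⟩ h
    simp only [Finset.mem_filter, Finset.mem_product, Finset.mem_univ, and_true] at h ⊢
    rw [G.back d x (hW h.1) (hW h.2), G.inv_inv]
  · rintro ⟨x, d⟩ h'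
    simp only [Finset.mem_filter, Finset.mem_product, Finset.mem_univ, and_true] at h' ⊢
    rw [G.back d x (hW h'.1) (hW h'.2), G.sback d x (hW h'.1) (hW h'.2)]
    ring

lemma g_symm (hW : W ⊆ G.U) (x y : V) : G.g W x y = G.g W y x := by
  by_cases hx : x ∈ W
  swap
  · rw [g_left hW hx, g_right hx]
  by_cases hy : y ∈ W
  swap
  · rw [g_left hW hy, g_right hy]
  have h1 := K_symm hW (fun z => G.g W z x) (fun z => G.g W z y) (fun z hz => g_left hW hz)
    (fun z hz => g_left hW hz)
  have e : ∀ x y : V, x ∈ W → y ∈ W → ∑ z ∈ W, G.g W z x * G.K (fun z => G.g W z y) z =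
      ∑ z ∈ W, G.g W z x * G.g W z y - G.g W y x := by
    intro x y hx hy
    have : ∀ z ∈ W, G.g W z x * G.K (fun z => G.g W z y) z =
      G.g W z x * G.g W z y - if z = y then G.g W z x else 0 := by
      intro z hz
      have := g_eq hW hz hy
      by_cases hzy : z = y
      · simp only [hzy, if_true] at this ⊢
        rw [show G.K (fun z => G.g W z y) y = G.g W y y - 1 by linarith]; ring
      · simp only [hzy, if_false] at this ⊢
        rw [this]; simp
    rw [Finset.sum_congr rfl this, Finset.sum_sub_distrib, Finset.sum_ite_eq' W y, if_pos hy]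
  rw [e x y hx hy, e y x hy hx] at h1
  have : ∑ z ∈ W, G.g W z x * G.g W z y = ∑ z ∈ W, G.g W z y * G.g W z x :=
    Finset.sum_congr rfl fun z _ => mul_comm _ _
  linarith

lemma g_pos (hW : W ⊆ G.U) {a : V} (ha : a ∈ W) : 0 < G.g W a a := by
  by_contra hc
  push Not at hc
  have h := G.mp (fun x => |G.g W x a|) W hW (fun x hx => by simp [g_left hW hx]) (fun x hx => by
    have e := g_eq hW hx ha
    have k := G.abs_K_le (fun x => G.g W x a) x
    by_cases hxa : x = a
    · subst hxa
      simp only [if_true] at e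
      rw [abs_of_nonpos hc]
      have := neg_abs_le (G.K (fun z => G.g W z x) x)
      linarith
    · simp only [hxa, if_false, add_zero] at e
      rw [e]; exact k)
  have z : ∀ x, G.g W x a = 0 := fun x => abs_eq_zero.1 (le_antisymm (h x) (abs_nonneg _))
  have := g_eq hW ha ha
  simp [z, K] at this

lemma erase_sub (hW : W ⊆ G.U) (a : V) : W.erase a ⊆ G.U := (Finset.erase_subset _ _).trans hW

lemma g_del (hW : W ⊆ G.U) {a y : V} (ha : a ∈ W) (hy : y ≠ a) (x : V) :
    G.g W x y = G.g (W.erase a) x y + G.g W x a * G.g W a y / G.g W a a := by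
  by_cases hyW : y ∈ W
  swap
  · rw [g_right hyW, g_right hyW, g_right (fun h => hyW (Finset.mem_of_mem_erase h))]; simp
  have hp := g_pos hW ha
  have := g_unique (erase_sub hW a)
    (fun x => G.g W x y - G.g W x a * (G.g W a y / G.g W a a)) (y := y)
    (Finset.mem_erase.2 ⟨hy, hyW⟩) ?_ ?_ x
  · rw [← this]; ring
  · intro x hx
    by_cases hxa : x = a
    · subst hxa; field_simp; ring
    · have : x ∉ W := fun h => hx (Finset.mem_erase.2 ⟨hxa, h⟩)
      simp [g_left hW this]
  · intro x hx
    have hxa := (Finset.mem_erase.1 hx).1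
    have hxW := (Finset.mem_erase.1 hx).2
    have e1 := g_eq hW hxW hyW
    have e2 := g_eq hW hxW ha
    simp only [hxa, if_false, add_zero] at e2
    rw [e1, e2]
    simp only [K, mul_sub, Finset.sum_sub_distrib, Finset.sum_mul]
    simp only [mul_assoc]
    ring

lemma g_diag_erase (hW : W ⊆ G.U) (a b : V) : G.g (W.erase b) a a ≤ G.g W a a := by
  by_cases hb : b ∈ W
  swap
  · rw [Finset.erase_eq_of_notMem hb]
  by_cases hab : a = b
  · subst hab
    rw [g_right (by simp)]
    exact (g_pos hW hb).le
  rw [g_del hW hb hab a, g_symm hW b a]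
  have := div_nonneg (mul_self_nonneg (G.g W a b)) (g_pos hW hb).le
  linarith

lemma g_diag_mono (hW : W ⊆ G.U) {T : Finset V} (hT : T ⊆ W) (a : V) : G.g T a a ≤ G.g W a a := by
  induction h : (W \ T).card generalizing W with
  | zero =>
    have : W = T := by
      apply Finset.Subset.antisymm _ hT
      rw [Finset.card_eq_zero, Finset.sdiff_eq_empty_iff_subset] at h
      exact h
    rw [this]
  | succ n ih =>
    have : (W \ T).Nonempty := by rw [← Finset.card_pos]; omega
    obtain ⟨b, hb⟩ := this
    have hb' := Finset.mem_sdiff.1 hb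
    refine (ih (W := W.erase b) (erase_sub hW b)
      (fun x hx => Finset.mem_erase.2 ⟨fun e => hb'.2 (e ▸ hx), hT hx⟩) ?_).trans
      (g_diag_erase hW a b)
    rw [Finset.erase_sdiff_comm, Finset.card_erase_of_mem hb, h]; rfl

lemma g_step (hW : W ⊆ G.U) {a b : V} (ha : a ∈ W) (hb : b ∈ W) (hab : b ≠ a) :
    G.g W a b = G.g W a a * ∑ d, G.sg d a * 4⁻¹ * G.g (W.erase a) (G.nb d a) b := by
  have hp := g_pos hW ha
  have e := g_eq hW ha hb
  have e2 := g_eq hW ha ha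
  simp only [hab.symm, if_false, add_zero, if_true] at e e2
  have h1 : G.K (fun x => G.g W x b) a = (∑ d, G.sg d a * 4⁻¹ * G.g (W.erase a) (G.nb d a) b) +
      G.K (fun x => G.g W x a) a * (G.g W a b / G.g W a a) := by
    simp only [K, Finset.sum_mul]
    rw [← Finset.sum_add_distrib]
    refine Finset.sum_congr rfl fun d _ => ?_
    rw [g_del hW ha hab (G.nb d a)]; ring
  have h2 : G.K (fun x => G.g W x a) a = G.g W a a - 1 := by linarith
  rw [h2] at h1
  rw [← e] at h1
  have : G.g W a b / G.g W a a = ∑ d, G.sg d a * 4⁻¹ * G.g (W.erase a) (G.nb d a) b := by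
    have : (G.g W a a - 1) * (G.g W a b / G.g W a a) = G.g W a b - G.g W a b / G.g W a a := by
      field_simp
    linarith
  rw [← this]; field_simp

end SG

end

section

namespace SG

variable {V : Type*}

/-- signed walks -/
inductive SW (G : SG V) (S : Set V) : V → V → List V → ℝ → Prop
  | one {x : V} : x ∈ S → SW G S x x [x] 1
  | cons {x y : V} {l : List V} {s : ℝ} (d : Fin 4) : x ∈ S → SW G S (G.nb d x) y l s →
      SW G S x y (x :: l) (G.sg d x * s)

variable {G : SG V} {S T : Set V} {a b c : V} {l l' : List V} {s s' : ℝ}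

lemma SW.walk (h : SW G S a b l s) : Walk G.nb S a b l := by
  induction h with
  | one h => exact .one h
  | cons d h _ ih => exact .cons d h ih

lemma SW.abs (h : SW G S a b l s) : s = 1 ∨ s = -1 := by
  induction h with
  | one h => simp
  | @cons x y l s d h _ ih =>
    rcases G.sg_abs d x with h1 | h1 <;> rcases ih with h2 | h2 <;> simp [h1, h2]

lemma SW.of_walk (h : Walk G.nb S a b l) : ∃ s, SW G S a b l s := by
  induction h with
  | one h => exact ⟨1, .one h⟩
  | cons d h _ ih =>
    obtain ⟨s, hs⟩ := ih
    exact ⟨_, .cons d h hs⟩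

lemma SW.mono (h : SW G S a b l s) (hT : ∀ v ∈ l, v ∈ T) : SW G T a b l s := by
  induction h with
  | one h => exact .one (hT _ (by simp))
  | cons d h _ ih =>
    exact .cons d (hT _ (by simp)) (ih (fun v hv => hT v (by simp [hv])))

lemma SW.mono' (h : SW G S a b l s) (hT : S ⊆ T) : SW G T a b l s :=
  h.mono (fun v hv => hT (h.walk.mem v hv))

lemma SW.append {d : Fin 4} (h : SW G S a b l s) (h' : SW G S (G.nb d b) c l' s') :
    SW G S a c (l ++ l') (s * (G.sg d b * s')) := by
  induction h with
  | one h => rw [one_mul]; exact .cons d h h'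
  | cons d' h _ ih => rw [mul_assoc]; exact .cons d' h (ih h')

lemma SW.join (h : SW G S a b l s) (h' : SW G S b c l' s') :
    SW G S a c (l ++ l'.tail) (s * s') := by
  cases h' with
  | one h' => simpa using h
  | cons d hx h' => simpa using h.append h'

lemma bal_green {W : Finset V} (hW : W ⊆ G.U) {a b : V} (σ : ℝ) (hσ : σ = 1 ∨ σ = -1)
    (h : ∀ l s, SW G W a b l s → s = σ) : 0 ≤ σ * G.g W a b ∧
    ∑' l : List V, (if Walk G.nb W a b l then wt l else 0) ≤
      ENNReal.ofReal (σ * G.g W a b / 4) := by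
  by_cases hab : ∃ l s, SW G W a b l s
  swap
  · -- no walk
    have hsum : ∑' l : List V, (if Walk G.nb W a b l then wt l else 0) = 0 := by
      rw [ENNReal.tsum_eq_zero]
      intro l
      rw [if_neg]
      intro hl
      obtain ⟨s, hs⟩ := SW.of_walk hl
      exact hab ⟨l, s, hs⟩
    have hg : G.g W a b = 0 := by
      by_cases ha : a ∈ W
      swap
      · exact g_left hW ha
      by_cases hb : b ∈ W
      swap
      · exact g_right hb
      have hm := G.mp (fun x => if ∃ l s, SW G W a x l s then |G.g W x b| else 0) W hW
        (fun x hx => by simp [g_left hW hx]) (fun x hx => by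
          by_cases hr : ∃ l s, SW G W a x l s
          · rw [if_pos hr]
            have hxb : x ≠ b := by rintro rfl; exact hab hr
            have e := g_eq hW hx hb
            simp only [hxb, if_false, add_zero] at e
            rw [e]
            refine (G.abs_K_le _ x).trans (Finset.sum_le_sum fun d _ => ?_)
            by_cases hd : G.nb d x ∈ W
            · obtain ⟨l, s, hl⟩ := hr
              rw [if_pos ⟨_, _, hl.append (.one hd)⟩]
            · simp [g_left hW hd]
          · rw [if_neg hr]
            refine Finset.sum_nonneg fun d _ => ?_
            split_ifs <;> positivity) a
      rw [if_pos ⟨_, _, SW.one ha⟩] at hm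
      exact abs_eq_zero.1 (le_antisymm hm (abs_nonneg _))
    rw [hsum, hg]
    simp
  -- a walk exists
  have hb : b ∈ W := by obtain ⟨l, s, hl⟩ := hab; exact hl.walk.end_in
  let R : V → Prop := fun x => (∃ l s, SW G W a x l s) ∧ (∃ l s, SW G W x b l s)
  have hRW : ∀ x, R x → x ∈ W := by
    rintro x ⟨_, l, s, hl⟩; exact hl.walk.start_in
  have hRnb : ∀ x d, R x → G.nb d x ∈ W → R (G.nb d x) := by
    rintro x d hR hd
    have hx := hRW x hR
    obtain ⟨⟨l, s, hl⟩, l', s', hl'⟩ := hR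
    refine ⟨⟨_, _, hl.append (.one hd)⟩, ?_⟩
    rw [← G.back d x (hW hx) (hW hd)] at hl'
    exact ⟨_, _, .cons _ hd hl'⟩
  have huniq : ∀ x, R x → ∀ l s l' s', SW G W x b l s → SW G W x b l' s' → s = s' := by
    rintro x ⟨⟨l0, s0, h0⟩, _⟩ l s l' s' h1 h2
    have e1 := h _ _ (h0.join h1)
    have e2 := h _ _ (h0.join h2)
    rcases h0.abs with h3 | h3 <;> rw [h3] at e1 e2 <;> linarith
  let τ : V → ℝ := fun x => if hx : ∃ l s, SW G W x b l s then hx.choose_spec.choose else 0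
  have hτ : ∀ x, R x → ∀ l s, SW G W x b l s → s = τ x := by
    intro x hR l s hs
    have hx : ∃ l s, SW G W x b l s := ⟨l, s, hs⟩
    have := hx.choose_spec.choose_spec
    simp only [τ, hx, dif_pos]
    exact huniq x hR _ _ _ _ hs this
  have hRa : R a := by
    refine ⟨⟨_, _, .one ?_⟩, hab⟩
    obtain ⟨l, s, hl⟩ := hab; exact hl.walk.start_in
  have hRb : R b := ⟨hab, ⟨_, _, .one hb⟩⟩
  have hτb : τ b = 1 := (hτ b hRb _ _ (.one hb)).symm
  have hτa : τ a = σ := by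
    obtain ⟨l, s, hl⟩ := hab
    rw [← hτ a hRa l s hl]; exact h l s hl
  have hτd : ∀ x d, R x → G.nb d x ∈ W → τ x = G.sg d x * τ (G.nb d x) := by
    intro x d hR hd
    obtain ⟨l, s, hl⟩ := (hRnb x d hR hd).2
    rw [← hτ _ (hRnb x d hR hd) l s hl]
    exact (hτ x hR _ _ (.cons d (hRW x hR) hl)).symm
  have heq : ∀ x, R x → τ x * G.g W x b = (if x = b then 1 else 0) +
      ∑ d, 4⁻¹ * (if R (G.nb d x) then τ (G.nb d x) * G.g W (G.nb d x) b else 0) := by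
    intro x hR
    rw [g_eq hW (hRW x hR) hb, mul_add, add_comm]
    congr 1
    · by_cases hxb : x = b
      · simp [hxb, hτb]
      · simp [hxb]
    · rw [K, Finset.mul_sum]
      refine Finset.sum_congr rfl fun d _ => ?_
      by_cases hd : G.nb d x ∈ W
      · rw [if_pos (hRnb x d hR hd), hτd x d hR hd]
        have := G.sg_mul_self d x
        linear_combination (4⁻¹ * τ (G.nb d x) * G.g W (G.nb d x) b) * this
      · rw [if_neg (fun h => hd (hRW _ h)), g_left hW hd]; ring
  have hpos : ∀ x, R x → 0 ≤ τ x * G.g W x b := by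
    intro x hR
    have := G.mp (fun x => if R x then - (τ x * G.g W x b) else 0) W hW (fun x hx => by
      rw [if_neg (fun h => hx (hRW x h))]) (fun x hx => by
      by_cases hR : R x
      · rw [if_pos hR, heq x hR]
        have : ∑ d, 4⁻¹ * (if R (G.nb d x) then -(τ (G.nb d x) * G.g W (G.nb d x) b) else 0) =
          - ∑ d, 4⁻¹ * (if R (G.nb d x) then τ (G.nb d x) * G.g W (G.nb d x) b else 0) := by
          rw [← Finset.sum_neg_distrib]
          refine Finset.sum_congr rfl fun d _ => ?_
          split_ifs <;> ring
        rw [this]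
        have : (0:ℝ) ≤ if x = b then 1 else 0 := by split_ifs <;> norm_num
        linarith
      · rw [if_neg hR]
        refine Finset.sum_nonneg fun d _ => ?_
        rw [if_neg]
        · simp
        intro hR'
        apply hR
        have hd := hRW _ hR'
        have := hRnb _ (G.inv d) hR' (by rw [G.back d x (hW hx) (hW hd)]; exact hx)
        rwa [G.back d x (hW hx) (hW hd)] at this) x
    rw [if_pos hR] at this
    linarith
  have h0 := hpos a hRa
  rw [hτa] at h0
  refine ⟨h0, ?_⟩
  have := walk_sum_to G.nb W b (fun x => if R x then ENNReal.ofReal (τ x * G.g W x b / 4) else ⊤)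
    (fun x hx => by
      by_cases hR : R x
      · rw [if_pos hR, heq x hR]
        have h4 : (4:ℝ≥0∞)⁻¹ = ENNReal.ofReal (4⁻¹) := by
          rw [ENNReal.ofReal_inv_of_pos (by norm_num)]; norm_num
        have e1 : ∀ d, (4:ℝ≥0∞)⁻¹ * (if G.nb d x ∈ (W : Set V) then (if R (G.nb d x) then
            ENNReal.ofReal (τ (G.nb d x) * G.g W (G.nb d x) b / 4) else ⊤) else 0) =
            ENNReal.ofReal (4⁻¹ *
              ((if R (G.nb d x) then τ (G.nb d x) * G.g W (G.nb d x) b else 0) / 4)) := by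
          intro d
          by_cases hd : G.nb d x ∈ W
          · have := hRnb x d hR hd
            rw [if_pos (by simpa using hd), if_pos this, if_pos this, h4,
              ← ENNReal.ofReal_mul (by norm_num)]
          · rw [if_neg (by simpa using hd), if_neg (fun h => hd (hRW _ h))]; simp
        have e2 : (4:ℝ≥0∞)⁻¹ * (if x = b then 1 else 0) =
            ENNReal.ofReal (4⁻¹ * (if x = b then 1 else 0)) := by
          split_ifs
          · rw [mul_one, mul_one, h4]
          · simp
        have e3 : ∀ q r : ℝ≥0∞, q = r → ∀ y, r ≤ y → q ≤ y := fun q r h y => h ▸ id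
        rw [e2]
        refine e3 _ _ (congrArg₂ (· + ·) rfl (Finset.sum_congr rfl
          (fun d _ => Eq.trans (by congr) (e1 d)))) _ ?_
        rw [← ENNReal.ofReal_sum_of_nonneg,
          ← ENNReal.ofReal_add]
        · apply ENNReal.ofReal_le_ofReal
          rw [add_div, Finset.sum_div]
          apply le_of_eq
          congr 1
          · ring
          · exact Finset.sum_congr rfl fun d _ => by ring
        · split_ifs <;> norm_num
        · refine Finset.sum_nonneg fun d _ => ?_
          by_cases hR' : R (G.nb d x)
          · rw [if_pos hR']; have := hpos _ hR'; positivity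
          · rw [if_neg hR']; simp
        · intro d _
          by_cases hR' : R (G.nb d x)
          · rw [if_pos hR']; have := hpos _ hR'; positivity
          · rw [if_neg hR']; simp
      · rw [if_neg hR]; exact le_top) a (hRW a hRa)
  rw [if_pos hRa, hτa] at this
  exact this

/-- sign coherence of pairs of disjoint walks -/
structure Coh (G : SG V) (W : Finset V) (a a' b b' : V) (σ : ℝ) : Prop where
  par : ∀ X s Y s', SW G W a b X s → SW G W a' b' Y s' → X.Disjoint Y → s * s' = σ
  swp : ∀ X s Y s', SW G W a b' X s → SW G W a' b Y s' → X.Disjoint Y → s * s' = -σ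
  bal : ∀ X s Y s', (SW G W a b X s ∧ SW G W a' b' Y s' ∨ SW G W a b' X s ∧ SW G W a' b Y s') →
    X.Disjoint Y → ∀ C t, SW G (W.filter (· ∉ Y)) a a C t → t = 1

lemma Coh.swap {W : Finset V} {a a' b b' : V} {σ : ℝ} (h : Coh G W a a' b b' σ) :
    Coh G W a a' b' b (-σ) :=
  ⟨h.swp, fun X s Y s' h1 h2 h3 => by rw [neg_neg]; exact h.par X s Y s' h1 h2 h3,
    fun X s Y s' h1 h2 => h.bal X s Y s' h1.symm h2⟩

lemma Coh.step {W : Finset V} (hW : W ⊆ G.U) {a a' b b' : V} {σ : ℝ} (h : Coh G W a a' b b' σ)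
    (ha : a ∈ W) (d : Fin 4) : Coh G (W.erase a) (G.nb d a) a' b b' (G.sg d a * σ) := by
  have hsub : ((W.erase a : Finset V) : Set V) ⊆ (W : Set V) := by
    exact_mod_cast Finset.erase_subset a W
  have hd : ∀ {X Y : List V} {c c' : V} {s}, SW G (W.erase a : Finset V) c c' Y s → X.Disjoint Y →
      (a :: X).Disjoint Y := by
    intro X Y c c' s hY hXY
    rw [List.disjoint_cons_left]
    refine ⟨fun hc => ?_, hXY⟩
    have := hY.walk.mem a hc
    simp at this
  have hsq := G.sg_mul_self d a
  refine ⟨?_, ?_, ?_⟩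
  · intro X s Y s' hX hY hXY
    have := h.par (a :: X) _ Y _ (.cons d ha (hX.mono' hsub)) (hY.mono' hsub) (hd hY hXY)
    linear_combination G.sg d a * this - s * s' * hsq
  · intro X s Y s' hX hY hXY
    have := h.swp (a :: X) _ Y _ (.cons d ha (hX.mono' hsub)) (hY.mono' hsub) (hd hY hXY)
    linear_combination G.sg d a * this - s * s' * hsq
  · intro X s Y s' hXY hdis C t hC
    have hx := hC.walk.start_in
    simp only [Finset.coe_filter, Finset.mem_erase, Set.mem_ofPred_eq] at hx
    have haY : a ∉ Y := by
      rcases hXY with ⟨_, h2⟩ | ⟨_, h2⟩ <;> intro hc <;> have := h2.walk.mem a hc <;> simp at this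
    have haW : a ∈ ((W.filter (· ∉ Y) : Finset V) : Set V) := by simp [ha, haY]
    have hsub2 : (((W.erase a).filter (· ∉ Y) : Finset V) : Set V) ⊆
        ((W.filter (· ∉ Y) : Finset V) : Set V) := by
      intro v; simp only [Finset.coe_filter, Finset.mem_erase, Set.mem_ofPred_eq]; tauto
    have hback := G.back d a (hW ha) (hW hx.1.2)
    have hsback := G.sback d a (hW ha) (hW hx.1.2)
    have hlast : SW G (W.filter (· ∉ Y) : Finset V) (G.nb (G.inv d) (G.nb d a)) a [a] 1 := by
      rw [hback]; exact .one haW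
    have hcl := SW.cons d haW ((hC.mono' hsub2).append hlast)
    have key : G.sg d a * (t * (G.sg (G.inv d) (G.nb d a) * 1)) = 1 := by
      rcases hXY with ⟨h1, h2⟩ | ⟨h1, h2⟩
      · exact h.bal (a :: X) _ Y _ (Or.inl ⟨.cons d ha (h1.mono' hsub), h2.mono' hsub⟩)
          (hd h2 hdis) _ _ hcl
      · exact h.bal (a :: X) _ Y _ (Or.inr ⟨.cons d ha (h1.mono' hsub), h2.mono' hsub⟩)
          (hd h2 hdis) _ _ hcl
    rw [hsback] at key
    linear_combination key - t * hsq

/-- mass of disjoint pairs of walks -/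
def N (G : SG V) (W : Finset V) (a b a' b' : V) : ℝ≥0∞ :=
  ∑' p : List V × List V, if Walk G.nb W a b p.1 ∧ Walk G.nb W a' b' p.2 ∧ p.1.Disjoint p.2 then
    wt p.1 * wt p.2 else 0

/-- the two by two determinant -/
def D (G : SG V) (W : Finset V) (a b a' b' : V) : ℝ :=
  G.g W a b * G.g W a' b' - G.g W a b' * G.g W a' b

lemma N_zero {W : Finset V} {a b a' b' : V} (h : a ∉ W ∨ a = a' ∨ b = b' ∨ a = b' ∨ a' = b) :
    N G W a b a' b' = 0 := by
  unfold N
  rw [ENNReal.tsum_eq_zero]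
  rintro ⟨X, Y⟩
  rw [if_neg]
  rintro ⟨h1, h2, h3⟩
  simp only at h1 h2 h3
  have e1 := h1.start_mem
  have e2 := h1.end_mem
  have e3 := h2.start_mem
  have e4 := h2.end_mem
  rcases h with h | h | h | h | h
  · exact h h1.start_in
  · subst h; exact h3 e1 e3
  · subst h; exact h3 e2 e4
  · subst h; exact h3 e1 e4
  · subst h; exact h3 e2 e3

lemma loop_sum {W : Finset V} (hW : W ⊆ G.U) {a a' b b' : V} {σ : ℝ} (h : Coh G W a a' b b' σ)
    {X Y : List V} (hX : Walk G.nb W a b X) (hY : Walk G.nb W a' b' Y) (hd : X.Disjoint Y) :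
    ∑' C : List V, (if Walk G.nb (W.filter (· ∉ Y) : Finset V) a a C then wt C else 0) ≤
      ENNReal.ofReal (G.g W a a / 4) := by
  obtain ⟨s, hs⟩ := SW.of_walk hX
  obtain ⟨s', hs'⟩ := SW.of_walk hY
  have hsub : W.filter (· ∉ Y) ⊆ W := Finset.filter_subset _ _
  refine (bal_green (hsub.trans hW) 1 (Or.inl rfl)
    (fun l t hl => h.bal X s Y s' (Or.inl ⟨hs, hs'⟩) hd l t hl)).2.trans ?_
  apply ENNReal.ofReal_le_ofReal
  have := g_diag_mono hW hsub a
  linarith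

lemma N_step {W : Finset V} (hW : W ⊆ G.U) {a a' b b' : V} {σ : ℝ} (h : Coh G W a a' b b' σ)
    (hab : a ≠ b) : N G W a b a' b' ≤
      ∑ d, ENNReal.ofReal (G.g W a a / 4) * N G (W.erase a) (G.nb d a) b a' b' := by
  by_cases ha : a ∈ W
  swap
  · rw [N_zero (Or.inl ha)]; exact zero_le
  let F : Fin 4 × ((List V × List V) × List V) → ℝ≥0∞ := fun q =>
    (if Walk G.nb (W.erase a : Finset V) (G.nb q.1 a) b q.2.1.1 ∧
      Walk G.nb (W.erase a : Finset V) a' b' q.2.1.2 ∧ q.2.1.1.Disjoint q.2.1.2 then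
      wt q.2.1.1 * wt q.2.1.2 else 0) *
    (if Walk G.nb (W.filter (· ∉ q.2.1.2) : Finset V) a a q.2.2 then wt q.2.2 else 0)
  refine (tsum_le_join _ F (fun q => (q.2.2 ++ q.2.1.1, q.2.1.2)) ?_).trans ?_
  · rintro ⟨X, Y⟩ hne
    have hc := (ite_ne_right_iff.1 hne).1
    rw [if_pos hc]
    obtain ⟨h1, h2, h3⟩ := hc
    simp only at h1 h2 h3
    obtain ⟨C, d, X', rfl, hC, hX'⟩ := (h1.last_visit hab).1 h1.start_mem
    have haY : a ∉ Y := fun hc => h3 h1.start_mem hc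
    have e1 : Walk G.nb (W.erase a : Finset V) (G.nb d a) b X' := hX'.mono' (by simp)
    have e2 : Walk G.nb (W.erase a : Finset V) a' b' Y := h2.mono (fun v hv => by
      have := h2.mem v hv
      simp only [Finset.coe_erase, Set.mem_sdiff, Set.mem_singleton_iff]
      exact ⟨this, fun e => haY (e ▸ hv)⟩)
    have e3 : X'.Disjoint Y := (List.disjoint_append_left.1 h3).2
    have e4 : Walk G.nb (W.filter (· ∉ Y) : Finset V) a a C := hC.mono (fun v hv => by
      have := hC.mem v hv
      simp only [Finset.coe_filter, Set.mem_ofPred_eq]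
      exact ⟨this, fun e => (List.disjoint_append_left.1 h3).1 hv e⟩)
    refine ⟨(d, ((X', Y), C)), rfl, ?_⟩
    simp only [F]
    rw [if_pos ⟨e1, e2, e3⟩, if_pos e4, wt_append]
    apply le_of_eq; ring
  · rw [ENNReal.tsum_prod', tsum_fintype]
    refine Finset.sum_le_sum fun d _ => ?_
    rw [ENNReal.tsum_prod', N, ← ENNReal.tsum_mul_left]
    refine ENNReal.tsum_le_tsum ?_
    rintro ⟨X, Y⟩
    simp only [F]
    rw [ENNReal.tsum_mul_left]
    by_cases hc : Walk G.nb (W.erase a : Finset V) (G.nb d a) b X ∧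
      Walk G.nb (W.erase a : Finset V) a' b' Y ∧ X.Disjoint Y
    · rw [if_pos hc, mul_comm]
      gcongr
      have hsub : ((W.erase a : Finset V) : Set V) ⊆ (W : Set V) := by
        exact_mod_cast Finset.erase_subset a W
      refine loop_sum hW h (X := a :: X) (.cons d ha (hc.1.mono' hsub)) (hc.2.1.mono' hsub) ?_
      rw [List.disjoint_cons_left]
      refine ⟨fun hc' => ?_, hc.2.2⟩
      have := hc.2.1.mem a hc'
      simp at this
    · rw [if_neg hc]; simp

lemma D_base {W : Finset V} (hW : W ⊆ G.U) {b a' b' : V} (hb : b ∈ W) (hbb : b' ≠ b) :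
    D G W b b a' b' = G.g W b b * G.g (W.erase b) a' b' := by
  unfold D
  rw [g_del hW hb hbb a']
  have := g_pos hW hb
  field_simp
  ring

lemma N_base {W : Finset V} (hW : W ⊆ G.U) {b a' b' : V} {σ : ℝ} (hσ : σ = 1 ∨ σ = -1)
    (h : Coh G W b a' b b' σ) (hb : b ∈ W) (hbb : b' ≠ b) : 0 ≤ σ * D G W b b a' b' ∧
      N G W b b a' b' ≤ ENNReal.ofReal (σ * D G W b b a' b' / 16) := by
  have hp := g_pos hW hb
  have hsub : ((W.erase b : Finset V) : Set V) ⊆ (W : Set V) := by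
    exact_mod_cast Finset.erase_subset b W
  have hdis : ∀ Y : List V, Walk G.nb (W.erase b : Finset V) a' b' Y → [b].Disjoint Y := by
    intro Y hY
    rw [List.singleton_disjoint]
    intro hc
    have := hY.mem b hc
    simp at this
  obtain ⟨h1, h2⟩ := bal_green (erase_sub hW b) (a := a') (b := b') σ hσ (fun l s hl => by
    have := h.par [b] 1 l s (.one hb) (hl.mono' hsub) (hdis l hl.walk)
    linarith)
  rw [D_base hW hb hbb]
  refine ⟨by nlinarith [mul_nonneg hp.le h1], ?_⟩
  let F : List V × List V → ℝ≥0∞ := fun q =>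
    (if Walk G.nb (W.erase b : Finset V) a' b' q.1 then wt q.1 else 0) *
    (if Walk G.nb (W.filter (· ∉ q.1) : Finset V) b b q.2 then wt q.2 else 0)
  refine (tsum_le_join _ F (fun q => (q.2, q.1)) ?_).trans ?_
  · rintro ⟨X, Y⟩ hne
    have hc := (ite_ne_right_iff.1 hne).1
    rw [if_pos hc]
    obtain ⟨h1, h2, h3⟩ := hc
    simp only at h1 h2 h3
    refine ⟨(Y, X), rfl, ?_⟩
    have e2 : Walk G.nb (W.erase b : Finset V) a' b' Y := h2.mono (fun v hv => by
      have := h2.mem v hv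
      simp only [Finset.coe_erase, Set.mem_sdiff, Set.mem_singleton_iff]
      exact ⟨this, fun e => h3 h1.start_mem (e ▸ hv)⟩)
    have e4 : Walk G.nb (W.filter (· ∉ Y) : Finset V) b b X := h1.mono (fun v hv => by
      have := h1.mem v hv
      simp only [Finset.coe_filter, Set.mem_ofPred_eq]
      exact ⟨this, fun e => h3 hv e⟩)
    simp only [F]
    rw [if_pos e2, if_pos e4]
    apply le_of_eq; ring
  · rw [ENNReal.tsum_prod']
    calc ∑' Y, ∑' X, F (Y, X) ≤ ∑' Y, ENNReal.ofReal (G.g W b b / 4) *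
          (if Walk G.nb (W.erase b : Finset V) a' b' Y then wt Y else 0) := by
          refine ENNReal.tsum_le_tsum fun Y => ?_
          simp only [F]
          rw [ENNReal.tsum_mul_left]
          by_cases hc : Walk G.nb (W.erase b : Finset V) a' b' Y
          · rw [if_pos hc, mul_comm]
            gcongr
            exact loop_sum hW h (.one hb) (hc.mono' hsub) (hdis Y hc)
          · rw [if_neg hc]; simp
      _ ≤ ENNReal.ofReal (G.g W b b / 4) * ENNReal.ofReal (σ * G.g (W.erase b) a' b' / 4) := by
          rw [ENNReal.tsum_mul_left]
          gcongr
      _ = _ := by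
          rw [← ENNReal.ofReal_mul (by positivity)]
          congr 1; ring

/-- Fomin-type inequality. -/
theorem fomin {W : Finset V} (hW : W ⊆ G.U) {a a' b b' : V} {σ : ℝ} (hσ : σ = 1 ∨ σ = -1)
    (h : Coh G W a a' b b' σ) : 0 ≤ σ * D G W a b a' b' ∧
    N G W a b a' b' + N G W a b' a' b ≤ ENNReal.ofReal (σ * D G W a b a' b' / 16) := by
  induction hn : W.card generalizing W a σ with
  | zero =>
    have : W = ∅ := Finset.card_eq_zero.1 hn
    subst this
    rw [N_zero (Or.inl (by simp)), N_zero (Or.inl (by simp))]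
    simp [D, g]
  | succ n ih =>
    by_cases ha : a ∈ W
    swap
    · rw [N_zero (Or.inl ha), N_zero (Or.inl ha), D, g_left hW ha, g_left hW ha]; simp
    by_cases haa : a = a'
    · rw [N_zero (Or.inr (Or.inl haa)), N_zero (Or.inr (Or.inl haa)), D, haa]
      simp [mul_comm]
    by_cases hbb : b = b'
    · rw [N_zero (Or.inr (Or.inr (Or.inl hbb))), N_zero (Or.inr (Or.inr (Or.inl hbb.symm))), D, hbb]
      simp
    by_cases hab : a = b
    · subst hab
      rw [N_zero (a := a) (b := b') (a' := a') (b' := a) (by tauto), add_zero]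
      exact N_base hW hσ h ha (Ne.symm hbb)
    by_cases hab' : a = b'
    · subst hab'
      rw [N_zero (a := a) (b := b) (a' := a') (b' := a) (by tauto), zero_add]
      have := N_base hW (σ := -σ) (by rcases hσ with h | h <;> simp [h]) h.swap ha hbb
      have e : D G W a b a' a = - D G W a a a' b := by unfold D; ring
      rw [e, show σ * -D G W a a a' b = -σ * D G W a a a' b by ring]
      exact this
    have hp := g_pos hW ha
    have hcard : (W.erase a).card = n := by rw [Finset.card_erase_of_mem ha, hn]; rfl
    have IH := fun d => ih (erase_sub hW a) (a := G.nb d a) (σ := G.sg d a * σ) (by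
      rcases G.sg_abs d a with h1 | h1 <;> rcases hσ with h2 | h2 <;> simp [h1, h2])
      (h.step hW ha d) hcard
    have hD : D G W a b a' b' =
        G.g W a a * ∑ d, G.sg d a * 4⁻¹ * D G (W.erase a) (G.nb d a) b a' b' := by
      by_cases hbW : b ∈ W
      swap
      · have : b ∉ W.erase a := fun h => hbW (Finset.mem_of_mem_erase h)
        simp [D, g_right hbW, g_right this]
      by_cases hbW' : b' ∈ W
      swap
      · have : b' ∉ W.erase a := fun h => hbW' (Finset.mem_of_mem_erase h)
        simp [D, g_right hbW', g_right this]
      have e1 := g_del hW ha (Ne.symm hab) a'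
      have e2 := g_del hW ha (Ne.symm hab') a'
      have s1 := g_step hW ha hbW (Ne.symm hab)
      have s2 := g_step hW ha hbW' (Ne.symm hab')
      have : D G W a b a' b' = G.g W a b * G.g (W.erase a) a' b' -
          G.g W a b' * G.g (W.erase a) a' b := by
        unfold D
        rw [e1, e2]; ring
      rw [this, s1, s2]
      simp only [D, mul_sub, Finset.sum_sub_distrib]
      simp only [mul_assoc, Finset.sum_mul]
    have hpos : 0 ≤ σ * D G W a b a' b' := by
      rw [hD]
      have : σ * (G.g W a a * ∑ d, G.sg d a * 4⁻¹ * D G (W.erase a) (G.nb d a) b a' b') =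
        G.g W a a * ∑ d, 4⁻¹ * (G.sg d a * σ * D G (W.erase a) (G.nb d a) b a' b') := by
        simp only [Finset.mul_sum]
        exact Finset.sum_congr rfl fun d _ => by ring
      rw [this]
      exact mul_nonneg hp.le (Finset.sum_nonneg fun d _ => mul_nonneg (by norm_num) (IH d).1)
    refine ⟨hpos, ?_⟩
    calc N G W a b a' b' + N G W a b' a' b
        ≤ ∑ d, ENNReal.ofReal (G.g W a a / 4) * N G (W.erase a) (G.nb d a) b a' b' +
          ∑ d, ENNReal.ofReal (G.g W a a / 4) * N G (W.erase a) (G.nb d a) b' a' b :=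
          add_le_add (N_step hW h hab) (N_step hW h.swap hab')
      _ = ∑ d, ENNReal.ofReal (G.g W a a / 4) * (N G (W.erase a) (G.nb d a) b a' b' +
          N G (W.erase a) (G.nb d a) b' a' b) := by
          rw [← Finset.sum_add_distrib]
          exact Finset.sum_congr rfl fun d _ => by ring
      _ ≤ ∑ d, ENNReal.ofReal (G.g W a a / 4) *
          ENNReal.ofReal (G.sg d a * σ * D G (W.erase a) (G.nb d a) b a' b' / 16) := by
          refine Finset.sum_le_sum fun d _ => ?_
          gcongr
          exact (IH d).2
      _ = ∑ d, ENNReal.ofReal (G.g W a a / 4 *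
          (G.sg d a * σ * D G (W.erase a) (G.nb d a) b a' b' / 16)) := by
          refine Finset.sum_congr rfl fun d _ => ?_
          rw [← ENNReal.ofReal_mul (by positivity)]
      _ = ENNReal.ofReal (∑ d, G.g W a a / 4 *
          (G.sg d a * σ * D G (W.erase a) (G.nb d a) b a' b' / 16)) := by
          rw [ENNReal.ofReal_sum_of_nonneg]
          intro d _
          have := (IH d).1
          positivity
      _ = _ := by
          congr 1
          rw [hD]
          simp only [Finset.mul_sum, Finset.sum_div]
          exact Finset.sum_congr rfl fun d _ => by ring

end SG

end

section

/-! ### A crossing lemma for planar curves -/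

lemma edge_arg {f L : ℝ → ℂ} {c : ℂ} (hc : c ≠ 0) (hf : Continuous f) (hL : Continuous L)
    (hfL : ∀ t, Complex.exp (L t) = f t) (hre : ∀ t, 0 ≤ (c * f t).re) :
    (L 1).im - (L 0).im = Complex.arg (c * f 1) - Complex.arg (c * f 0) := by
  have hne : ∀ t, c * f t ≠ 0 := fun t => mul_ne_zero hc (by rw [← hfL]; exact Complex.exp_ne_zero _)
  have hsl : ∀ t, c * f t ∈ Complex.slitPlane := by
    intro t
    rw [Complex.mem_slitPlane_iff]
    by_contra hcon
    push Not at hcon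
    exact hne t (Complex.ext (le_antisymm hcon.1 (hre t)) hcon.2)
  have hh : Continuous (fun t => L t - Complex.log (c * f t)) := by
    refine hL.sub ?_
    refine Continuous.clog (by fun_prop) hsl
  have hexp : ∀ t, Complex.exp (L t - Complex.log (c * f t)) = c⁻¹ := by
    intro t
    rw [Complex.exp_sub, hfL, Complex.exp_log (hne t)]
    have := hne t
    have h2 := right_ne_zero_of_mul this
    field_simp
  have hd : DiscreteTopology (Complex.exp ⁻¹' {c⁻¹}) :=
    (Complex.isCoveringMapOn_exp c⁻¹ (by simpa using hc)).1
  have := isPreconnected_univ.constant_of_mapsTo (S := (univ : Set ℝ)) (T := Complex.exp ⁻¹' {c⁻¹}) ⟨hd⟩ hh.continuousOn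
    (fun t _ => hexp t) (mem_univ 1) (mem_univ 0)
  have := congrArg Complex.im this
  simp only [Complex.sub_im, Complex.log_im] at this
  linarith

lemma corner_arg {x : ℂ} (h1 : 0 ≤ x.re) (h2 : 0 ≤ x.im) (h0 : x ≠ 0) :
    Complex.arg (-Complex.I * x) = Complex.arg x - Real.pi / 2 := by
  have hp := Real.pi_pos
  have ha : 0 ≤ x.arg := Complex.arg_nonneg_iff.2 h2
  have ha' : x.arg ≤ Real.pi / 2 := Complex.arg_le_pi_div_two_iff.2 (Or.inl h1)
  rw [Complex.arg_mul (by simp) h0]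
  · simp; ring
  · simp; constructor <;> linarith

theorem crossing {S T : Set ℂ} {α β γ δ : ℂ} (h1 : JoinedIn S α β) (h2 : JoinedIn T γ δ)
    (hT : ∀ z ∈ T, α.re ≤ z.re ∧ z.re ≤ β.re) (hS : ∀ z ∈ S, γ.im ≤ z.im ∧ z.im ≤ δ.im) :
    (S ∩ T).Nonempty := by
  by_contra hcon
  obtain ⟨φ, hφ⟩ := h1
  obtain ⟨ψ, hψ⟩ := h2
  have eφ : ∀ s : ℝ, φ.extend s ∈ S := fun s => hφ _
  have eψ : ∀ s : ℝ, ψ.extend s ∈ T := fun s => hψ _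
  set D : ℝ × ℝ → ℂ := fun p => φ.extend p.1 - ψ.extend p.2 with hD
  have hDc : Continuous D := (φ.continuous_extend.comp continuous_fst).sub
    (ψ.continuous_extend.comp continuous_snd)
  have hD0 : ∀ p, D p ≠ 0 := by
    intro p hp
    apply hcon
    refine ⟨φ.extend p.1, eφ _, ?_⟩
    rw [sub_eq_zero.1 hp]; exact eψ _
  have huni : IsSimplyConnected (univ : Set (ℝ × ℝ)) := by
    have : ContractibleSpace (univ : Set (ℝ × ℝ)) := convex_univ.contractibleSpace ⟨0, mem_univ 0⟩
    exact SimplyConnectedSpace.ofContractible _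
  obtain ⟨L, hLc, hL⟩ := Complex.exists_continuousOn_eqOn_exp_comp huni isOpen_univ hDc.continuousOn
    (by rintro ⟨p, -, hp⟩; exact hD0 p hp)
  rw [continuousOn_univ] at hLc
  have hL' : ∀ p, Complex.exp (L p) = D p := fun p => hL (mem_univ p)
  have e1 := edge_arg (f := fun s => D (s, 0)) (L := fun s => L (s, 0)) (c := -Complex.I) (by simp)
    (by fun_prop) (by fun_prop) (fun t => hL' _) (by
      intro t; have := (hS _ (eφ t)).1; simp [hD]; linarith)
  have e2 := edge_arg (f := fun s => D (1, s)) (L := fun s => L (1, s)) (c := 1) (by simp)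
    (by fun_prop) (by fun_prop) (fun t => hL' _) (by
      intro t; have := (hT _ (eψ t)).2; simp [hD]; linarith)
  have e3 := edge_arg (f := fun s => D (s, 1)) (L := fun s => L (s, 1)) (c := Complex.I) (by simp)
    (by fun_prop) (by fun_prop) (fun t => hL' _) (by
      intro t; have := (hS _ (eφ t)).2; simp [hD]; linarith)
  have e4 := edge_arg (f := fun s => D (0, s)) (L := fun s => L (0, s)) (c := -1) (by simp)
    (by fun_prop) (by fun_prop) (fun t => hL' _) (by
      intro t; have := (hT _ (eψ t)).1; simp [hD]; linarith)
  have hα := hS _ (eφ 0)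
  have hβ := hS _ (eφ 1)
  have hγ := hT _ (eψ 0)
  have hδ := hT _ (eψ 1)
  have dA : D (0, 0) = α - γ := by simp [hD]
  have dB : D (1, 0) = β - γ := by simp [hD]
  have dC : D (1, 1) = β - δ := by simp [hD]
  have dE : D (0, 1) = α - δ := by simp [hD]
  simp only [Path.extend_zero, Path.extend_one] at hα hβ hγ hδ
  have nA := hD0 (0, 0)
  have nB := hD0 (1, 0)
  have nC := hD0 (1, 1)
  have nE := hD0 (0, 1)
  simp only [dA, dB, dC, dE] at e1 e2 e3 e4 nA nB nC nE
  have c1 := corner_arg (x := β - γ) (by simp; linarith) (by simp; linarith) nB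
  have c2 := corner_arg (x := Complex.I * (β - δ)) (by simp; linarith) (by simp; linarith)
    (mul_ne_zero Complex.I_ne_zero nC)
  have c3 := corner_arg (x := -1 * (α - δ)) (by simp; linarith) (by simp; linarith)
    (mul_ne_zero (by simp) nE)
  have c4 := corner_arg (x := -Complex.I * (α - γ)) (by simp; linarith) (by simp; linarith)
    (mul_ne_zero (by simp) nA)
  have i1 : -Complex.I * (Complex.I * (β - δ)) = 1 * (β - δ) := by
    rw [← mul_assoc]; simp
  have i2 : -Complex.I * (-1 * (α - δ)) = Complex.I * (α - δ) := by ring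
  have i3 : -Complex.I * (-Complex.I * (α - γ)) = -1 * (α - γ) := by
    rw [← mul_assoc]; simp
  rw [i1] at c2
  rw [i2] at c3
  rw [i3] at c4
  have := Real.pi_pos
  rw [one_mul] at e2 c2
  rw [one_mul] at e2
  linarith

end

section

/-! ### The double cover of the punctured lattice -/

/-- squared Euclidean norm -/
def nsq (z : Lat) : ℤ := z.1 ^ 2 + z.2 ^ 2

/-- lattice points as complex numbers -/
def toC (z : Lat) : ℂ := ⟨z.1, z.2⟩

/-- the four directions -/
def dirs : Fin 4 → Lat := ![(1, 0), (-1, 0), (0, 1), (0, -1)]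

/-- opposite direction -/
def dinv : Fin 4 → Fin 4 := ![1, 0, 3, 2]

/-- directions as complex numbers -/
def dC (d : Fin 4) : ℂ := toC (dirs d)

lemma toC_add (z w : Lat) : toC (z + w) = toC z + toC w := by
  apply Complex.ext <;> simp [toC]

lemma toC_inj {z w : Lat} (h : toC z = toC w) : z = w := by
  have h1 := congrArg Complex.re h
  have h2 := congrArg Complex.im h
  simp only [toC] at h1 h2
  exact Prod.ext (by exact_mod_cast h1) (by exact_mod_cast h2)

lemma dirs_dinv (d : Fin 4) : dirs (dinv d) = - dirs d := by
  fin_cases d <;> simp [dirs, dinv]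

lemma dinv_dinv (d : Fin 4) : dinv (dinv d) = d := by
  fin_cases d <;> simp [dinv]

lemma dC_dinv (d : Fin 4) : dC (dinv d) = - dC d := by
  rw [dC, dirs_dinv]; apply Complex.ext <;> simp [toC, dC]

lemma nsq_dirs (d : Fin 4) : nsq (dirs d) = 1 := by
  fin_cases d <;> simp [dirs, nsq]

lemma norm_toC_sq (z : Lat) : ‖toC z‖ ^ 2 = nsq z := by
  rw [← Complex.normSq_eq_norm_sq, Complex.normSq_apply]
  simp [toC, nsq]; ring

lemma norm_dC (d : Fin 4) : ‖dC d‖ = 1 := by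
  have h := norm_toC_sq (dirs d)
  rw [nsq_dirs] at h
  have h0 := norm_nonneg (dC d)
  change ‖dC d‖ ^ 2 = _ at h
  push_cast at h
  nlinarith

/-- vertices of the double cover lying over lattice points at distance more than one -/
def Good (v : ℂ) (z : Lat) : Prop := v ^ 2 = toC z ∧ 1 < nsq z

lemma Good.unique {v : ℂ} {z w : Lat} (h : Good v z) (h' : Good v w) : z = w :=
  toC_inj (h.1.symm.trans h'.1)

lemma Good.norm {v : ℂ} {z : Lat} (h : Good v z) : 1 < ‖v ^ 2‖ := by
  have h1 := norm_toC_sq z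
  rw [← h.1] at h1
  have h2 : (1 : ℝ) < nsq z := by exact_mod_cast h.2
  have h0 := norm_nonneg (v ^ 2)
  nlinarith

lemma Good.ne {v : ℂ} {z : Lat} (h : Good v z) : v ≠ 0 := by
  rintro rfl
  have := h.norm
  norm_num at this

/-- the factor `1 + s d / v²` -/
def fac (v : ℂ) (d : Fin 4) (s : ℝ) : ℂ := 1 + s * dC d / v ^ 2

lemma Good.fac_re {v : ℂ} {z : Lat} (h : Good v z) (d : Fin 4) {s : ℝ} (h0 : 0 ≤ s) (h1 : s ≤ 1) :
    0 < (fac v d s).re := by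
  have hn : ‖(s : ℂ) * dC d / v ^ 2‖ < 1 := by
    rw [norm_div, norm_mul, norm_dC, mul_one, Complex.norm_real, Real.norm_eq_abs, abs_of_nonneg h0]
    rw [div_lt_one (by linarith [h.norm])]
    linarith [h.norm]
  have := Complex.abs_re_le_norm ((s : ℂ) * dC d / v ^ 2)
  have := (abs_lt.1 (this.trans_lt hn)).1
  rw [fac, Complex.add_re, Complex.one_re]
  linarith

lemma Good.fac_ne {v : ℂ} {z : Lat} (h : Good v z) (d : Fin 4) {s : ℝ} (h0 : 0 ≤ s) (h1 : s ≤ 1) :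
    fac v d s ≠ 0 := by
  intro hc
  have := h.fac_re d h0 h1
  rw [hc] at this
  simp at this

/-- edge arcs in the double cover -/
def arc (v : ℂ) (d : Fin 4) (s : ℝ) : ℂ := v * Complex.exp (Complex.log (fac v d s) / 2)

/-- neighbours in the double cover -/
def hnb (d : Fin 4) (v : ℂ) : ℂ := arc v d 1

lemma arc_zero (v : ℂ) (d : Fin 4) : arc v d 0 = v := by simp [arc, fac]

lemma exp_half_sq (w : ℂ) : Complex.exp (w / 2) ^ 2 = Complex.exp w := by
  rw [← Complex.exp_nat_mul]; congr 1; push_cast; ring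

lemma Good.arc_sq {v : ℂ} {z : Lat} (h : Good v z) (d : Fin 4) {s : ℝ} (h0 : 0 ≤ s) (h1 : s ≤ 1) :
    arc v d s ^ 2 = toC z + s * dC d := by
  rw [arc, mul_pow, exp_half_sq, Complex.exp_log (h.fac_ne d h0 h1), fac, ← h.1]
  have := h.ne
  field_simp

lemma Good.arc_ne {v : ℂ} {z : Lat} (h : Good v z) (d : Fin 4) (s : ℝ) : arc v d s ≠ 0 :=
  mul_ne_zero h.ne (Complex.exp_ne_zero _)

lemma Good.hnb_sq {v : ℂ} {z : Lat} (h : Good v z) (d : Fin 4) :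
    hnb d v ^ 2 = toC (z + dirs d) := by
  rw [hnb, h.arc_sq d zero_le_one le_rfl, toC_add, dC]; simp

lemma log_inv_of_re {w : ℂ} (h : 0 < w.re) : Complex.log w⁻¹ = - Complex.log w := by
  refine Complex.log_inv _ ?_
  have := Complex.abs_arg_lt_pi_div_two_iff.2 (Or.inl h)
  have h2 := (abs_lt.1 this).2
  have := Real.pi_pos
  intro hc
  linarith

lemma log_mul_of_re {w w' : ℂ} (h : 0 < w.re) (h' : 0 < w'.re) :
    Complex.log (w * w') = Complex.log w + Complex.log w' := by
  have h1 := abs_lt.1 (Complex.abs_arg_lt_pi_div_two_iff.2 (Or.inl h))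
  have h2 := abs_lt.1 (Complex.abs_arg_lt_pi_div_two_iff.2 (Or.inl h'))
  have e1 : w ≠ 0 := by rintro rfl; simp at h
  have e2 : w' ≠ 0 := by rintro rfl; simp at h'
  rw [Complex.log_mul e1 e2]
  constructor <;> linarith [h1.1, h1.2, h2.1, h2.2]

/-- traversing an edge backwards -/
lemma Good.arc_rev {v : ℂ} {z : Lat} (h : Good v z) (d : Fin 4) (h' : Good (hnb d v) (z + dirs d))
    {s : ℝ} (h0 : 0 ≤ s) (h1 : s ≤ 1) : arc (hnb d v) (dinv d) (1 - s) = arc v d s := by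
  have hsq := h.hnb_sq d
  have key : fac v d 1 * fac (hnb d v) (dinv d) (1 - s) = fac v d s := by
    rw [fac, fac, fac, hsq, dC_dinv, toC_add, ← h.1]
    change (1 + (1 : ℝ) * dC d / v ^ 2) * (1 + ((1 - s : ℝ) : ℂ) * -dC d / (v ^ 2 + dC d)) = _
    have h2 : v ^ 2 + dC d ≠ 0 := by
      have := h'.ne
      have h3 : hnb d v ^ 2 ≠ 0 := pow_ne_zero _ this
      rwa [hsq, toC_add, ← h.1] at h3
    have := h.ne
    push_cast
    field_simp
    ring
  rw [arc]
  rw [show arc v d s = v * Complex.exp (Complex.log (fac v d s) / 2) from rfl, ← key,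
    log_mul_of_re (h.fac_re d zero_le_one le_rfl) (h'.fac_re _ (by linarith) (by linarith)),
    add_div, Complex.exp_add]
  rw [show hnb d v * Complex.exp (Complex.log (fac (hnb d v) (dinv d) (1 - s)) / 2) =
    (v * Complex.exp (Complex.log (fac v d 1) / 2)) *
      Complex.exp (Complex.log (fac (hnb d v) (dinv d) (1 - s)) / 2) from rfl]
  ring

lemma Good.hnb_back {v : ℂ} {z : Lat} (h : Good v z) (d : Fin 4) (h' : Good (hnb d v) (z + dirs d)) :
    hnb (dinv d) (hnb d v) = v := by
  have := h.arc_rev d h' le_rfl zero_le_one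
  rw [sub_zero, arc_zero] at this
  exact this

/-- the quarter-root function used for signs -/
def qr (v : ℂ) : ℂ := Complex.exp (Complex.log v / 2)

lemma qr_ne (v : ℂ) : qr v ≠ 0 := Complex.exp_ne_zero _

lemma qr_sq {v : ℂ} (h : v ≠ 0) : qr v ^ 2 = v := by
  rw [qr, exp_half_sq, Complex.exp_log h]

/-- edge signs -/
def hsg (d : Fin 4) (v : ℂ) : ℝ :=
  if qr (hnb d v) = qr v * Complex.exp (Complex.log (fac v d 1) / 4) then 1 else -1

lemma hsg_abs (d : Fin 4) (v : ℂ) : hsg d v = 1 ∨ hsg d v = -1 := by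
  unfold hsg; split_ifs <;> simp

lemma Good.qr_hnb {v : ℂ} {z : Lat} (h : Good v z) (d : Fin 4) :
    qr (hnb d v) = hsg d v * (qr v * Complex.exp (Complex.log (fac v d 1) / 4)) := by
  have h1 : qr (hnb d v) ^ 2 = (qr v * Complex.exp (Complex.log (fac v d 1) / 4)) ^ 2 := by
    rw [qr_sq (show hnb d v ≠ 0 from h.arc_ne d 1), mul_pow, qr_sq h.ne, hnb, arc, ← exp_half_sq]
    congr 3; ring
  rcases sq_eq_sq_iff_eq_or_eq_neg.1 h1 with h2 | h2
  · rw [hsg, if_pos h2, h2]; simp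
  · rw [hsg, if_neg, h2]
    · simp
    · intro h3
      rw [h3] at h2
      have := self_eq_neg.1 h2
      exact mul_ne_zero (qr_ne v) (Complex.exp_ne_zero _) this

lemma Good.hsg_back {v : ℂ} {z : Lat} (h : Good v z) (d : Fin 4) (h' : Good (hnb d v) (z + dirs d)) :
    hsg (dinv d) (hnb d v) = hsg d v := by
  have e1 := h.qr_hnb d
  have e2 := h'.qr_hnb (dinv d)
  rw [h.hnb_back d h'] at e2
  have key : fac v d 1 * fac (hnb d v) (dinv d) 1 = 1 := by
    have hsq := h.hnb_sq d
    rw [fac, fac, hsq, dC_dinv, toC_add, ← h.1]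
    change (1 + (1 : ℝ) * dC d / v ^ 2) * (1 + ((1 : ℝ) : ℂ) * -dC d / (v ^ 2 + dC d)) = _
    have h2 : v ^ 2 + dC d ≠ 0 := by
      have := h'.ne
      have h3 : hnb d v ^ 2 ≠ 0 := pow_ne_zero _ this
      rwa [hsq, toC_add, ← h.1] at h3
    have := h.ne
    push_cast
    field_simp
    ring
  have hl := log_mul_of_re (h.fac_re d zero_le_one le_rfl) (h'.fac_re (dinv d) zero_le_one le_rfl)
  rw [key, Complex.log_one] at hl
  rw [e1] at e2
  have e3 : Complex.exp (Complex.log (fac v d 1) / 4) *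
      Complex.exp (Complex.log (fac (hnb d v) (dinv d) 1) / 4) = 1 := by
    rw [← Complex.exp_add, ← add_div, ← hl]; simp
  have e4 : ((hsg (dinv d) (hnb d v) * hsg d v : ℝ) : ℂ) = 1 := by
    have hq := qr_ne v
    push_cast
    apply mul_right_cancel₀ hq
    rw [one_mul]
    conv_rhs => rw [e2]
    linear_combination (-1 : ℂ) * (hsg (dinv d) (hnb d v) * hsg d v * qr v) * e3
  have e5 : hsg (dinv d) (hnb d v) * hsg d v = 1 := by exact_mod_cast e4
  rcases hsg_abs (dinv d) (hnb d v) with h3 | h3 <;> rcases hsg_abs d v with h4 | h4 <;>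
    rw [h3, h4] at e5 ⊢ <;> norm_num at e5

/-- vertices of the cover over an annulus -/
def annU (t ρ : ℤ) : Set ℂ := {v | ∃ z, v ^ 2 = toC z ∧ t < nsq z ∧ nsq z ≤ ρ}

lemma lat_finite (ρ : ℤ) : {z : Lat | nsq z ≤ ρ}.Finite := by
  refine ((Set.finite_Icc (-ρ) ρ).prod (Set.finite_Icc (-ρ) ρ)).subset ?_
  rintro ⟨x, y⟩ h
  simp only [nsq, Set.mem_ofPred_eq] at h
  simp only [Set.mem_prod, Set.mem_Icc]
  refine ⟨⟨?_, ?_⟩, ?_, ?_⟩ <;> nlinarith [sq_nonneg x, sq_nonneg y, sq_nonneg (x - 1), sq_nonneg (x + 1), sq_nonneg (y - 1), sq_nonneg (y + 1)]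

lemma annU_finite (t ρ : ℤ) : (annU t ρ).Finite := by
  have h1 := ((lat_finite ρ).image (fun z => Complex.exp (Complex.log (toC z) / 2)))
  have h2 := ((lat_finite ρ).image (fun z => -Complex.exp (Complex.log (toC z) / 2)))
  refine ((h1.union h2).union (Set.finite_singleton 0)).subset ?_
  rintro v ⟨z, hz, -, hzρ⟩
  by_cases hv : v = 0
  · right; exact hv
  left
  have h0 : toC z ≠ 0 := by rw [← hz]; exact pow_ne_zero _ hv
  have : v ^ 2 = Complex.exp (Complex.log (toC z) / 2) ^ 2 := by
    rw [exp_half_sq, Complex.exp_log h0, hz]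
  rcases sq_eq_sq_iff_eq_or_eq_neg.1 this with h | h
  · left; exact ⟨z, hzρ, h.symm⟩
  · right; exact ⟨z, hzρ, h.symm⟩

lemma good_of_ann {t ρ : ℤ} (ht : 1 ≤ t) {v : ℂ} (h : v ∈ annU t ρ) :
    ∃ z, Good v z ∧ t < nsq z ∧ nsq z ≤ ρ := by
  obtain ⟨z, h1, h2, h3⟩ := h
  exact ⟨z, ⟨h1, by linarith⟩, h2, h3⟩

lemma good_hnb_of_ann {t ρ : ℤ} (ht : 1 ≤ t) {v : ℂ} {z : Lat} (hz : Good v z) {d : Fin 4}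
    (h : hnb d v ∈ annU t ρ) :
    Good (hnb d v) (z + dirs d) ∧ t < nsq (z + dirs d) ∧ nsq (z + dirs d) ≤ ρ := by
  obtain ⟨w, h1, h2, h3⟩ := good_of_ann ht h
  have : w = z + dirs d := toC_inj (by rw [← h1.1, hz.hnb_sq])
  subst this
  exact ⟨h1, h2, h3⟩

lemma nsq_avg (z : Lat) : ∑ d, (4 : ℝ)⁻¹ * (nsq (z + dirs d) : ℝ) = nsq z + 1 := by
  simp [Fin.sum_univ_four, dirs, nsq]; ring

lemma nsq_step_le (z : Lat) (d : Fin 4) : nsq (z + dirs d) ≤ 2 * nsq z + 2 := by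
  fin_cases d <;> simp [dirs, nsq] <;> nlinarith [sq_nonneg (z.1 - 1), sq_nonneg (z.1 + 1), sq_nonneg (z.2 - 1), sq_nonneg (z.2 + 1)]

lemma ann_mp {t ρ : ℤ} (ht : 1 ≤ t) (m : ℂ → ℝ) (W : Finset ℂ) (hW : W ⊆ (annU_finite t ρ).toFinset)
    (h0 : ∀ x ∉ W, m x ≤ 0) (h1 : ∀ x ∈ W, m x ≤ ∑ d, 4⁻¹ * m (hnb d x)) (x : ℂ) : m x ≤ 0 := by
  by_contra hx
  push Not at hx
  have hxW : x ∈ W := by by_contra hc; linarith [h0 x hc]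
  set φ : ℂ → ℝ := fun v => 2 * ρ + 3 - ‖v ^ 2‖ ^ 2 with hφ
  have hgood : ∀ v ∈ W, ∃ z, Good v z ∧ t < nsq z ∧ nsq z ≤ ρ := fun v hv =>
    good_of_ann ht ((annU_finite t ρ).mem_toFinset.1 (hW hv))
  have hρ : ∀ v ∈ W, (1 : ℝ) ≤ ρ := by
    intro v hv
    obtain ⟨z, h1, h2, h3⟩ := hgood v hv
    have : 1 ≤ ρ := by linarith
    exact_mod_cast this
  have hφpos : ∀ v ∈ W, 0 < φ v := by
    intro v hv
    obtain ⟨z, h1, h2, h3⟩ := hgood v hv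
    have := hρ v hv
    have h3' : (nsq z : ℝ) ≤ ρ := by exact_mod_cast h3
    simp only [hφ, h1.1, norm_toC_sq]
    linarith
  have hφn : ∀ v ∈ W, ∀ d, 0 < φ (hnb d v) := by
    intro v hv d
    obtain ⟨z, h1, h2, h3⟩ := hgood v hv
    have h3' : (nsq z : ℝ) ≤ ρ := by exact_mod_cast h3
    have h4 : (nsq (z + dirs d) : ℝ) ≤ 2 * nsq z + 2 := by exact_mod_cast nsq_step_le z d
    simp only [hφ, h1.hnb_sq, norm_toC_sq]
    linarith
  have hφa : ∀ v ∈ W, ∑ d, 4⁻¹ * φ (hnb d v) = φ v - 1 := by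
    intro v hv
    obtain ⟨z, h1, h2, h3⟩ := hgood v hv
    simp only [hφ, h1.hnb_sq, norm_toC_sq, h1.1, mul_sub, Finset.sum_sub_distrib]
    rw [nsq_avg]
    simp
    ring
  obtain ⟨y, hy, hmax⟩ := W.exists_max_image (fun v => m v / φ v) ⟨x, hxW⟩
  set c := m y / φ y with hc
  have hcpos : 0 < c := lt_of_lt_of_le (div_pos hx (hφpos x hxW)) (hmax x hxW)
  have hle : ∀ d, m (hnb d y) ≤ c * φ (hnb d y) := by
    intro d
    by_cases hd : hnb d y ∈ W
    · have := hmax _ hd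
      rwa [div_le_iff₀ (hφpos _ hd)] at this
    · exact (h0 _ hd).trans (mul_pos hcpos (hφn y hy d)).le
  have h2 : m y ≤ c * (φ y - 1) := by
    rw [← hφa y hy, Finset.mul_sum]
    refine (h1 y hy).trans (Finset.sum_le_sum fun d _ => ?_)
    have := hle d
    nlinarith
  have h3 : m y = c * φ y := by rw [hc]; field_simp [(hφpos y hy).ne']
  nlinarith

/-- the signed double cover of an annulus -/
def annG (t ρ : ℤ) (ht : 1 ≤ t) : SG ℂ where
  nb := hnb
  sg := hsg
  U := (annU_finite t ρ).toFinset
  inv := dinv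
  sg_abs := hsg_abs
  inv_inv := dinv_dinv
  back := by
    intro d x hx hx'
    rw [Set.Finite.mem_toFinset] at hx hx'
    obtain ⟨z, hz, -, -⟩ := good_of_ann ht hx
    exact hz.hnb_back d (good_hnb_of_ann ht hz hx').1
  sback := by
    intro d x hx hx'
    rw [Set.Finite.mem_toFinset] at hx hx'
    obtain ⟨z, hz, -, -⟩ := good_of_ann ht hx
    exact hz.hsg_back d (good_hnb_of_ann ht hz hx').1
  mp := fun m W hW h0 h1 x => ann_mp ht m W hW h0 h1 x

end

section

/-! ### Planarity of the covers -/

/-- Crossing curves in a strip keep their order. -/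
lemma strip_order {S T : Set ℂ} {x y x' y' : ℂ} {A B : ℝ} (hS : JoinedIn S x y)
    (hT : JoinedIn T x' y') (hx : x.re = A) (hx' : x'.re = A) (hy : y.re = B) (hy' : y'.re = B)
    (hSA : ∀ z ∈ S, z.re = A → z = x) (hSB : ∀ z ∈ S, z.re = B → z = y)
    (hTr : ∀ z ∈ T, A ≤ z.re ∧ z.re ≤ B) (hdis : ∀ z ∈ S, z ∉ T)
    (hlt : x.im < x'.im) : y.im < y'.im := by
  by_contra hcon
  push Not at hcon
  have hAB : A ≤ B := by have := hTr _ hT.source_mem; linarith [this.1, this.2]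
  obtain ⟨φ, hφ⟩ := hS
  have hcomp : IsCompact (range φ) := isCompact_range φ.continuous
  obtain ⟨M, hM⟩ := (hcomp.image Complex.continuous_im).isBounded.exists_norm_le
  have hM' : ∀ z ∈ range φ, -M ≤ z.im ∧ z.im ≤ M := by
    intro z hz
    exact abs_le.1 (hM _ ⟨z, hz, rfl⟩)
  have hSφ : ∀ z ∈ range φ, z ∈ S := by rintro _ ⟨t, rfl⟩; exact hφ t
  have hJφ : JoinedIn (range φ) x y := ⟨φ, fun t => ⟨t, rfl⟩⟩
  set lo : ℂ := ⟨B, min (-M) y'.im⟩ with hlo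
  set hi : ℂ := ⟨A, max M x'.im⟩ with hhi
  have seg : ∀ (p q : ℂ), JoinedIn (segment ℝ p q) p q := fun p q =>
    (convex_segment p q).isPathConnected ⟨p, left_mem_segment ℝ p q⟩ |>.joinedIn _ (left_mem_segment ℝ p q) _ (right_mem_segment ℝ p q)
  have segre : ∀ (p q z : ℂ), p.re = q.re → p.im ≤ q.im → z ∈ segment ℝ p q →
      z.re = p.re ∧ p.im ≤ z.im ∧ z.im ≤ q.im := by
    intro p q z h1 h2 hz
    obtain ⟨a, b, ha, hb, hab, rfl⟩ := hz
    have : a = 1 - b := by linarith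
    subst this
    simp [h1]
    refine ⟨by ring, ?_, ?_⟩ <;> nlinarith
  set T' := segment ℝ lo y' ∪ T ∪ segment ℝ x' hi with hT'
  have hJT : JoinedIn T' lo hi := by
    refine ((seg lo y').mono ?_).trans ((hT.symm.mono ?_).trans ((seg x' hi).mono ?_))
    · intro z hz; exact Or.inl (Or.inl hz)
    · intro z hz; exact Or.inl (Or.inr hz)
    · intro z hz; exact Or.inr hz
  have h1 := fun z hz => segre lo y' z (by simp [hlo, hy']) (by simp [hlo]) hz
  have h2 := fun z hz => segre x' hi z (by simp [hhi, hx']) (by simp [hhi]) hz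
  obtain ⟨z, hz1, hz2⟩ := crossing hJφ hJT (by
    rintro z ((hz | hz) | hz)
    · have := (h1 z hz).1
      rw [this]; simp only [hlo]; constructor <;> linarith
    · have := hTr z hz; rw [hx, hy]; exact this
    · have := (h2 z hz).1
      rw [this]; constructor <;> linarith) (by
    intro z hz
    have := hM' z hz
    exact ⟨(min_le_left _ _).trans this.1, this.2.trans (le_max_left _ _)⟩)
  rcases hz2 with (hz | hz) | hz
  · have h3 := h1 z hz
    have h4 := hSB z (hSφ z hz1) h3.1
    subst h4
    have : z = y' := Complex.ext (by rw [hy, hy']) (le_antisymm h3.2.2 hcon)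
    subst this
    exact hdis z (hSφ z hz1) hT.target_mem
  · exact hdis z (hSφ z hz1) hz
  · have h3 := h2 z hz
    have h4 := hSA z (hSφ z hz1) (by rw [h3.1, hx'])
    subst h4
    linarith [h3.2.1]

lemma int_of_mem {k : ℤ} {x : ℝ} (h : x = k) (h0 : -1 ≤ x) (h1 : x ≤ 1) : k = -1 ∨ k = 0 ∨ k = 1 := by
  subst h
  have a : -1 ≤ k := by exact_mod_cast h0
  have b : k ≤ 1 := by exact_mod_cast h1
  omega

lemma int_01 {k : ℤ} {s : ℝ} (h : s = k) (h0 : 0 ≤ s) (h1 : s ≤ 1) : s = 0 ∨ s = 1 := by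
  rcases int_of_mem h (by linarith) h1 with h2 | h2 | h2
  · subst h2; rw [h] at h0; norm_num at h0
  · subst h2; left; simpa using h
  · subst h2; right; simpa using h

lemma edge_meet {z z' : Lat} {d d' : Fin 4} {s s' : ℝ} (h0 : 0 ≤ s) (h1 : s ≤ 1) (h0' : 0 ≤ s')
    (h1' : s' ≤ 1) (h : toC z + s * dC d = toC z' + s' * dC d') :
    ((s = 0 ∨ s = 1) ∧ (s' = 0 ∨ s' = 1)) ∨ (z = z' ∧ d = d' ∧ s = s') ∨
      (z' = z + dirs d ∧ d' = dinv d ∧ s' = 1 - s) := by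
  obtain ⟨x, y⟩ := z
  obtain ⟨x', y'⟩ := z'
  have hr := congrArg Complex.re h
  have hi := congrArg Complex.im h
  by_cases hs : (s = 0 ∨ s = 1) ∧ (s' = 0 ∨ s' = 1)
  · exact Or.inl hs
  right
  have same : ∀ {k k' : ℤ}, (k : ℝ) + s = k' + s' → k = k' ∧ s = s' := by
    intro k k' hk
    rcases int_of_mem (k := k' - k) (x := s - s') (by push_cast; linarith) (by linarith) (by linarith) with e | e | e
    · exfalso; apply hs
      have : (k' : ℝ) - k = -1 := by exact_mod_cast e
      exact ⟨Or.inl (by linarith), Or.inr (by linarith)⟩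
    · have e' : (k' : ℝ) - k = 0 := by exact_mod_cast e
      exact ⟨by omega, by linarith⟩
    · exfalso; apply hs
      have : (k' : ℝ) - k = 1 := by exact_mod_cast e
      exact ⟨Or.inr (by linarith), Or.inl (by linarith)⟩
  have opp : ∀ {k k' : ℤ}, (k : ℝ) + s = k' - s' → k' = k + 1 ∧ s' = 1 - s := by
    intro k k' hk
    rcases int_of_mem (k := k' - k - 1) (x := s + s' - 1) (by push_cast; linarith) (by linarith) (by linarith) with e | e | e
    · exfalso; apply hs
      have : (k' : ℝ) - k - 1 = -1 := by exact_mod_cast e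
      exact ⟨Or.inl (by linarith), Or.inl (by linarith)⟩
    · have e' : (k' : ℝ) - k - 1 = 0 := by exact_mod_cast e
      exact ⟨by omega, by linarith⟩
    · exfalso; apply hs
      have : (k' : ℝ) - k - 1 = 1 := by exact_mod_cast e
      exact ⟨Or.inr (by linarith), Or.inr (by linarith)⟩
  have perp : ∀ {k k' l l' : ℤ}, s = k → s' = k' → False := by
    intro k k' l l' e1 e2
    exact hs ⟨int_01 e1 h0 h1, int_01 e2 h0' h1'⟩
  fin_cases d <;> fin_cases d' <;> simp [toC, dC, dirs] at hr hi
  · obtain ⟨e1, e2⟩ := same hr; left; simp [e1, e2, hi]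
  · obtain ⟨e1, e2⟩ := opp (k := x) (k' := x') (by linarith); right; simp [e1, e2, hi, dinv, dirs]
  · exfalso; exact hs ⟨int_01 (k := x' - x) (by push_cast; linarith) h0 h1, int_01 (k := y - y') (by push_cast; linarith) h0' h1'⟩
  · exfalso; exact hs ⟨int_01 (k := x' - x) (by push_cast; linarith) h0 h1, int_01 (k := y' - y) (by push_cast; linarith) h0' h1'⟩
  · obtain ⟨e1, e2⟩ := opp (k := -x) (k' := -x') (by push_cast; linarith); right; simp [e2, hi, dinv, dirs]; omega
  · obtain ⟨e1, e2⟩ := same (k := -x) (k' := -x') (by push_cast; linarith); left; simp [e2, hi]; omega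
  · exfalso; exact hs ⟨int_01 (k := x - x') (by push_cast; linarith) h0 h1, int_01 (k := y - y') (by push_cast; linarith) h0' h1'⟩
  · exfalso; exact hs ⟨int_01 (k := x - x') (by push_cast; linarith) h0 h1, int_01 (k := y' - y) (by push_cast; linarith) h0' h1'⟩
  · exfalso; exact hs ⟨int_01 (k := y' - y) (by push_cast; linarith) h0 h1, int_01 (k := x - x') (by push_cast; linarith) h0' h1'⟩
  · exfalso; exact hs ⟨int_01 (k := y' - y) (by push_cast; linarith) h0 h1, int_01 (k := x' - x) (by push_cast; linarith) h0' h1'⟩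
  · obtain ⟨e1, e2⟩ := same hi; left; simp [e1, e2, hr]
  · obtain ⟨e1, e2⟩ := opp (k := y) (k' := y') (by linarith); right; simp [e1, e2, hr, dinv, dirs]
  · exfalso; exact hs ⟨int_01 (k := y - y') (by push_cast; linarith) h0 h1, int_01 (k := x - x') (by push_cast; linarith) h0' h1'⟩
  · exfalso; exact hs ⟨int_01 (k := y - y') (by push_cast; linarith) h0 h1, int_01 (k := x' - x) (by push_cast; linarith) h0' h1'⟩
  · obtain ⟨e1, e2⟩ := opp (k := -y) (k' := -y') (by push_cast; linarith); right; simp [e2, hr, dinv, dirs]; omega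
  · obtain ⟨e1, e2⟩ := same (k := -y) (k' := -y') (by push_cast; linarith); left; simp [e2, hr]; omega

lemma arc_meet {v v' : ℂ} {z z' : Lat} {d d' : Fin 4} {s s' : ℝ} (hv : Good v z) (hv' : Good v' z')
    (h0 : 0 ≤ s) (h1 : s ≤ 1) (h0' : 0 ≤ s') (h1' : s' ≤ 1) (h : arc v d s = arc v' d' s') :
    ((s = 0 ∨ s = 1) ∧ (s' = 0 ∨ s' = 1)) ∨ v = v' ∨ (v' = hnb d v ∧ s ≠ 0) := by
  have h2 := congrArg (· ^ 2) h
  simp only [hv.arc_sq d h0 h1, hv'.arc_sq d' h0' h1'] at h2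
  rcases edge_meet h0 h1 h0' h1' h2 with h3 | ⟨h3, h4, h5⟩ | ⟨h3, h4, h5⟩
  · exact Or.inl h3
  · right; left
    subst h3 h4 h5
    have : fac v d s = fac v' d s := by rw [fac, fac, hv.1, hv'.1]
    rw [arc, arc, this] at h
    exact mul_right_cancel₀ (Complex.exp_ne_zero _) h
  · by_cases hs : s = 0
    · left; subst hs; simp [h5]
    right; right
    refine ⟨?_, hs⟩
    subst h3 h4 h5
    have hg : Good (hnb d v) (z + dirs d) := ⟨hv.hnb_sq d, hv'.2⟩
    have hf : fac v' (dinv d) (1 - s) = fac (hnb d v) (dinv d) (1 - s) := by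
      rw [fac, fac, hg.1, hv'.1]
    have h6 := hv.arc_rev d hg h0 h1
    rw [h, arc, arc, hf] at h6
    exact (mul_right_cancel₀ (Complex.exp_ne_zero _) h6).symm

/-- The edge arcs spanned by a set of vertices together with outer prongs. -/
def Ev (t ρ : ℤ) (S : Set ℂ) : Set ℂ := {w | ∃ v ∈ S, ∃ d : Fin 4, ∃ s : ℝ, 0 ≤ s ∧ s ≤ 1 ∧
  w = arc v d s ∧ (s = 0 ∨ hnb d v ∈ S ∨ (hnb d v ∉ annU t ρ ∧ s < 1))}

lemma Ev_disjoint {t ρ : ℤ} (ht : 1 ≤ t) {S S' : Set ℂ} (hS : S ⊆ annU t ρ) (hS' : S' ⊆ annU t ρ)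
    (hd : ∀ v ∈ S, v ∉ S') {w : ℂ} (hw : w ∈ Ev t ρ S) : w ∉ Ev t ρ S' := by
  intro hw'
  obtain ⟨v, hv, d, s, h0, h1, hws, hc⟩ := hw
  obtain ⟨v', hv', d', s', h0', h1', hws', hc'⟩ := hw'
  obtain ⟨z, hz, -, -⟩ := good_of_ann ht (hS hv)
  obtain ⟨z', hz', -, -⟩ := good_of_ann ht (hS' hv')
  have aux : ∀ {S : Set ℂ} {v d s}, v ∈ S → (s = 0 ∨ s = 1) → w = arc v d s →
      (s = 0 ∨ hnb d v ∈ S ∨ (hnb d v ∉ annU t ρ ∧ s < 1)) → w ∈ S := by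
    intro S v d s hv h01 hw hc
    rcases h01 with rfl | rfl
    · rw [hw, arc_zero]; exact hv
    · rcases hc with hc | hc | hc
      · norm_num at hc
      · rw [hw]; exact hc
      · exact absurd hc.2 (lt_irrefl _)
  rcases arc_meet hz hz' h0 h1 h0' h1' (hws.symm.trans hws') with h | h | ⟨h, hs⟩
  · exact hd w (aux hv h.1 hws hc) (aux hv' h.2 hws' hc')
  · subst h; exact hd v hv hv'
  · rw [← h] at hc
    rcases hc with hc | hc | hc
    · exact hs hc
    · exact hd v' hc hv'
    · exact hc.1 (hS' hv')

lemma Ev_mono {t ρ : ℤ} {S S' : Set ℂ} (h : S ⊆ S') : Ev t ρ S ⊆ Ev t ρ S' := by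
  rintro w ⟨v, hv, d, s, h0, h1, hws, hc⟩
  refine ⟨v, h hv, d, s, h0, h1, hws, ?_⟩
  rcases hc with hc | hc | hc
  · exact Or.inl hc
  · exact Or.inr (Or.inl (h hc))
  · exact Or.inr (Or.inr hc)

lemma seg_norm (z : Lat) (d : Fin 4) (s : ℝ) : ‖toC z + s * dC d‖ ^ 2 =
    nsq z + s * (nsq (z + dirs d) - nsq z - 1) + s ^ 2 := by
  rw [← Complex.normSq_eq_norm_sq, Complex.normSq_apply]
  fin_cases d <;> simp [toC, nsq, dC, dirs] <;> ring

lemma nsq_parity (z : Lat) (d : Fin 4) : ∃ k : ℤ, nsq (z + dirs d) = nsq z + 2 * k + 1 := by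
  fin_cases d
  · exact ⟨z.1, by simp [nsq, dirs]; ring⟩
  · exact ⟨-z.1, by simp [nsq, dirs]; ring⟩
  · exact ⟨z.2, by simp [nsq, dirs]; ring⟩
  · exact ⟨-z.2, by simp [nsq, dirs]; ring⟩

lemma seg_norm' {z : Lat} {d : Fin 4} {k : ℤ} (hk : nsq (z + dirs d) = nsq z + 2 * k + 1) (s : ℝ) :
    ‖toC z + s * dC d‖ ^ 2 = nsq z + 2 * k * s + s ^ 2 := by
  rw [seg_norm, hk]; push_cast; ring

/-- norm bounds along inner edges -/
lemma seg_bounds {t ρ : ℤ} {z : Lat} {d : Fin 4} (h1 : t < nsq z) (h2 : nsq z ≤ ρ)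
    (h3 : t < nsq (z + dirs d)) (h4 : nsq (z + dirs d) ≤ ρ) {s : ℝ} (h0 : 0 ≤ s) (hs : s ≤ 1) :
    (t : ℝ) + 1 ≤ ‖toC z + s * dC d‖ ^ 2 ∧ ‖toC z + s * dC d‖ ^ 2 ≤ ρ := by
  obtain ⟨k, hk⟩ := nsq_parity z d
  rw [seg_norm' hk]
  rw [hk] at h3 h4
  have e1 : (t : ℝ) + 1 ≤ nsq z := by exact_mod_cast h1
  have e2 : (nsq z : ℝ) ≤ ρ := by exact_mod_cast h2
  have e3 : (t : ℝ) + 1 ≤ nsq z + 2 * k + 1 := by exact_mod_cast h3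
  have e4 : (nsq z : ℝ) + 2 * k + 1 ≤ ρ := by exact_mod_cast h4
  rcases le_or_gt 0 k with hk0 | hk0
  · have : (0 : ℝ) ≤ k := by exact_mod_cast hk0
    constructor <;> nlinarith [mul_nonneg this h0]
  · have : (k : ℝ) ≤ -1 := by exact_mod_cast (by omega : k ≤ -1)
    constructor <;> nlinarith [mul_nonneg (by linarith : (0 : ℝ) ≤ -1 - k) h0]

/-- A tip of a prong leaving the annulus. -/
structure Tip (t ρ : ℤ) (v : ℂ) (d : Fin 4) (σ c : ℝ) : Prop where
  pos : 0 ≤ σ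
  lt : σ < 1
  out : hnb d v ∉ annU t ρ
  eq : ‖arc v d σ ^ 2‖ ^ 2 = c
  bd : ∀ s, 0 ≤ s → s < σ → (t : ℝ) + 1 / 2 < ‖arc v d s ^ 2‖ ^ 2 ∧ ‖arc v d s ^ 2‖ ^ 2 < ρ + 1 / 2

lemma tip_in {t ρ : ℤ} {v : ℂ} {z : Lat} {d : Fin 4} (hv : Good v z) (h1 : t < nsq z)
    (h2 : nsq z ≤ ρ) (h3 : nsq (z + dirs d) ≤ t) : ∃ σ, Tip t ρ v d σ (t + 1 / 2) := by
  obtain ⟨k, hk⟩ := nsq_parity z d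
  have e1 : (t : ℝ) + 1 ≤ nsq z := by exact_mod_cast h1
  have e2 : (nsq z : ℝ) ≤ ρ := by exact_mod_cast h2
  have e3 : (nsq z : ℝ) + 2 * k + 1 ≤ t := by rw [hk] at h3; exact_mod_cast h3
  have hk1 : (k : ℝ) ≤ -1 := by exact_mod_cast (by omega : k ≤ -1)
  have hcont : ContinuousOn (fun s : ℝ => (nsq z : ℝ) + 2 * k * s + s ^ 2) (Icc 0 1) := by fun_prop
  obtain ⟨σ, hσ, hσ'⟩ := intermediate_value_Icc' (zero_le_one) hcont
    (show (t : ℝ) + 1 / 2 ∈ _ by constructor <;> norm_num <;> linarith)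
  have hlt : σ < 1 := by
    rcases hσ.2.lt_or_eq with h | h
    · exact h
    · subst h; norm_num at hσ'; linarith
  refine ⟨σ, hσ.1, hlt, ?_, ?_, ?_⟩
  · rintro ⟨w, hw, hw2, -⟩
    have : w = z + dirs d := toC_inj (by rw [← hw, hv.hnb_sq])
    subst this; linarith
  · rw [hv.arc_sq d hσ.1 hσ.2, seg_norm' hk]; exact hσ'
  · intro s hs hs'
    rw [hv.arc_sq d hs (by linarith), seg_norm' hk, ← hσ']
    constructor
    · nlinarith
    · nlinarith

lemma tip_out {t ρ : ℤ} {v : ℂ} {z : Lat} {d : Fin 4} (hv : Good v z) (h1 : t < nsq z)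
    (h2 : nsq z ≤ ρ) (h3 : ρ < nsq (z + dirs d)) : ∃ σ, Tip t ρ v d σ (ρ + 1 / 2) := by
  obtain ⟨k, hk⟩ := nsq_parity z d
  have e1 : (t : ℝ) + 1 ≤ nsq z := by exact_mod_cast h1
  have e2 : (nsq z : ℝ) ≤ ρ := by exact_mod_cast h2
  have e3 : (ρ : ℝ) + 1 ≤ nsq z + 2 * k + 1 := by rw [hk] at h3; exact_mod_cast h3
  have hk1 : (0 : ℝ) ≤ k := by exact_mod_cast (by omega : 0 ≤ k)
  have hcont : ContinuousOn (fun s : ℝ => (nsq z : ℝ) + 2 * k * s + s ^ 2) (Icc 0 1) := by fun_prop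
  obtain ⟨σ, hσ, hσ'⟩ := intermediate_value_Icc (zero_le_one) hcont
    (show (ρ : ℝ) + 1 / 2 ∈ _ by constructor <;> norm_num <;> linarith)
  have hlt : σ < 1 := by
    rcases hσ.2.lt_or_eq with h | h
    · exact h
    · subst h; norm_num at hσ'; linarith
  have hmono : ∀ s, 0 ≤ s → s < σ → (nsq z : ℝ) + 2 * k * s + s ^ 2 < (nsq z : ℝ) + 2 * k * σ + σ ^ 2 := by
    intro s hs hs'
    nlinarith [mul_nonneg hk1 (sub_nonneg.2 hs'.le)]
  refine ⟨σ, hσ.1, hlt, ?_, ?_, ?_⟩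
  · rintro ⟨w, hw, -, hw2⟩
    have : w = z + dirs d := toC_inj (by rw [← hw, hv.hnb_sq])
    subst this; linarith
  · rw [hv.arc_sq d hσ.1 hσ.2, seg_norm' hk]; exact hσ'
  · intro s hs hs'
    rw [hv.arc_sq d hs (by linarith), seg_norm' hk]
    have := hmono s hs hs'
    constructor
    · nlinarith [mul_nonneg hk1 hs]
    · linarith

end

section

/-! ### Lifting walks to the universal cover -/

/-- arcs spanned by a set of vertices -/
def E0 (S : Set ℂ) : Set ℂ := {w | ∃ v ∈ S, ∃ d : Fin 4, ∃ s : ℝ, 0 ≤ s ∧ s ≤ 1 ∧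
  w = arc v d s ∧ (s = 0 ∨ hnb d v ∈ S)}

lemma E0_sub (t ρ : ℤ) (S : Set ℂ) : E0 S ⊆ Ev t ρ S := by
  rintro w ⟨v, hv, d, s, h0, h1, hw, hc⟩
  exact ⟨v, hv, d, s, h0, h1, hw, by tauto⟩

lemma E0_mono {S S' : Set ℂ} (h : S ⊆ S') : E0 S ⊆ E0 S' := by
  rintro w ⟨v, hv, d, s, h0, h1, hw, hc⟩
  exact ⟨v, h hv, d, s, h0, h1, hw, hc.imp id (fun h' => h h')⟩

/-- prongs in the universal cover -/
def prong (α v : ℂ) (d : Fin 4) (σ : ℝ) : Set ℂ :=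
  {l | ∃ s : ℝ, 0 ≤ s ∧ s ≤ σ ∧ l = α + Complex.log (fac v d s)}

lemma exp_prong {α v : ℂ} (hα : Complex.exp (α / 2) = v) (d : Fin 4) (s : ℝ) :
    Complex.exp ((α + Complex.log (fac v d s)) / 2) = arc v d s := by
  rw [add_div, Complex.exp_add, hα, arc]

lemma prong_joined {v : ℂ} {z : Lat} (hv : Good v z) (α : ℂ) (d : Fin 4) {σ : ℝ} (h0 : 0 ≤ σ)
    (h1 : σ ≤ 1) : JoinedIn (prong α v d σ) α (α + Complex.log (fac v d σ)) := by
  refine JoinedIn.ofLine (f := fun s : ℝ => α + Complex.log (fac v d (s * σ))) ?_ ?_ ?_ ?_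
  · have hsl : ∀ s ∈ unitInterval, fac v d (s * σ) ∈ Complex.slitPlane := by
      intro s hs
      left
      exact hv.fac_re d (mul_nonneg hs.1 h0) (by nlinarith [hs.1, hs.2])
    refine continuousOn_const.add (ContinuousOn.clog ?_ hsl)
    unfold fac
    fun_prop
  · simp [fac]
  · simp
  · rintro _ ⟨s, hs, rfl⟩
    exact ⟨s * σ, mul_nonneg hs.1 h0, by nlinarith [hs.1, hs.2], rfl⟩

lemma joined_shift {S : Set ℂ} {x y : ℂ} (h : JoinedIn S x y) (c : ℂ) :
    JoinedIn {z | z - c ∈ S} (x + c) (y + c) := by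
  obtain ⟨φ, hφ⟩ := h
  refine ⟨φ.map (f := fun z => z + c) (by fun_prop), fun t => ?_⟩
  simp [hφ]

lemma exp_shift (z : ℂ) (k : ℤ) : Complex.exp ((z + k * (4 * Real.pi * Complex.I)) / 2) =
    Complex.exp (z / 2) := by
  rw [show (z + k * (4 * Real.pi * Complex.I)) / 2 = z / 2 + k * (2 * Real.pi * Complex.I) by ring]
  rw [Complex.exp_add, Complex.exp_int_mul_two_pi_mul_I, mul_one]

lemma exp_shift4 (z : ℂ) (k : ℤ) : Complex.exp ((z + k * (4 * Real.pi * Complex.I)) / 4) =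
    (-1) ^ k * Complex.exp (z / 4) := by
  rw [show (z + k * (4 * Real.pi * Complex.I)) / 4 = z / 4 + k * (Real.pi * Complex.I) by ring]
  rw [Complex.exp_add, Complex.exp_int_mul, Complex.exp_pi_mul_I, mul_comm]

lemma exists_shift {z w : ℂ} (h : Complex.exp (z / 2) = Complex.exp (w / 2)) :
    ∃ k : ℤ, z = w + k * (4 * Real.pi * Complex.I) := by
  obtain ⟨k, hk⟩ := Complex.exp_eq_exp_iff_exists_int.1 h
  exact ⟨k, by linear_combination 2 * hk⟩

lemma lift_walk {t ρ : ℤ} (ht : 1 ≤ t) {S : Set ℂ} (hS : S ⊆ annU t ρ) {a b : ℂ} {l : List ℂ} {s : ℝ}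
    (h : SG.SW (annG t ρ ht) S a b l s) : ∀ α, Complex.exp (α / 2) = a → ∃ β, Complex.exp (β / 2) = b ∧
      JoinedIn {z | Complex.exp (z / 2) ∈ E0 {v | v ∈ l}} α β ∧
      Complex.exp (β / 4) * qr a = s * (Complex.exp (α / 4) * qr b) := by
  induction h with
  | @one x hx =>
    intro α hα
    refine ⟨α, hα, JoinedIn.refl ?_, by simp⟩
    exact ⟨x, by simp, 0, 0, le_rfl, zero_le_one, by rw [arc_zero]; exact hα, Or.inl rfl⟩
  | @cons x y l s d hx hw ih =>
    intro α hα
    obtain ⟨z, hz, -, -⟩ := good_of_ann ht (hS hx)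
    obtain ⟨β, h1, h2, h3⟩ := ih (α + Complex.log (fac x d 1)) (exp_prong hα d 1)
    have hmem : hnb d x ∈ l := hw.walk.start_mem
    refine ⟨β, h1, ?_, ?_⟩
    · refine JoinedIn.trans ((prong_joined hz α d zero_le_one le_rfl).mono ?_) (h2.mono ?_)
      · rintro _ ⟨s, hs0, hs1, rfl⟩
        refine ⟨x, by simp, d, s, hs0, hs1, exp_prong hα d s, Or.inr ?_⟩
        simp [hmem]
      · intro w hw
        exact E0_mono (fun v hv => by simp; right; exact hv) hw
    · have h4 := hz.qr_hnb d
      change _ * qr (hnb d x) = _ at h3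
      rw [h4, add_div, Complex.exp_add] at h3
      have e1 : ((hsg d x : ℝ) : ℂ) * hsg d x = 1 := by
        exact_mod_cast (annG t ρ ht).sg_mul_self d x
      have hne : Complex.exp (Complex.log (fac x d 1) / 4) ≠ 0 := Complex.exp_ne_zero _
      change _ = ((hsg d x * s : ℝ) : ℂ) * _
      push_cast
      apply mul_right_cancel₀ hne
      linear_combination (hsg d x : ℂ) * h3 - Complex.exp (β / 4) * qr x * Complex.exp (Complex.log (fac x d 1) / 4) * e1

lemma norm_exp_half {l w : ℂ} (h : Complex.exp (l / 2) = w) : ‖w ^ 2‖ ^ 2 = Real.exp (2 * l.re) := by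
  rw [← h, exp_half_sq, Complex.norm_exp, ← Real.exp_nat_mul]; norm_num

lemma re_of_norm {l w : ℂ} (h : Complex.exp (l / 2) = w) : l.re = Real.log (‖w ^ 2‖ ^ 2) / 2 := by
  rw [norm_exp_half h, Real.log_exp]; ring

lemma E0_norm {t ρ : ℤ} (ht : 1 ≤ t) {S : Set ℂ} (hS : S ⊆ annU t ρ) {w : ℂ} (hw : w ∈ E0 S) :
    (t : ℝ) + 1 ≤ ‖w ^ 2‖ ^ 2 ∧ ‖w ^ 2‖ ^ 2 ≤ ρ := by
  obtain ⟨v, hv, d, s, h0, h1, rfl, hc⟩ := hw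
  obtain ⟨z, hz, hz1, hz2⟩ := good_of_ann ht (hS hv)
  rcases hc with rfl | hc
  · rw [arc_zero, hz.1, norm_toC_sq]
    exact ⟨by exact_mod_cast hz1, by exact_mod_cast hz2⟩
  · obtain ⟨h3, h4, h5⟩ := good_hnb_of_ann ht hz (hS hc)
    rw [hz.arc_sq d h0 h1]
    exact seg_bounds hz1 hz2 h4 h5 h0 h1

/-- tip of a prong over the principal lift -/
def tip (v : ℂ) (d : Fin 4) (σ : ℝ) : ℂ := 2 * Complex.log v + Complex.log (fac v d σ)

lemma exp_log_v {v : ℂ} (h : v ≠ 0) : Complex.exp (2 * Complex.log v / 2) = v := by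
  rw [mul_div_cancel_left₀ _ two_ne_zero, Complex.exp_log h]

/-- properties of lifted crossing curves -/
structure Cross (t ρ : ℤ) (X : List ℂ) (x y : ℂ) (S : Set ℂ) : Prop where
  joined : JoinedIn S x y
  ev : ∀ z ∈ S, Complex.exp (z / 2) ∈ Ev t ρ {v | v ∈ X}
  lo : ∀ z ∈ S, Real.log (t + 1 / 2) / 2 ≤ z.re
  hi : ∀ z ∈ S, z.re ≤ Real.log (ρ + 1 / 2) / 2
  eqlo : ∀ z ∈ S, z.re = Real.log (t + 1 / 2) / 2 → z = x
  eqhi : ∀ z ∈ S, z.re = Real.log (ρ + 1 / 2) / 2 → z = y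
  xlo : x.re = Real.log (t + 1 / 2) / 2
  yhi : y.re = Real.log (ρ + 1 / 2) / 2

lemma Cross.shift {t ρ : ℤ} {X : List ℂ} {x y : ℂ} {S : Set ℂ} (h : Cross t ρ X x y S) (k : ℤ) :
    Cross t ρ X (x + k * (4 * Real.pi * Complex.I)) (y + k * (4 * Real.pi * Complex.I))
      {z | z - k * (4 * Real.pi * Complex.I) ∈ S} := by
  have hre : ∀ z : ℂ, (z - k * (4 * Real.pi * Complex.I)).re = z.re := by intro z; simp
  have hre' : ∀ z : ℂ, (z + k * (4 * Real.pi * Complex.I)).re = z.re := by intro z; simp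
  refine ⟨joined_shift h.joined _, ?_, ?_, ?_, ?_, ?_, ?_, ?_⟩
  · intro z hz
    have := h.ev _ hz
    rwa [← exp_shift _ k, sub_add_cancel] at this
  · intro z hz; rw [← hre]; exact h.lo _ hz
  · intro z hz; rw [← hre]; exact h.hi _ hz
  · intro z hz hz'
    rw [← hre] at hz'
    exact sub_eq_iff_eq_add.1 (h.eqlo _ hz hz')
  · intro z hz hz'
    rw [← hre] at hz'
    exact sub_eq_iff_eq_add.1 (h.eqhi _ hz hz')
  · rw [hre']; exact h.xlo
  · rw [hre']; exact h.yhi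

lemma cross_exists {t ρ : ℤ} (ht : 1 ≤ t) {S : Set ℂ} (hS : S ⊆ annU t ρ) {a b : ℂ} {X : List ℂ}
    {s : ℝ} (h : SG.SW (annG t ρ ht) S a b X s) {da db : Fin 4} {σa σb : ℝ}
    (ha : Tip t ρ a da σa (t + 1 / 2)) (hb : Tip t ρ b db σb (ρ + 1 / 2)) :
    ∃ m : ℤ, s = (-1) ^ m ∧ ∃ T, Cross t ρ X (tip a da σa)
      (tip b db σb + m * (4 * Real.pi * Complex.I)) T := by
  obtain ⟨za, hza, hza1, hza2⟩ := good_of_ann ht (hS h.walk.start_in)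
  obtain ⟨zb, hzb, -, -⟩ := good_of_ann ht (hS h.walk.end_in)
  have htρ : (t : ℝ) + 1 ≤ ρ := by exact_mod_cast (by omega : t + 1 ≤ ρ)
  have ht0 : (1 : ℝ) ≤ t := by exact_mod_cast ht
  have hXU : {v | v ∈ X} ⊆ annU t ρ := fun v hv => hS (h.walk.mem v hv)
  have hea := exp_log_v hza.ne
  have heb := exp_log_v hzb.ne
  obtain ⟨β, hβ1, hβ2, hβ3⟩ := lift_walk ht hS h (2 * Complex.log a) hea
  obtain ⟨m, hm⟩ := exists_shift (hβ1.trans heb.symm)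
  refine ⟨m, ?_, ?_⟩
  · rw [hm, exp_shift4] at hβ3
    have e1 : ∀ v : ℂ, Complex.exp (2 * Complex.log v / 4) = qr v := by
      intro v; rw [qr]; congr 1; ring
    rw [e1, e1] at hβ3
    have := mul_right_cancel₀ (mul_ne_zero (qr_ne a) (qr_ne b))
      (show (-1 : ℂ) ^ m * (qr a * qr b) = s * (qr a * qr b) by linear_combination hβ3)
    apply Complex.ofReal_injective; push_cast; exact this.symm
  · have key : ∀ {α v : ℂ} {d : Fin 4} {σ c : ℝ}, v ∈ X → Complex.exp (α / 2) = v → Tip t ρ v d σ c →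
        (c = t + 1 / 2 ∨ c = ρ + 1 / 2) →
        ∀ z ∈ prong α v d σ, Complex.exp (z / 2) ∈ Ev t ρ {v | v ∈ X} ∧
          Real.log (t + 1 / 2) / 2 ≤ z.re ∧ z.re ≤ Real.log (ρ + 1 / 2) / 2 ∧
          (z.re = Real.log (t + 1 / 2) / 2 → c = t + 1 / 2 ∧ z = α + Complex.log (fac v d σ)) ∧
          (z.re = Real.log (ρ + 1 / 2) / 2 → c = ρ + 1 / 2 ∧ z = α + Complex.log (fac v d σ)) := by
      intro α v d σ c hv hα hT hc z hz
      obtain ⟨u, hu0, hu1, rfl⟩ := hz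
      have he := exp_prong hα d u
      refine ⟨⟨v, hv, d, u, hu0, hu1.trans hT.lt.le, he, Or.inr (Or.inr ⟨hT.out, hu1.trans_lt hT.lt⟩)⟩, ?_⟩
      rw [re_of_norm he]
      rcases hu1.lt_or_eq with hlt | heq
      · have hb := hT.bd u hu0 hlt
        have l1 := Real.log_lt_log (by linarith) hb.1
        have l2 := Real.log_lt_log (by linarith) hb.2
        refine ⟨by linarith, by linarith, fun h => ?_, fun h => ?_⟩ <;> linarith
      · subst heq
        rw [hT.eq]
        have l1 : Real.log ((t : ℝ) + 1 / 2) < Real.log (ρ + 1 / 2) := Real.log_lt_log (by linarith) (by linarith)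
        rcases hc with rfl | rfl
        · exact ⟨le_rfl, by linarith, fun _ => ⟨rfl, rfl⟩, fun h => by linarith⟩
        · exact ⟨by linarith, le_rfl, fun h => by linarith, fun _ => ⟨rfl, rfl⟩⟩
    have ka := key h.walk.start_mem hea ha (Or.inl rfl)
    have kb := key h.walk.end_mem hβ1 hb (Or.inr rfl)
    have k0 : ∀ z : ℂ, Complex.exp (z / 2) ∈ E0 {v | v ∈ X} →
        Real.log (t + 1 / 2) / 2 < z.re ∧ z.re < Real.log (ρ + 1 / 2) / 2 := by
      intro z hz
      have hb := E0_norm ht hXU hz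
      rw [re_of_norm rfl]
      have l1 := Real.log_lt_log (show (0 : ℝ) < t + 1 / 2 by linarith) (lt_of_lt_of_le (by linarith) hb.1)
      have l2 := Real.log_lt_log (by linarith) (lt_of_le_of_lt hb.2 (show (ρ : ℝ) < ρ + 1 / 2 by linarith))
      constructor <;> linarith
    have hend : tip b db σb + m * (4 * Real.pi * Complex.I) = β + Complex.log (fac b db σb) := by
      rw [hm, tip]; ring
    rw [hend]
    have hne : (t : ℝ) + 1 / 2 ≠ ρ + 1 / 2 := by intro h; linarith
    refine ⟨{z | Complex.exp (z / 2) ∈ E0 {v | v ∈ X}} ∪ prong (2 * Complex.log a) a da σa ∪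
      prong β b db σb, ?_, ?_, ?_, ?_, ?_, ?_, ?_, ?_⟩
    · refine ((prong_joined hza _ da ha.pos ha.lt.le).symm.mono ?_).trans ((hβ2.mono ?_).trans
        ((prong_joined hzb _ db hb.pos hb.lt.le).mono ?_))
      · intro z hz; exact Or.inl (Or.inr hz)
      · intro z hz; exact Or.inl (Or.inl hz)
      · intro z hz; exact Or.inr hz
    · rintro z ((hz | hz) | hz)
      · exact E0_sub t ρ _ hz
      · exact (ka z hz).1
      · exact (kb z hz).1
    · rintro z ((hz | hz) | hz)
      · exact (k0 z hz).1.le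
      · exact (ka z hz).2.1
      · exact (kb z hz).2.1
    · rintro z ((hz | hz) | hz)
      · exact (k0 z hz).2.le
      · exact (ka z hz).2.2.1
      · exact (kb z hz).2.2.1
    · rintro z ((hz | hz) | hz) he
      · linarith [(k0 z hz).1]
      · exact ((ka z hz).2.2.2.1 he).2
      · exact absurd ((kb z hz).2.2.2.1 he).1 hne.symm
    · rintro z ((hz | hz) | hz) he
      · linarith [(k0 z hz).2]
      · exact absurd ((ka z hz).2.2.2.2 he).1 hne
      · exact ((kb z hz).2.2.2.2 he).2
    · rw [tip, re_of_norm (exp_prong hea da σa), ha.eq]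
    · rw [re_of_norm (exp_prong hβ1 db σb), hb.eq]

lemma shift_im (z : ℂ) (k : ℤ) : (z + k * (4 * Real.pi * Complex.I)).im = z.im + k * (4 * Real.pi) := by
  simp

lemma tip_noncong {t ρ : ℤ} (ht : 1 ≤ t) {a a' : ℂ} (haU : a ∈ annU t ρ) (haU' : a' ∈ annU t ρ)
    (hne : a ≠ a') {d d' : Fin 4} {σ σ' c : ℝ} (ha : Tip t ρ a d σ c) (ha' : Tip t ρ a' d' σ' c)
    (k : ℤ) : (tip a d σ).im + k * (4 * Real.pi) ≠ (tip a' d' σ').im := by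
  intro h
  obtain ⟨z, hz, -, -⟩ := good_of_ann ht haU
  obtain ⟨z', hz', -, -⟩ := good_of_ann ht haU'
  have e1 := exp_prong (exp_log_v hz.ne) d σ
  have e2 := exp_prong (exp_log_v hz'.ne) d' σ'
  have hre : (tip a d σ).re = (tip a' d' σ').re := by
    rw [tip, tip, re_of_norm e1, re_of_norm e2, ha.eq, ha'.eq]
  have heq : tip a d σ + k * (4 * Real.pi * Complex.I) = tip a' d' σ' := by
    apply Complex.ext
    · simpa using hre
    · rw [shift_im, h]
  have : arc a d σ = arc a' d' σ' := by
    rw [← e1, ← e2]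
    change Complex.exp (tip a d σ / 2) = Complex.exp (tip a' d' σ' / 2)
    rw [← heq, exp_shift]
  have m1 : arc a d σ ∈ Ev t ρ {a} := ⟨a, rfl, d, σ, ha.pos, ha.lt.le, rfl, Or.inr (Or.inr ⟨ha.out, ha.lt⟩)⟩
  have m2 : arc a' d' σ' ∈ Ev t ρ {a'} :=
    ⟨a', rfl, d', σ', ha'.pos, ha'.lt.le, rfl, Or.inr (Or.inr ⟨ha'.out, ha'.lt⟩)⟩
  rw [← this] at m2
  exact Ev_disjoint ht (by simpa using haU) (by simpa using haU') (by rintro v rfl; simpa using hne) m1 m2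

/-- The order of disjoint crossing curves determines the shifts. -/
lemma cross_order {t ρ : ℤ} (ht : 1 ≤ t) {X Y : List ℂ} (hX : {v | v ∈ X} ⊆ annU t ρ)
    (hY : {v | v ∈ Y} ⊆ annU t ρ) (hd : X.Disjoint Y) {x y x' y' : ℂ} {S T : Set ℂ} {m m' n k : ℤ}
    (hS : Cross t ρ X x (y + m * (4 * Real.pi * Complex.I)) S)
    (hT : Cross t ρ Y x' (y' + m' * (4 * Real.pi * Complex.I)) T)
    (hn1 : x.im + n * (4 * Real.pi) < x'.im) (hn2 : x'.im < x.im + (n + 1 : ℤ) * (4 * Real.pi))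
    (hk1 : y.im + k * (4 * Real.pi) < y'.im) (hk2 : y'.im < y.im + (k + 1 : ℤ) * (4 * Real.pi)) :
    k + m' = n + m := by
  have hdis : ∀ (j : ℤ) (z : ℂ), z - j * (4 * Real.pi * Complex.I) ∈ S → z ∉ T := by
    intro j z hz hz'
    exact Ev_disjoint ht hX hY (fun v hv hv' => hd hv hv') ((hS.shift j).ev z hz) (hT.ev z hz')
  have o1 := strip_order (hS.shift n).joined hT.joined (hS.shift n).xlo hT.xlo (hS.shift n).yhi hT.yhi
    (hS.shift n).eqlo (hS.shift n).eqhi (fun z hz => ⟨hT.lo z hz, hT.hi z hz⟩) (hdis n)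
    (by rw [shift_im]; exact hn1)
  have o2 := strip_order hT.joined (hS.shift (n + 1)).joined hT.xlo (hS.shift (n + 1)).xlo hT.yhi
    (hS.shift (n + 1)).yhi hT.eqlo hT.eqhi
    (fun z hz => ⟨(hS.shift (n + 1)).lo z hz, (hS.shift (n + 1)).hi z hz⟩)
    (fun z hz hz' => hdis (n + 1) z hz' hz) (by rw [shift_im]; exact hn2)
  rw [shift_im, shift_im, shift_im] at o1 o2
  have hp : (0 : ℝ) < 4 * Real.pi := by positivity
  push_cast at o2 hk2
  have a1 : ((m + n : ℤ) : ℝ) * (4 * Real.pi) < ((k + 1 + m' : ℤ) : ℝ) * (4 * Real.pi) := by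
    push_cast; linarith
  have a2 : ((k + m' : ℤ) : ℝ) * (4 * Real.pi) < ((m + n + 1 : ℤ) : ℝ) * (4 * Real.pi) := by
    push_cast; linarith
  have b1 : m + n < k + 1 + m' := by exact_mod_cast lt_of_mul_lt_mul_right a1 hp.le
  have b2 : k + m' < m + n + 1 := by exact_mod_cast lt_of_mul_lt_mul_right a2 hp.le
  omega

/-- Loops avoiding a crossing walk are balanced. -/
lemma cross_bal {t ρ : ℤ} (ht : 1 ≤ t) {Y : List ℂ} (hY : {v | v ∈ Y} ⊆ annU t ρ) {x y : ℂ}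
    {T : Set ℂ} (hT : Cross t ρ Y x y T) {S : Set ℂ} (hS : S ⊆ annU t ρ) (hSY : ∀ v ∈ S, v ∉ Y)
    {a : ℂ} {C : List ℂ} {s : ℝ} (hC : SG.SW (annG t ρ ht) S a a C s) : s = 1 := by
  rcases hC.abs with h1 | h1
  · exact h1
  exfalso
  subst h1
  obtain ⟨z, hz, hz1, hz2⟩ := good_of_ann ht (hS hC.walk.start_in)
  have hea := exp_log_v hz.ne
  obtain ⟨β, hβ1, hβ2, hβ3⟩ := lift_walk ht hS hC (2 * Complex.log a) hea
  obtain ⟨m, hm⟩ := exists_shift (hβ1.trans hea.symm)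
  have hm0 : m ≠ 0 := by
    rintro rfl
    rw [Int.cast_zero, zero_mul, add_zero] at hm
    rw [hm] at hβ3
    have h4 := mul_ne_zero (Complex.exp_ne_zero (2 * Complex.log a / 4)) (qr_ne a)
    push_cast at hβ3
    rw [neg_one_mul] at hβ3
    exact h4 (self_eq_neg.1 hβ3)
  set α := 2 * Complex.log a
  set E := {z | Complex.exp (z / 2) ∈ E0 {v | v ∈ C}} with hE
  have hstep : ∀ j : ℤ, JoinedIn E (α + (j * m : ℤ) * (4 * Real.pi * Complex.I))
      (α + ((j + 1) * m : ℤ) * (4 * Real.pi * Complex.I)) := by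
    intro j
    have := (joined_shift hβ2 ((j * m : ℤ) * (4 * Real.pi * Complex.I))).mono (V := E) (by
      intro w hw
      have hw' : Complex.exp ((w - (j * m : ℤ) * (4 * Real.pi * Complex.I)) / 2) ∈ E0 {v | v ∈ C} := hw
      rw [← exp_shift _ (j * m), sub_add_cancel] at hw'
      exact hw')
    rw [hm] at this
    convert this using 1
    push_cast
    ring
  have hjoin : ∀ K : ℕ, JoinedIn E (α + (-(K : ℤ) * m : ℤ) * (4 * Real.pi * Complex.I))
      (α + ((K : ℤ) * m : ℤ) * (4 * Real.pi * Complex.I)) := by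
    intro K
    induction K with
    | zero =>
      simp only [Nat.cast_zero, neg_zero, zero_mul, Int.cast_zero, add_zero]
      exact JoinedIn.refl hβ2.source_mem
    | succ K ih =>
      have s1 := hstep (-((K + 1 : ℕ) : ℤ))
      have s2 := hstep K
      rw [show -((K + 1 : ℕ) : ℤ) + 1 = -(K : ℤ) by push_cast; ring] at s1
      exact s1.trans (ih.trans (by exact_mod_cast s2))
  obtain ⟨φ, hφ⟩ := hT.joined
  have hcomp : IsCompact (range φ) := isCompact_range φ.continuous
  obtain ⟨M, hM⟩ := (hcomp.image Complex.continuous_im).isBounded.exists_norm_le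
  have hM' : ∀ z ∈ range φ, -M ≤ z.im ∧ z.im ≤ M := by
    intro z hz
    exact abs_le.1 (hM _ ⟨z, hz, rfl⟩)
  have hTφ : ∀ z ∈ range φ, z ∈ T := by rintro _ ⟨t, rfl⟩; exact hφ t
  have hJφ : JoinedIn (range φ) x y := ⟨φ, fun t => ⟨t, rfl⟩⟩
  obtain ⟨K, hK⟩ := exists_nat_ge (M + |α.im|)
  have hbig : ∃ p q, JoinedIn E p q ∧ p.im ≤ -M ∧ M ≤ q.im := by
    have hp : (1 : ℝ) ≤ 4 * Real.pi := by linarith [Real.pi_gt_three]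
    have hK0 : (0 : ℝ) ≤ K := Nat.cast_nonneg K
    have hle := le_abs_self α.im
    have hle' := neg_abs_le α.im
    rcases lt_or_gt_of_ne hm0 with hneg | hpos
    · have hm1 : (m : ℝ) ≤ -1 := by exact_mod_cast (by omega : m ≤ -1)
      have e : (1 : ℝ) ≤ -m * (4 * Real.pi) := by nlinarith
      refine ⟨_, _, (hjoin K).symm, ?_, ?_⟩ <;> rw [shift_im] <;> push_cast <;> nlinarith
    · have hm1 : (1 : ℝ) ≤ m := by exact_mod_cast hpos
      have e : (1 : ℝ) ≤ m * (4 * Real.pi) := by nlinarith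
      refine ⟨_, _, hjoin K, ?_, ?_⟩ <;> rw [shift_im] <;> push_cast <;> nlinarith
  obtain ⟨p, q, hpq, hp, hq⟩ := hbig
  have hCU : {v | v ∈ C} ⊆ S := fun v hv => hC.walk.mem v hv
  have ht0 : (1 : ℝ) ≤ t := by exact_mod_cast ht
  obtain ⟨w, hw1, hw2⟩ := crossing hJφ hpq (by
    intro w hw
    have hb := E0_norm ht (hCU.trans hS) hw
    rw [hT.xlo, hT.yhi, re_of_norm rfl]
    have l1 := Real.log_le_log (show (0 : ℝ) < t + 1 / 2 by linarith) (le_trans (by linarith) hb.1)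
    have l2 := Real.log_le_log (by linarith) (le_trans hb.2 (show (ρ : ℝ) ≤ ρ + 1 / 2 by linarith))
    constructor <;> linarith) (by
    intro w hw
    have := hM' w hw
    exact ⟨hp.trans this.1, this.2.trans hq⟩)
  exact Ev_disjoint ht (hCU.trans hS) hY (fun v hv hv' => hSY v (hCU hv) hv') (E0_sub t ρ _ hw2)
    (hT.ev w (hTφ w hw1))

lemma floor_strict {x y : ℝ} (h : ∀ k : ℤ, x + k * (4 * Real.pi) ≠ y) :
    x + ⌊(y - x) / (4 * Real.pi)⌋ * (4 * Real.pi) < y ∧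
      y < x + (⌊(y - x) / (4 * Real.pi)⌋ + 1 : ℤ) * (4 * Real.pi) := by
  have hp : (0 : ℝ) < 4 * Real.pi := by positivity
  have h1 := Int.floor_le ((y - x) / (4 * Real.pi))
  have h2 := Int.lt_floor_add_one ((y - x) / (4 * Real.pi))
  rw [le_div_iff₀ hp] at h1
  rw [div_lt_iff₀ hp] at h2
  refine ⟨lt_of_le_of_ne (by linarith) (h _), ?_⟩
  push_cast; linarith

theorem ann_coh {t ρ : ℤ} (ht : 1 ≤ t) {a a' b b' : ℂ} (haU : a ∈ annU t ρ) (haU' : a' ∈ annU t ρ)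
    (hbU : b ∈ annU t ρ) (hbU' : b' ∈ annU t ρ) (hab : a ≠ a') (hbb : b ≠ b')
    {da da' db db' : Fin 4} {σa σa' σb σb' : ℝ}
    (ha : Tip t ρ a da σa (t + 1 / 2)) (ha' : Tip t ρ a' da' σa' (t + 1 / 2))
    (hb : Tip t ρ b db σb (ρ + 1 / 2)) (hb' : Tip t ρ b' db' σb' (ρ + 1 / 2)) :
    ∃ σ : ℝ, (σ = 1 ∨ σ = -1) ∧ SG.Coh (annG t ρ ht) (annG t ρ ht).U a a' b b' σ := by
  have hU : ((annG t ρ ht).U : Set ℂ) ⊆ annU t ρ := by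
    intro v hv
    exact (annU_finite t ρ).mem_toFinset.1 hv
  have fa := floor_strict (tip_noncong ht haU haU' hab ha ha')
  have fb := floor_strict (tip_noncong ht hbU hbU' hbb hb hb')
  set n := ⌊((tip a' da' σa').im - (tip a da σa).im) / (4 * Real.pi)⌋ with hn
  set k := ⌊((tip b' db' σb').im - (tip b db σb).im) / (4 * Real.pi)⌋ with hk
  have hsub : ∀ {S : Set ℂ} {a b X s}, S ⊆ annU t ρ → SG.SW (annG t ρ ht) S a b X s →
      {v | v ∈ X} ⊆ annU t ρ := fun hS h v hv => hS (h.walk.mem v hv)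
  have parity : ∀ (p q : ℤ), ((-1 : ℝ)) ^ p * (-1) ^ q = (-1) ^ (p + q) := by
    intro p q; rw [zpow_add₀ (by norm_num)]
  have ev2 : ∀ p : ℤ, ((-1 : ℝ)) ^ (2 * p) = 1 := by
    intro p; rw [zpow_mul]; norm_num
  refine ⟨(-1) ^ (n + k), ?_, ?_, ?_, ?_⟩
  · rcases Int.even_or_odd (n + k) with h | h
    · left; exact h.neg_one_zpow
    · right; exact h.neg_one_zpow
  · intro X s Y s' hX hY hXY
    obtain ⟨m, hm, S, hS⟩ := cross_exists ht hU hX ha hb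
    obtain ⟨m', hm', T, hT⟩ := cross_exists ht hU hY ha' hb'
    have := cross_order ht (hsub hU hX) (hsub hU hY) hXY hS hT fa.1 fa.2 fb.1 fb.2
    rw [hm, hm', parity]
    have e : m + m' = n + k + 2 * (m' - n) := by omega
    rw [e, ← parity, ev2, mul_one]
  · intro X s Y s' hX hY hXY
    obtain ⟨m, hm, S, hS⟩ := cross_exists ht hU hX ha hb'
    obtain ⟨m', hm', T, hT⟩ := cross_exists ht hU hY ha' hb
    have := cross_order (k := -k - 1) ht (hsub hU hX) (hsub hU hY) hXY hS hT fa.1 fa.2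
      (by have := fb.2; push_cast at this ⊢; linarith) (by have := fb.1; push_cast at this ⊢; linarith)
    rw [hm, hm', parity]
    have e : m + m' = n + k + (1 + 2 * (m' - n - k - 1)) := by omega
    rw [e, ← parity, ← parity 1, ev2]
    norm_num
  · intro X s Y s' h hXY C u hC
    have hCU : ((((annG t ρ ht).U.filter (· ∉ Y) : Finset ℂ)) : Set ℂ) ⊆ annU t ρ := by
      intro v hv
      simp only [Finset.coe_filter, Set.mem_ofPred_eq] at hv
      exact hU hv.1
    have hCY : ∀ v ∈ ((((annG t ρ ht).U.filter (· ∉ Y) : Finset ℂ)) : Set ℂ), v ∉ Y := by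
      intro v hv
      simp only [Finset.coe_filter, Set.mem_ofPred_eq] at hv
      exact hv.2
    rcases h with ⟨-, hY⟩ | ⟨-, hY⟩
    · obtain ⟨m', hm', T, hT⟩ := cross_exists ht hU hY ha' hb'
      exact cross_bal ht (hsub hU hY) hT hCU hCY hC
    · obtain ⟨m', hm', T, hT⟩ := cross_exists ht hU hY ha' hb
      exact cross_bal ht (hsub hU hY) hT hCU hCY hC

end

section

/-! ### Comparison and quarter-cover lifts -/

lemma ann_comp {t ρ : ℤ} (ht : 1 ≤ t) (W : Finset ℂ) (hW : W ⊆ (annU_finite t ρ).toFinset)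
    (m Ψ e : ℂ → ℝ) (h1 : ∀ v ∈ W, m v ≤ ∑ d, 4⁻¹ * m (hnb d v) + e v)
    (h2 : ∀ v ∈ W, ∑ d, 4⁻¹ * Ψ (hnb d v) + e v ≤ Ψ v)
    (h3 : ∀ v ∈ W, ∀ d, hnb d v ∉ W → m (hnb d v) ≤ Ψ (hnb d v)) : ∀ v ∈ W, m v ≤ Ψ v := by
  intro v hv
  have := ann_mp ht (fun v => if v ∈ W then m v - Ψ v else 0) W hW (fun x hx => by simp [hx]) ?_ v
  · simp only [hv, if_true] at this; linarith
  · intro x hx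
    simp only [hx, if_true]
    have a1 := h1 x hx
    have a2 := h2 x hx
    have : ∑ d, 4⁻¹ * m (hnb d x) - ∑ d, 4⁻¹ * Ψ (hnb d x) ≤
        ∑ d, 4⁻¹ * (if hnb d x ∈ W then m (hnb d x) - Ψ (hnb d x) else 0) := by
      rw [← Finset.sum_sub_distrib]
      refine Finset.sum_le_sum fun d _ => ?_
      split_ifs with h
      · linarith
      · linarith [h3 x hx d h]
    linarith

/-- sign of a quarter-cover point relative to the principal branch -/
def usg (u : ℂ) : ℝ := if u = qr (u ^ 2) then 1 else -1

lemma usg_spec {u : ℂ} (h : u ≠ 0) : u = usg u * qr (u ^ 2) := by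
  have h1 : u ^ 2 = qr (u ^ 2) ^ 2 := (qr_sq (pow_ne_zero 2 h)).symm
  rcases sq_eq_sq_iff_eq_or_eq_neg.1 h1 with h2 | h2
  · rw [usg, if_pos h2]; simpa using h2
  · have h3 : u ≠ qr (u ^ 2) := by
      intro hc
      rw [← hc] at h2
      exact h (self_eq_neg.1 h2)
    rw [usg, if_neg h3]; simpa using h2

lemma usg_abs (u : ℂ) : usg u = 1 ∨ usg u = -1 := by
  unfold usg; split_ifs <;> simp

lemma usg_unique {u : ℂ} (h : u ≠ 0) {s : ℝ} (hs : u = s * qr (u ^ 2)) : usg u = s := by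
  have h1 := usg_spec h
  have := mul_right_cancel₀ (qr_ne (u ^ 2)) (h1.symm.trans hs)
  exact_mod_cast this

lemma usg_neg {u : ℂ} (h : u ≠ 0) : usg (-u) = - usg u := by
  refine usg_unique (neg_ne_zero.2 h) ?_
  have := usg_spec h
  rw [neg_sq]
  push_cast
  linear_combination -this

/-- neighbours in the quarter cover -/
def nb4 (d : Fin 4) (u : ℂ) : ℂ := u * Complex.exp (Complex.log (fac (u ^ 2) d 1) / 4)

lemma nb4_sq (d : Fin 4) (u : ℂ) : nb4 d u ^ 2 = hnb d (u ^ 2) := by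
  have h : Complex.log (fac (u ^ 2) d 1) / 4 = (Complex.log (fac (u ^ 2) d 1) / 2) / 2 := by ring
  rw [nb4, hnb, arc, mul_pow, h, exp_half_sq]

lemma nb4_neg (d : Fin 4) (u : ℂ) : nb4 d (-u) = - nb4 d u := by
  rw [nb4, nb4, neg_sq]; ring

lemma nb4_ne (d : Fin 4) {u : ℂ} (h : u ≠ 0) : nb4 d u ≠ 0 := mul_ne_zero h (Complex.exp_ne_zero _)

lemma Good.une {u : ℂ} {z : Lat} (h : Good (u ^ 2) z) : u ≠ 0 := by
  have := h.ne
  rintro rfl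
  simp at this

lemma Good.nb4_pow {u : ℂ} {z : Lat} (h : Good (u ^ 2) z) (d : Fin 4) :
    nb4 d u ^ 4 = toC (z + dirs d) := by
  rw [← h.hnb_sq d, ← nb4_sq]; ring

lemma Good.usg_nb4 {u : ℂ} {z : Lat} (h : Good (u ^ 2) z) (d : Fin 4) :
    usg (nb4 d u) = usg u * hsg d (u ^ 2) := by
  refine usg_unique (nb4_ne d h.une) ?_
  rw [nb4_sq, h.qr_hnb d, nb4]
  have h1 := usg_spec h.une
  have h2 : (hsg d (u ^ 2) : ℂ) * hsg d (u ^ 2) = 1 := by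
    rcases hsg_abs d (u ^ 2) with h | h <;> rw [h] <;> norm_num
  push_cast
  linear_combination (Complex.exp (Complex.log (fac (u ^ 2) d 1) / 4)) * h1 - (usg u * qr (u ^ 2) * Complex.exp (Complex.log (fac (u ^ 2) d 1) / 4)) * h2

/-- lift of a function on the double cover to an antiperiodic one on the quarter cover -/
def lf (f : ℂ → ℝ) (u : ℂ) : ℝ := usg u * f (u ^ 2)

lemma lf_neg (f : ℂ → ℝ) {u : ℂ} (h : u ≠ 0) : lf f (-u) = - lf f u := by
  rw [lf, lf, usg_neg h, neg_sq]; ring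

lemma lf_abs (f : ℂ → ℝ) (u : ℂ) : |lf f u| = |f (u ^ 2)| := by
  rw [lf, abs_mul]; rcases usg_abs u with h | h <;> rw [h] <;> simp

lemma lf_eq {f e : ℂ → ℝ} {u : ℂ} {z : Lat} (h : Good (u ^ 2) z)
    (he : f (u ^ 2) = ∑ d, hsg d (u ^ 2) * 4⁻¹ * f (hnb d (u ^ 2)) + e (u ^ 2)) :
    lf f u = ∑ d, 4⁻¹ * lf f (nb4 d u) + lf e u := by
  rw [lf, he, mul_add, Finset.mul_sum, lf]
  congr 1
  refine Finset.sum_congr rfl fun d _ => ?_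
  rw [lf, h.usg_nb4 d, nb4_sq]; ring

/-- conjugation of directions -/
def cj : Fin 4 → Fin 4 := ![0, 1, 3, 2]

lemma dC_cj (d : Fin 4) : dC (cj d) = (starRingEnd ℂ) (dC d) := by
  fin_cases d <;> apply Complex.ext <;> simp [dC, cj, dirs, toC]

/-- conjugate lattice point -/
def zcj (z : Lat) : Lat := (z.1, -z.2)

lemma toC_zcj (z : Lat) : toC (zcj z) = (starRingEnd ℂ) (toC z) := by
  apply Complex.ext <;> simp [toC, zcj]

lemma nsq_zcj (z : Lat) : nsq (zcj z) = nsq z := by simp [nsq, zcj]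

lemma zcj_dirs (z : Lat) (d : Fin 4) : zcj (z + dirs d) = zcj z + dirs (cj d) := by
  fin_cases d <;> simp [zcj, dirs, cj, add_comm]

/-- the reflection with axis `Im (c u) = 0` -/
def rf (c u : ℂ) : ℂ := (starRingEnd ℂ) (c * u) / c

/-- the coordinate -/
def lam (c u : ℂ) : ℝ := (c * u).im

lemma rf_sq_pow {c : ℂ} (hc : c ≠ 0) (hc4 : (c ^ 4).im = 0) (u : ℂ) :
    rf c u ^ 4 = (starRingEnd ℂ) (u ^ 4) := by
  have h : (starRingEnd ℂ) (c ^ 4) = c ^ 4 := Complex.conj_eq_iff_im.2 hc4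
  rw [rf, div_pow, ← map_pow, mul_pow, map_mul, h]
  field_simp

lemma rf_good {c : ℂ} (hc : c ≠ 0) (hc4 : (c ^ 4).im = 0) {u : ℂ} {z : Lat} (h : Good (u ^ 2) z) :
    Good (rf c u ^ 2) (zcj z) := by
  refine ⟨?_, by rw [nsq_zcj]; exact h.2⟩
  rw [toC_zcj, ← h.1, ← pow_mul, ← pow_mul]
  exact rf_sq_pow hc hc4 u

lemma rf_nb4 {c : ℂ} (hc : c ≠ 0) (hc4 : (c ^ 4).im = 0) {u : ℂ} {z : Lat} (h : Good (u ^ 2) z)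
    (d : Fin 4) : rf c (nb4 d u) = nb4 (cj d) (rf c u) := by
  have h1 : fac (rf c u ^ 2) (cj d) 1 = (starRingEnd ℂ) (fac (u ^ 2) d 1) := by
    rw [fac, fac, dC_cj, ← pow_mul, ← pow_mul, rf_sq_pow hc hc4]
    simp
  rw [nb4, nb4, h1, Complex.log_conj, rf, rf, map_mul, map_mul, map_mul, ← Complex.exp_conj]
  · simp only [map_div₀, Complex.conj_ofNat]; ring
  · have := abs_lt.1 (Complex.abs_arg_lt_pi_div_two_iff.2 (Or.inl (h.fac_re d zero_le_one le_rfl)))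
    have := Real.pi_pos
    intro hc; linarith

lemma rf_neg (c u : ℂ) : rf c (-u) = - rf c u := by simp [rf, neg_div]

lemma rf_fix {c : ℂ} (hc : c ≠ 0) {u : ℂ} (h : lam c u = 0) : rf c u = u := by
  rw [rf, Complex.conj_eq_iff_im.2 h]; field_simp

lemma sum_cj (F : Fin 4 → ℝ) : ∑ d, F (cj d) = ∑ d, F d := by
  simp [Fin.sum_univ_four, cj]; ring

/-- antisymmetrised lift -/
def gf (c : ℂ) (f : ℂ → ℝ) (u : ℂ) : ℝ := lf f u - lf f (rf c u)

lemma rf_ne {c : ℂ} (hc : c ≠ 0) {u : ℂ} (h : u ≠ 0) : rf c u ≠ 0 := by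
  rw [rf]; exact div_ne_zero (by simpa using ⟨hc, h⟩) hc

lemma gf_neg {c : ℂ} (hc : c ≠ 0) (f : ℂ → ℝ) {u : ℂ} (h : u ≠ 0) : gf c f (-u) = - gf c f u := by
  rw [gf, gf, rf_neg, lf_neg f h, lf_neg f (rf_ne hc h)]; ring

lemma gf_eq {c : ℂ} (hc : c ≠ 0) (hc4 : (c ^ 4).im = 0) {f e : ℂ → ℝ} {t ρ : ℤ}
    (he : ∀ v z, Good v z → t < nsq z → nsq z ≤ ρ → f v = ∑ d, hsg d v * 4⁻¹ * f (hnb d v) + e v)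
    {u : ℂ} {z : Lat} (h : Good (u ^ 2) z) (h1 : t < nsq z) (h2 : nsq z ≤ ρ) :
    gf c f u = ∑ d, 4⁻¹ * gf c f (nb4 d u) + gf c e u := by
  have hg := rf_good hc hc4 h
  have e1 := lf_eq h (he _ z h h1 h2)
  have e2 := lf_eq hg (he _ _ hg (by rwa [nsq_zcj]) (by rwa [nsq_zcj]))
  rw [gf, gf, e1, e2, ← sum_cj]
  have : ∑ d, (4 : ℝ)⁻¹ * gf c f (nb4 d u) =
    ∑ d, 4⁻¹ * lf f (nb4 d u) - ∑ d, 4⁻¹ * lf f (nb4 (cj d) (rf c u)) := by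
    rw [← Finset.sum_sub_distrib]
    refine Finset.sum_congr rfl fun d _ => ?_
    rw [gf, rf_nb4 hc hc4 h]; ring
  rw [this, sum_cj (fun d => 4⁻¹ * lf f (nb4 d u)), sum_cj (fun d => 4⁻¹ * lf f (nb4 d (rf c u)))]
  ring

lemma qr_hnb_pm {v : ℂ} {z : Lat} (h : Good v z) (d : Fin 4) :
    qr (hnb d v) = nb4 d (qr v) ∨ qr (hnb d v) = - nb4 d (qr v) := by
  rw [h.qr_hnb, nb4, qr_sq h.ne]
  rcases hsg_abs d v with h | h <;> rw [h] <;> simp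

/-- neighbours do not jump over the axis -/
lemma lam_nb4 {c : ℂ} (hc4 : (c ^ 4).im = 0) {u : ℂ} {z : Lat} (h : Good (u ^ 2) z)
    (hl : 0 < lam c u) (d : Fin 4) : 0 ≤ lam c (nb4 d u) := by
  by_contra hneg
  push Not at hneg
  let p : ℝ → ℂ := fun s => u * Complex.exp (Complex.log (fac (u ^ 2) d s) / 4)
  have hcont : ContinuousOn (fun s => lam c (p s)) (Set.Icc 0 1) := by
    have : ContinuousOn (fun s : ℝ => fac (u ^ 2) d s) (Set.Icc 0 1) := by
      unfold fac; fun_prop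
    have h2 : ContinuousOn (fun s : ℝ => Complex.log (fac (u ^ 2) d s)) (Set.Icc 0 1) :=
      this.clog fun s hs => Or.inl (h.fac_re d hs.1 hs.2)
    have h3 : ContinuousOn p (Set.Icc 0 1) := by
      apply ContinuousOn.mul continuousOn_const
      exact Complex.continuous_exp.comp_continuousOn (h2.div_const _)
    exact Complex.continuous_im.comp_continuousOn (continuousOn_const.mul h3)
  have p0 : p 0 = u := by simp [p, fac]
  have p1 : p 1 = nb4 d u := rfl
  obtain ⟨s, hs, hs0⟩ := intermediate_value_Icc' zero_le_one hcont
    (show (0 : ℝ) ∈ _ by simp only [p0, p1]; exact ⟨hneg.le, hl.le⟩)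
  have hs0' : s ≠ 0 := by rintro rfl; simp only [p0] at hs0; linarith
  have hs1' : s ≠ 1 := by rintro rfl; simp only [p1] at hs0; linarith
  have hs1 : 0 < s := lt_of_le_of_ne hs.1 (Ne.symm hs0')
  have hs2 : s < 1 := lt_of_le_of_ne hs.2 hs1'
  have hp4 : p s ^ 4 = toC z + s * dC d := by
    have : p s ^ 4 = arc (u ^ 2) d s ^ 2 := by
      simp only [p, arc, mul_pow, ← Complex.exp_nat_mul]; push_cast
      rw [← pow_mul]; congr 2; ring
    rw [this, h.arc_sq d hs.1 hs.2]
  have him : ((c * p s) ^ 4).im = 0 := by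
    have : c * p s = ((c * p s).re : ℂ) := by
      apply Complex.ext <;> simp; simpa [lam] using hs0
    rw [this, ← Complex.ofReal_pow, Complex.ofReal_im]
  have hc0 : c ≠ 0 := by rintro rfl; simp [lam] at hl
  rw [mul_pow, hp4] at him
  have hcr : c ^ 4 = ((c ^ 4).re : ℂ) := by apply Complex.ext <;> simp [hc4]
  have hre : (c ^ 4).re ≠ 0 := by
    intro hh; rw [hh] at hcr; exact pow_ne_zero 4 hc0 (by simpa using hcr)
  rw [hcr, Complex.im_ofReal_mul] at him
  have him' := (mul_eq_zero.1 him).resolve_left hre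
  have hnotint : ∀ k : ℤ, (k : ℝ) ≠ s := by
    intro k hk
    rw [← hk] at hs1 hs2
    have a1 : 0 < k := by exact_mod_cast hs1
    have a2 : k < 1 := by exact_mod_cast hs2
    omega
  have him2 : (z.2 : ℝ) + s * (dC d).im = 0 := by simpa [toC] using him'
  have hz2 : z.2 = 0 ∧ (dC d).im = 0 := by
    fin_cases d
    · simpa [dC, dirs, toC] using him2
    · simpa [dC, dirs, toC] using him2
    · exact absurd (show ((-z.2 : ℤ) : ℝ) = s by simp [dC, dirs, toC] at him2; push_cast; linarith) (hnotint _)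
    · exact absurd (show ((z.2 : ℤ) : ℝ) = s by simp [dC, dirs, toC] at him2; linarith) (hnotint _)
  have hz : toC z = ((z.1 : ℝ) : ℂ) := by apply Complex.ext <;> simp [toC, hz2.1]
  have hd : dC d = ((dC d).re : ℂ) := by apply Complex.ext <;> simp [hz2.2]
  have hfac : fac (u ^ 2) d s = ((1 + s * (dC d).re / z.1 : ℝ) : ℂ) := by
    rw [fac, h.1, hz, hd]; push_cast; simp
  have hpos := h.fac_re d hs.1 hs.2
  rw [hfac, Complex.ofReal_re] at hpos
  have hps : p s = u * (Real.exp (Real.log (1 + s * (dC d).re / z.1) / 4) : ℝ) := by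
    simp only [p]
    rw [hfac, ← Complex.ofReal_log hpos.le]; push_cast; rfl
  have : lam c (p s) = lam c u * Real.exp (Real.log (1 + s * (dC d).re / z.1) / 4) := by
    rw [lam, lam, hps, ← mul_assoc, Complex.im_mul_ofReal]
  have h5 : lam c (p s) = 0 := hs0
  rw [this] at h5
  exact absurd h5 (mul_pos hl (Real.exp_pos _)).ne'

end

section

/-! ### Quarter-power estimates -/

lemma quarter_avg : ∃ C : ℝ, 0 < C ∧ ∀ ζ : ℂ, ‖ζ‖ < 1 / 4 →
    ‖∑ d, (4 : ℂ)⁻¹ * Complex.exp (Complex.log (1 + dC d * ζ) / 4) - 1‖ ≤ C * ‖ζ‖ ^ 4 := by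
  let f : ℂ → ℂ := fun ζ => Complex.exp (Complex.log (1 + ζ) / 4)
  have hd : DifferentiableOn ℂ f (Metric.closedBall 0 ((1 / 2 : ℝ≥0) : ℝ)) := by
    intro ζ hζ
    have h1 : ‖ζ‖ ≤ 1 / 2 := by simpa using hζ
    have h2 : 1 + ζ ∈ Complex.slitPlane := by
      left
      have := (abs_le.1 (Complex.abs_re_le_norm ζ)).1
      simp; linarith
    apply DifferentiableAt.differentiableWithinAt
    have : DifferentiableAt ℂ (fun ζ => Complex.log (1 + ζ)) ζ :=
      DifferentiableAt.clog (by fun_prop) h2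
    simp only [f]
    fun_prop
  obtain ⟨p, hp⟩ : ∃ p, HasFPowerSeriesOnBall f p 0 ((1 / 2 : ℝ≥0) : ℝ≥0∞) :=
    ⟨_, hd.hasFPowerSeriesOnBall (by norm_num)⟩
  obtain ⟨a, ha, C, hC, hb⟩ := hp.uniform_geometric_approx' (r' := (1 / 4 : ℝ≥0)) (by
    rw [ENNReal.coe_lt_coe, ← NNReal.coe_lt_coe]; norm_num)
  have key : ∀ ζ : ℂ, ‖ζ‖ < 1 / 4 → ‖f ζ - p.partialSum 4 ζ‖ ≤ (C * 256) * ‖ζ‖ ^ 4 := by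
    intro ζ hζ
    have := hb ζ (by simpa using hζ) 4
    rw [zero_add] at this
    refine this.trans ?_
    have e : (a * (‖ζ‖ / ((1 / 4 : ℝ≥0) : ℝ))) ^ 4 = a ^ 4 * 256 * ‖ζ‖ ^ 4 := by
      push_cast; ring
    rw [e]
    have : a ^ 4 ≤ 1 := pow_le_one₀ ha.1.le ha.2.le
    have h3 : (0 : ℝ) ≤ ‖ζ‖ ^ 4 := by positivity
    nlinarith [mul_le_mul_of_nonneg_right this h3]
  have hf0 : p.coeff 0 = 1 := by
    rw [FormalMultilinearSeries.coeff, hp.coeff_zero]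
    simp only [f]
    rw [add_zero, Complex.log_one, zero_div, Complex.exp_zero]
  refine ⟨C * 256, by positivity, fun ζ hζ => ?_⟩
  have hsum : ∑ d, (4 : ℂ)⁻¹ * p.partialSum 4 (dC d * ζ) = 1 := by
    simp only [FormalMultilinearSeries.partialSum, FormalMultilinearSeries.apply_eq_pow_smul_coeff,
      Finset.sum_range_succ, Finset.sum_range_zero, Fin.sum_univ_four, smul_eq_mul, hf0]
    have d0 : dC 0 = 1 := by apply Complex.ext <;> simp [dC, dirs, toC]
    have d1 : dC 1 = -1 := by apply Complex.ext <;> simp [dC, dirs, toC]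
    have d2 : dC 2 = Complex.I := by apply Complex.ext <;> simp [dC, dirs, toC]
    have d3 : dC 3 = -Complex.I := by apply Complex.ext <;> simp [dC, dirs, toC]
    rw [d0, d1, d2, d3]
    linear_combination (ζ ^ 2 * p.coeff 2 / 2) * Complex.I_sq
  have e0 : ∑ d, (4 : ℂ)⁻¹ * Complex.exp (Complex.log (1 + dC d * ζ) / 4) - 1 =
      ∑ d, ((4 : ℂ)⁻¹ * Complex.exp (Complex.log (1 + dC d * ζ) / 4) -
      4⁻¹ * p.partialSum 4 (dC d * ζ)) := by
    rw [Finset.sum_sub_distrib, hsum]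
  rw [e0]
  refine (norm_sum_le _ _).trans ?_
  have : ∀ d ∈ Finset.univ, ‖(4 : ℂ)⁻¹ * Complex.exp (Complex.log (1 + dC d * ζ) / 4) -
      4⁻¹ * p.partialSum 4 (dC d * ζ)‖ ≤ 4⁻¹ * ((C * 256) * ‖ζ‖ ^ 4) := by
    intro d _
    have hn : ‖dC d * ζ‖ = ‖ζ‖ := by rw [norm_mul, norm_dC, one_mul]
    rw [← mul_sub, norm_mul]
    have := key (dC d * ζ) (by rwa [hn])
    rw [hn] at this
    simp only [norm_inv, Complex.norm_ofNat]
    gcongr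
  refine (Finset.sum_le_sum this).trans ?_
  simp

lemma Good.norm4 {u : ℂ} {z : Lat} (h : u ^ 4 = toC z) : (‖u‖ ^ 4) ^ 2 = nsq z := by
  rw [← norm_pow, h, norm_toC_sq]

lemma nb4_avg : ∃ C : ℝ, 0 < C ∧ ∀ (u : ℂ) (z : Lat), Good (u ^ 2) z → 100 ≤ nsq z →
    ‖∑ d, (4 : ℂ)⁻¹ * nb4 d u - u‖ ≤ C * ‖u‖ * (1 / ‖u‖ ^ 4) ^ 4 := by
  obtain ⟨C, hC, h⟩ := quarter_avg
  refine ⟨C, hC, fun u z hz h100 => ?_⟩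
  have hn := Good.norm4 (u := u) (z := z) (by rw [← hz.1]; ring)
  have h100' : (100 : ℝ) ≤ nsq z := by exact_mod_cast h100
  have h10 : 10 ≤ ‖u‖ ^ 4 := by
    have : 0 ≤ ‖u‖ ^ 4 := by positivity
    nlinarith
  have := h (1 / u ^ 4) (by
    rw [norm_div, norm_one, norm_pow]
    rw [div_lt_div_iff₀ (by linarith) (by norm_num)]; linarith)
  have e : ∑ d, (4 : ℂ)⁻¹ * nb4 d u - u =
      u * (∑ d, (4 : ℂ)⁻¹ * Complex.exp (Complex.log (1 + dC d * (1 / u ^ 4)) / 4) - 1) := by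
    rw [mul_sub, Finset.mul_sum, mul_one]
    congr 1
    refine Finset.sum_congr rfl fun d _ => ?_
    rw [nb4, fac]
    have : ((1 : ℝ) : ℂ) * dC d / (u ^ 2) ^ 2 = dC d * (1 / u ^ 4) := by
      rw [← pow_mul]; push_cast; ring
    rw [this]; ring
  rw [e, norm_mul]
  rw [norm_div, norm_one, norm_pow] at this
  calc _ ≤ ‖u‖ * (C * (1 / ‖u‖ ^ 4) ^ 4) := by gcongr
    _ = _ := by ring

lemma invsqrt_taylor {t : ℝ} (h : |t| ≤ 1 / 4) :
    1 - t / 2 + 3 / 8 * t ^ 2 - 5 / 16 * t ^ 3 ≤ 1 / Real.sqrt (1 + t) := by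
  have h1 := abs_le.1 h
  have hp : 0 < 1 + t := by linarith
  have hs := Real.sqrt_pos.2 hp
  have hsq := Real.sq_sqrt hp.le
  rw [le_div_iff₀ hs]
  set q := 1 - t / 2 + 3 / 8 * t ^ 2 - 5 / 16 * t ^ 3 with hq
  have hq0 : 0 < q := by
    have : t ^ 2 ≤ 1 / 16 := by nlinarith
    nlinarith
  have : (q * Real.sqrt (1 + t)) ^ 2 ≤ 1 := by
    rw [mul_pow, hsq]
    have e : 1 - q ^ 2 * (1 + t) =
        t ^ 4 * (35 / 64 - 14 / 64 * t + 35 / 256 * t ^ 2 - 25 / 256 * t ^ 3) := by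
      rw [hq]; ring
    have : 0 ≤ t ^ 4 * (35 / 64 - 14 / 64 * t + 35 / 256 * t ^ 2 - 25 / 256 * t ^ 3) := by
      apply mul_nonneg (by positivity)
      nlinarith [sq_nonneg t]
    linarith
  nlinarith [mul_pos hq0 hs]

lemma invnorm_avg (z : Lat) (hz : 100 ≤ nsq z) :
    1 / Real.sqrt (nsq z) * (1 + 1 / (8 * nsq z)) ≤ ∑ d, 4⁻¹ * (1 / Real.sqrt (nsq (z + dirs d))) := by
  set s : ℝ := ((nsq z : ℤ) : ℝ) with hs
  have hs100 : (100 : ℝ) ≤ s := by rw [hs]; exact_mod_cast hz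
  have hxy : s = (z.1 : ℝ) ^ 2 + (z.2 : ℝ) ^ 2 := by rw [hs, nsq]; push_cast; ring
  have key : ∀ x : ℝ, x ^ 2 ≤ s → 1 / Real.sqrt s * (1 - (1 + 2 * x) / s / 2 + 3 / 8 * ((1 + 2 * x) / s) ^ 2
      - 5 / 16 * ((1 + 2 * x) / s) ^ 3) ≤ 1 / Real.sqrt (s + (1 + 2 * x)) := by
    intro x hx
    have h1 : |(1 + 2 * x) / s| ≤ 1 / 4 := by
      rw [abs_div, abs_of_pos (show 0 < s by linarith), div_le_iff₀ (by linarith)]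
      apply abs_le_of_sq_le_sq
      · nlinarith [sq_nonneg (x - 1)]
      · linarith
    have h2 := invsqrt_taylor h1
    have e : s + (1 + 2 * x) = s * (1 + (1 + 2 * x) / s) := by field_simp
    rw [e, Real.sqrt_mul (by linarith), one_div, one_div, mul_inv, ← one_div (Real.sqrt (1 + _))]
    exact mul_le_mul_of_nonneg_left h2 (by positivity)
  have hx : ∀ d, ∃ x : ℝ, ((nsq (z + dirs d) : ℤ) : ℝ) = s + (1 + 2 * x) ∧ x ^ 2 ≤ s ∧
      x = ![(z.1 : ℝ), -z.1, z.2, -z.2] d := by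
    intro d
    refine ⟨_, ?_, ?_, rfl⟩
    · rw [hxy]; fin_cases d <;> simp [nsq, dirs] <;> ring
    · rw [hxy]; fin_cases d <;> simp <;> nlinarith [sq_nonneg (z.1 : ℝ), sq_nonneg (z.2 : ℝ)]
  have hsum : ∑ d, 4⁻¹ * (1 / Real.sqrt s * (1 - (1 + 2 * (![(z.1 : ℝ), -z.1, z.2, -z.2] d)) / s / 2 + 3 / 8 * ((1 + 2 * (![(z.1 : ℝ), -z.1, z.2, -z.2] d)) / s) ^ 2
      - 5 / 16 * ((1 + 2 * (![(z.1 : ℝ), -z.1, z.2, -z.2] d)) / s) ^ 3)) =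
      1 / Real.sqrt s * (1 - 1 / (2 * s) + 3 / 8 * ((1 + 2 * s) / s ^ 2) - 5 / 16 * ((1 + 6 * s) / s ^ 3)) := by
    rw [← Finset.mul_sum, ← Finset.mul_sum, mul_left_comm]
    congr 1
    simp [Fin.sum_univ_four]
    have hs0 : s ≠ 0 := by linarith
    field_simp
    rw [hxy]; ring
  have hfin : 1 / Real.sqrt s * (1 + 1 / (8 * s)) ≤
      1 / Real.sqrt s * (1 - 1 / (2 * s) + 3 / 8 * ((1 + 2 * s) / s ^ 2) - 5 / 16 * ((1 + 6 * s) / s ^ 3)) := by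
    apply mul_le_mul_of_nonneg_left _ (by positivity)
    have : (1 - 1 / (2 * s) + 3 / 8 * ((1 + 2 * s) / s ^ 2) - 5 / 16 * ((1 + 6 * s) / s ^ 3)) - (1 + 1 / (8 * s)) =
      (2 * s ^ 2 - 24 * s - 5) / (16 * s ^ 3) := by
      have hs0 : s ≠ 0 := by linarith
      field_simp; ring
    have h2 : 0 ≤ (2 * s ^ 2 - 24 * s - 5) / (16 * s ^ 3) := by
      apply div_nonneg
      · nlinarith
      · positivity
    linarith
  refine hfin.trans (hsum.symm.le.trans (Finset.sum_le_sum fun d _ => ?_))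
  obtain ⟨x, h1, h2, h3⟩ := hx d
  rw [h1, ← h3]
  exact mul_le_mul_of_nonneg_left (key x h2) (by norm_num)

lemma lam_good_one {u : ℂ} (h : (u ^ 4).re ≤ ‖u‖ ^ 4 / 2) :
    ‖u‖ ≤ 4 * |lam 1 u| ∧ ‖u‖ ≤ 4 * |lam Complex.I u| := by
  have hn : ‖u‖ ^ 2 = u.re ^ 2 + u.im ^ 2 := by
    rw [← Complex.normSq_eq_norm_sq, Complex.normSq_apply]; ring
  have hre : (u ^ 4).re = (‖u‖ ^ 2) ^ 2 - 8 * u.re ^ 2 * u.im ^ 2 := by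
    rw [hn]; simp [pow_succ, Complex.mul_re, Complex.mul_im]; ring
  rw [hre] at h
  have h4 : ‖u‖ ^ 4 = (‖u‖ ^ 2) ^ 2 := by ring
  rw [h4, hn] at h
  set p := u.re; set q := u.im
  have hp := sq_nonneg p
  have hq := sq_nonneg q
  have h16 : (p ^ 2 + q ^ 2) ^ 2 ≤ 16 * (p ^ 2 * q ^ 2) := by nlinarith
  have a1 : ‖u‖ ^ 2 ≤ (4 * |q|) ^ 2 := by
    rw [hn, mul_pow, sq_abs]
    by_contra hc
    push Not at hc
    nlinarith
  have a2 : ‖u‖ ^ 2 ≤ (4 * |p|) ^ 2 := by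
    rw [hn, mul_pow, sq_abs]
    by_contra hc
    push Not at hc
    nlinarith
  constructor
  · have : lam 1 u = q := by simp [lam, q]
    rw [this]; exact le_of_sq_le_sq a1 (by positivity)
  · have : lam Complex.I u = p := by simp [lam, p]
    rw [this]; exact le_of_sq_le_sq a2 (by positivity)

lemma lam_good_two {u : ℂ} (h : -(‖u‖ ^ 4 / 2) ≤ (u ^ 4).re) :
    ‖u‖ ≤ 4 * |lam (1 - Complex.I) u| ∧ ‖u‖ ≤ 4 * |lam (1 + Complex.I) u| := by
  have hn : ‖u‖ ^ 2 = u.re ^ 2 + u.im ^ 2 := by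
    rw [← Complex.normSq_eq_norm_sq, Complex.normSq_apply]; ring
  have hre : (u ^ 4).re = (‖u‖ ^ 2) ^ 2 - 8 * u.re ^ 2 * u.im ^ 2 := by
    rw [hn]; simp [pow_succ, Complex.mul_re, Complex.mul_im]; ring
  rw [hre] at h
  have h4 : ‖u‖ ^ 4 = (‖u‖ ^ 2) ^ 2 := by ring
  rw [h4, hn] at h
  set p := u.re; set q := u.im
  have hp := sq_nonneg (p + q)
  have hq := sq_nonneg (q - p)
  have h16 : (p ^ 2 + q ^ 2) ^ 2 ≤ 4 * ((p + q) ^ 2 * (q - p) ^ 2) := by nlinarith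
  have hs : (p + q) ^ 2 + (q - p) ^ 2 = 2 * (p ^ 2 + q ^ 2) := by ring
  have a1 : ‖u‖ ^ 2 ≤ (4 * |q - p|) ^ 2 := by
    rw [hn, mul_pow, sq_abs]
    by_contra hc
    push Not at hc
    nlinarith
  have a2 : ‖u‖ ^ 2 ≤ (4 * |p + q|) ^ 2 := by
    rw [hn, mul_pow, sq_abs]
    by_contra hc
    push Not at hc
    nlinarith
  constructor
  · have : lam (1 - Complex.I) u = q - p := by simp [lam, q, p]; ring
    rw [this]; exact le_of_sq_le_sq a1 (by positivity)
  · have : lam (1 + Complex.I) u = p + q := by simp [lam, q, p]; ring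
    rw [this]; exact le_of_sq_le_sq a2 (by positivity)

end

section

/-! ### The main comparison in the quarter cover -/

lemma gf_off {c : ℂ} (hc : c ≠ 0) (hc4 : (c ^ 4).im = 0) {f : ℂ → ℝ} {t ρ : ℤ}
    (h0 : ∀ v ∉ annU t ρ, f v = 0) {v : ℂ} (hv : v ∉ annU t ρ) (hv0 : v ≠ 0) : gf c f (qr v) = 0 := by
  have h1 : lf f (qr v) = 0 := by rw [lf, qr_sq hv0, h0 v hv, mul_zero]
  have h2 : lf f (rf c (qr v)) = 0 := by
    rw [lf, h0, mul_zero]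
    rintro ⟨z, hz, hz1, hz2⟩
    refine hv ⟨zcj z, ?_, by rwa [nsq_zcj], by rwa [nsq_zcj]⟩
    rw [← pow_mul, rf_sq_pow hc hc4, pow_mul _ 2 2, qr_sq hv0] at hz
    rw [toC_zcj, ← hz, Complex.conj_conj]
  rw [gf, h1, h2, sub_zero]

lemma gf_axis {c : ℂ} (hc : c ≠ 0) (f : ℂ → ℝ) {u : ℂ} (h : lam c u = 0) : gf c f u = 0 := by
  rw [gf, rf_fix hc h, sub_self]

lemma lam_neg (c u : ℂ) : lam c (-u) = - lam c u := by simp [lam]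

lemma lam_le (c u : ℂ) : |lam c u| ≤ ‖c‖ * ‖u‖ := by
  rw [← norm_mul]; exact Complex.abs_im_le_norm _

/-- the barrier -/
def psi (K : ℝ) (c u : ℂ) : ℝ := |lam c u| + K * (1 - 1 / ‖u‖ ^ 4)

lemma psi_neg (K : ℝ) (c u : ℂ) : psi K c (-u) = psi K c u := by simp [psi, lam_neg]

lemma norm4_eq {u : ℂ} {z : Lat} (h : u ^ 4 = toC z) : ‖u‖ ^ 4 = Real.sqrt (nsq z) := by
  rw [← Good.norm4 h, Real.sqrt_sq (by positivity)]

lemma psi_nonneg {K : ℝ} (hK : 0 ≤ K) {c u : ℂ} {z : Lat} (h : u ^ 4 = toC z) (hz : 1 ≤ nsq z) :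
    0 ≤ psi K c u := by
  rw [psi]
  have h1 : 1 ≤ ‖u‖ ^ 4 := by
    rw [norm4_eq h]; exact Real.one_le_sqrt.2 (by exact_mod_cast hz)
  have : 1 / ‖u‖ ^ 4 ≤ 1 := by rw [div_le_one (by linarith)]; exact h1
  have := mul_nonneg hK (sub_nonneg.2 this)
  positivity

lemma psi_super : ∃ K : ℝ, 0 < K ∧ ∀ (c u : ℂ) (z : Lat), (c ^ 4).im = 0 → ‖c‖ ≤ 2 → Good (u ^ 2) z →
    100 ≤ nsq z → lam c u ≠ 0 → ∑ d, 4⁻¹ * psi K c (nb4 d u) ≤ psi K c u := by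
  obtain ⟨C, hC, h⟩ := nb4_avg
  refine ⟨16 * C, by positivity, ?_⟩
  have main : ∀ (c u : ℂ) (z : Lat), (c ^ 4).im = 0 → ‖c‖ ≤ 2 → Good (u ^ 2) z →
    100 ≤ nsq z → 0 < lam c u → ∑ d, 4⁻¹ * psi (16 * C) c (nb4 d u) ≤ psi (16 * C) c u := by
    intro c u z hc4 hc2 hg hz hl
    have hu4 : u ^ 4 = toC z := by rw [← hg.1]; ring
    have hn := norm4_eq hu4
    have h100 : (100 : ℝ) ≤ nsq z := by exact_mod_cast hz
    have h1 : ∑ d, (4 : ℝ)⁻¹ * |lam c (nb4 d u)| = lam c (∑ d, (4 : ℂ)⁻¹ * nb4 d u) := by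
      have e : lam c (∑ d, (4 : ℂ)⁻¹ * nb4 d u) = ∑ d, lam c ((4 : ℂ)⁻¹ * nb4 d u) := by
        simp only [lam, Finset.mul_sum, Complex.im_sum]
      rw [e]
      refine Finset.sum_congr rfl fun d _ => ?_
      rw [abs_of_nonneg (lam_nb4 hc4 hg hl d), lam, lam]
      have : c * ((4 : ℂ)⁻¹ * nb4 d u) = ((4⁻¹ : ℝ) : ℂ) * (c * nb4 d u) := by push_cast; ring
      rw [this, Complex.im_ofReal_mul]
    have h2 : lam c (∑ d, (4 : ℂ)⁻¹ * nb4 d u) ≤ |lam c u| + 2 * (C * ‖u‖ * (1 / ‖u‖ ^ 4) ^ 4) := by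
      have e : lam c (∑ d, (4 : ℂ)⁻¹ * nb4 d u) = lam c u + lam c (∑ d, (4 : ℂ)⁻¹ * nb4 d u - u) := by
        simp only [lam, mul_sub, Complex.sub_im]; ring
      have a := (le_abs_self _).trans (lam_le c (∑ d, (4 : ℂ)⁻¹ * nb4 d u - u))
      have b := h u z hg hz
      have : ‖c‖ * ‖∑ d, (4 : ℂ)⁻¹ * nb4 d u - u‖ ≤ 2 * (C * ‖u‖ * (1 / ‖u‖ ^ 4) ^ 4) := by
        gcongr
      rw [e]; linarith [le_abs_self (lam c u)]
    have h3 := invnorm_avg z hz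
    have h4 : ∑ d, (4 : ℝ)⁻¹ * (1 / ‖nb4 d u‖ ^ 4) = ∑ d, 4⁻¹ * (1 / Real.sqrt (nsq (z + dirs d))) := by
      refine Finset.sum_congr rfl fun d _ => ?_
      rw [norm4_eq (hg.nb4_pow d)]
    rw [← h4, ← hn] at h3
    have hs2 : ((nsq z : ℤ) : ℝ) = (‖u‖ ^ 4) ^ 2 := (Good.norm4 hu4).symm
    rw [hs2] at h3 h100
    have e : ∑ d, 4⁻¹ * psi (16 * C) c (nb4 d u) =
        ∑ d, (4 : ℝ)⁻¹ * |lam c (nb4 d u)| + 16 * C * (1 - ∑ d, (4 : ℝ)⁻¹ * (1 / ‖nb4 d u‖ ^ 4)) := by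
      simp only [psi, Fin.sum_univ_four]; ring
    rw [e, h1, psi]
    set n := ‖u‖ with hnn
    have hn0 : 0 ≤ n := norm_nonneg _
    have hn1 : 1 ≤ n ^ 4 := by
      have : 0 ≤ n ^ 4 := by positivity
      nlinarith
    have hn1' : 1 ≤ n := by
      by_contra hc
      push Not at hc
      have : n ^ 4 < 1 := pow_lt_one₀ hn0 hc (by norm_num)
      linarith
    have h5 : n * (1 / n ^ 4) ^ 4 ≤ 1 / n ^ 4 * (1 / (n ^ 4) ^ 2) := by
      have : n * (1 / n ^ 4) ^ 4 = 1 / n ^ 15 := by field_simp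
      have e2 : 1 / n ^ 4 * (1 / (n ^ 4) ^ 2) = 1 / n ^ 12 := by field_simp
      rw [this, e2]
      apply one_div_le_one_div_of_le (by positivity)
      exact pow_le_pow_right₀ hn1' (by norm_num)
    have h6 : 1 / n ^ 4 * (1 + 1 / (8 * (n ^ 4) ^ 2)) = 1 / n ^ 4 + 1 / 8 * (1 / n ^ 4 * (1 / (n ^ 4) ^ 2)) := by
      field_simp
    rw [h6] at h3
    have h7 := mul_le_mul_of_nonneg_left h5 (show 0 ≤ 2 * C by positivity)
    have h8 := mul_le_mul_of_nonneg_left h3 (show 0 ≤ 16 * C by positivity)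
    nlinarith
  intro c u z hc4 hc2 hg hz hl
  rcases lt_or_gt_of_ne hl with h' | h'
  · have := main c (-u) z hc4 hc2 (by rwa [neg_sq]) hz (by rw [lam_neg]; linarith)
    simpa [nb4_neg, psi_neg] using this
  · exact main c u z hc4 hc2 hg hz h'

lemma nsq_ge_one {z : Lat} (hz : 1 < nsq z) (d : Fin 4) : 1 ≤ nsq (z + dirs d) := by
  by_contra hc
  have h0 : nsq (z + dirs d) = 0 := le_antisymm (by omega) (by unfold nsq; positivity)
  have h1 : z = - dirs d := by
    unfold nsq at h0
    have a : (z + dirs d).1 = 0 := by nlinarith [sq_nonneg (z + dirs d).1, sq_nonneg (z + dirs d).2]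
    have b : (z + dirs d).2 = 0 := by nlinarith [sq_nonneg (z + dirs d).1, sq_nonneg (z + dirs d).2]
    have : z + dirs d = 0 := Prod.ext a b
    exact eq_neg_of_add_eq_zero_left this
  rw [h1, ← dirs_dinv, nsq_dirs] at hz
  omega

lemma gf_bound : ∃ K : ℝ, 0 < K ∧ ∀ (c : ℂ) (t ρ : ℤ) (μ : ℝ) (f e : ℂ → ℝ) (E : Lat → Prop),
    c ≠ 0 → (c ^ 4).im = 0 → ‖c‖ ≤ 2 → 100 ≤ t → 0 < μ → μ ^ 8 ≤ ρ → (∀ v ∉ annU t ρ, f v = 0) →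
    (∀ v z, Good v z → t < nsq z → nsq z ≤ ρ → f v = ∑ d, hsg d v * 4⁻¹ * f (hnb d v) + e v) →
    (∀ v, |e v| ≤ 1) → (∀ v z, Good v z → ¬ E z → e v = 0) → (∀ z, E z ↔ E (zcj z)) →
    (∀ z, E z → ∃ d, ρ < nsq (z + dirs d) ∧ ∀ u, u ^ 4 = toC (z + dirs d) → ‖u‖ ≤ 4 * |lam c u|) →
    ∀ v ∈ annU t ρ, |gf c f (qr v)| ≤ 32 / μ * psi K c (qr v) := by
  obtain ⟨K, hK, hsup⟩ := psi_super
  refine ⟨K, hK, ?_⟩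
  intro c t ρ μ f e E hc hc4 hc2 ht hμ hμρ hf0 hfe he1 he0 hEs hE
  have ht1 : 1 ≤ t := by omega
  have hκ : 0 < 32 / μ := by positivity
  have hq4 : ∀ v z, Good v z → qr v ^ 4 = toC z := by
    intro v z h; rw [← h.1, pow_mul _ 2 2, qr_sq h.ne]
  have hgd : ∀ v z, Good v z → Good (qr v ^ 2) z := by
    intro v z h; rwa [qr_sq h.ne]
  let Ψ : ℂ → ℝ := fun v => if v ∈ annU t ρ then 32 / μ * psi K c (qr v) else 0
  have hΨ0 : ∀ v, 0 ≤ Ψ v := by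
    intro v
    simp only [Ψ]
    split_ifs with h
    · obtain ⟨z, h1, h2, h3⟩ := good_of_ann ht1 h
      exact mul_nonneg hκ.le (psi_nonneg hK.le (hq4 v z h1) (by have := h1.2; omega))
    · exact le_rfl
  let W : Finset ℂ := (annU_finite t ρ).toFinset.filter (fun v => lam c (qr v) ≠ 0)
  have hWm : ∀ v, v ∈ W ↔ v ∈ annU t ρ ∧ lam c (qr v) ≠ 0 := by intro v; simp [W]
  have hgfnb : ∀ v z, Good v z → ∀ d, |gf c f (nb4 d (qr v))| = |gf c f (qr (hnb d v))| := by
    intro v z h d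
    rcases qr_hnb_pm h d with h' | h' <;> rw [h']
    rw [gf_neg hc f (nb4_ne d (qr_ne v)), abs_neg]
  have hpsinb : ∀ v z, Good v z → ∀ d, psi K c (qr (hnb d v)) = psi K c (nb4 d (qr v)) := by
    intro v z h d
    rcases qr_hnb_pm h d with h' | h' <;> rw [h']
    rw [psi_neg]
  have comp := ann_comp ht1 W (Finset.filter_subset _ _) (fun v => |gf c f (qr v)|) Ψ
    (fun v => |gf c e (qr v)|) ?_ ?_ ?_
  · intro v hv
    by_cases hl : lam c (qr v) = 0
    · rw [gf_axis hc f hl, abs_zero]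
      have := hΨ0 v
      simpa only [Ψ, hv, if_true] using this
    · have := comp v ((hWm v).2 ⟨hv, hl⟩)
      simpa only [Ψ, hv, if_true] using this
  · intro v hv
    obtain ⟨z, h1, h2, h3⟩ := good_of_ann ht1 ((hWm v).1 hv).1
    have := gf_eq hc hc4 hfe (hgd v z h1) h2 h3
    rw [this]
    refine (abs_add_le _ _).trans (add_le_add ((Finset.abs_sum_le_sum_abs _ _).trans (le_of_eq ?_)) le_rfl)
    refine Finset.sum_congr rfl fun d _ => ?_
    rw [abs_mul, hgfnb v z h1]; norm_num
  · intro v hv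
    obtain ⟨hvU, hl⟩ := (hWm v).1 hv
    obtain ⟨z, h1, h2, h3⟩ := good_of_ann ht1 hvU
    have hsup' := hsup c (qr v) z hc4 hc2 (hgd v z h1) (by omega) hl
    have hpn : ∀ d, 0 ≤ psi K c (nb4 d (qr v)) := fun d =>
      psi_nonneg hK.le ((hgd v z h1).nb4_pow d) (nsq_ge_one h1.2 d)
    have hle : ∀ d, Ψ (hnb d v) ≤ 32 / μ * psi K c (nb4 d (qr v)) := by
      intro d
      simp only [Ψ]
      split_ifs
      · rw [hpsinb v z h1]
      · exact mul_nonneg hκ.le (hpn d)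
    have hΨv : Ψ v = 32 / μ * psi K c (qr v) := by simp only [Ψ, hvU, if_true]
    have htot : ∑ d, 4⁻¹ * (32 / μ * psi K c (nb4 d (qr v))) ≤ 32 / μ * psi K c (qr v) := by
      have := mul_le_mul_of_nonneg_left hsup' hκ.le
      rw [Finset.mul_sum] at this
      refine le_trans (le_of_eq (Finset.sum_congr rfl fun d _ => by ring)) this
    have hrfg := rf_good hc hc4 (hgd v z h1)
    rw [hΨv]
    by_cases hEz : E z
    · obtain ⟨d0, hd0, hd1⟩ := hE z hEz
      have hu4 := (hgd v z h1).nb4_pow d0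
      have hbig := hd1 _ hu4
      have hμu : μ ≤ ‖nb4 d0 (qr v)‖ := by
        have a := Good.norm4 hu4
        have b : (ρ : ℝ) < nsq (z + dirs d0) := by exact_mod_cast hd0
        have : μ ^ 8 ≤ ‖nb4 d0 (qr v)‖ ^ 8 := by
          calc μ ^ 8 ≤ _ := hμρ
            _ ≤ _ := b.le
            _ = _ := by rw [← a]; ring
        exact le_of_pow_le_pow_left₀ (by norm_num) (norm_nonneg _) this
      have hout : hnb d0 v ∉ annU t ρ := by
        intro hc'
        have := good_hnb_of_ann ht1 h1 hc'
        omega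
      have h0 : Ψ (hnb d0 v) = 0 := by simp only [Ψ, hout, if_false]
      have h2' : 2 ≤ 4⁻¹ * (32 / μ * psi K c (nb4 d0 (qr v))) := by
        have hps : ‖nb4 d0 (qr v)‖ / 4 ≤ psi K c (nb4 d0 (qr v)) := by
          rw [psi]
          have h1' : 1 ≤ ‖nb4 d0 (qr v)‖ ^ 4 := by
            rw [norm4_eq hu4]; exact Real.one_le_sqrt.2 (by exact_mod_cast nsq_ge_one h1.2 d0)
          have : 1 / ‖nb4 d0 (qr v)‖ ^ 4 ≤ 1 := by rw [div_le_one (by linarith)]; exact h1'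
          have := mul_nonneg hK.le (sub_nonneg.2 this)
          linarith
        have : 4⁻¹ * (32 / μ * (μ / 4)) ≤ 4⁻¹ * (32 / μ * psi K c (nb4 d0 (qr v))) := by
          gcongr; linarith
        have e : 4⁻¹ * (32 / μ * (μ / 4)) = 2 := by field_simp; norm_num
        linarith
      have he2 : |gf c e (qr v)| ≤ 2 := by
        rw [gf]
        have a := lf_abs e (qr v)
        have b := lf_abs e (rf c (qr v))
        have := abs_sub (lf e (qr v)) (lf e (rf c (qr v)))
        have := he1 (qr v ^ 2)
        have := he1 (rf c (qr v) ^ 2)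
        linarith
      have hs : ∑ d, 4⁻¹ * Ψ (hnb d v) + 4⁻¹ * (32 / μ * psi K c (nb4 d0 (qr v))) ≤
          ∑ d, 4⁻¹ * (32 / μ * psi K c (nb4 d (qr v))) := by
        rw [← Finset.add_sum_erase _ _ (Finset.mem_univ d0), ← Finset.add_sum_erase _ (fun d => 4⁻¹ * (32 / μ * psi K c (nb4 d (qr v)))) (Finset.mem_univ d0), h0]
        have : ∑ d ∈ Finset.univ.erase d0, 4⁻¹ * Ψ (hnb d v) ≤ ∑ d ∈ Finset.univ.erase d0, 4⁻¹ * (32 / μ * psi K c (nb4 d (qr v))) :=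
          Finset.sum_le_sum fun d _ => by linarith [hle d]
        linarith
      linarith
    · have e1 : lf e (qr v) = 0 := by rw [lf, he0 _ z (hgd v z h1) hEz, mul_zero]
      have e2 : lf e (rf c (qr v)) = 0 := by
        rw [lf, he0 _ _ hrfg (fun h => hEz ((hEs z).2 h)), mul_zero]
      rw [gf, e1, e2, sub_zero, abs_zero, add_zero]
      refine le_trans (Finset.sum_le_sum fun d _ => ?_) htot
      linarith [hle d]
  · intro v hv d hd
    obtain ⟨z, h1, h2, h3⟩ := good_of_ann ht1 ((hWm v).1 hv).1
    have : gf c f (qr (hnb d v)) = 0 := by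
      by_cases hU : hnb d v ∈ annU t ρ
      · have : lam c (qr (hnb d v)) = 0 := by
          by_contra hc'; exact hd ((hWm _).2 ⟨hU, hc'⟩)
        exact gf_axis hc f this
      · exact gf_off hc hc4 hf0 hU (h1.arc_ne d 1)
    rw [this, abs_zero]
    exact hΨ0 _

end

section

/-! ### Bounds for signed Green functions -/

/-- exit condition -/
def isOut (ρ : ℤ) (z : Lat) : Prop := ∃ d, ρ < nsq (z + dirs d)

/-- entrance condition -/
def isIn (t : ℤ) (z : Lat) : Prop := ∃ d, nsq (z + dirs d) ≤ t

lemma zcj_zcj (z : Lat) : zcj (zcj z) = z := by simp [zcj]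

lemma isOut_zcj {ρ : ℤ} {z : Lat} (h : isOut ρ z) : isOut ρ (zcj z) := by
  obtain ⟨d, hd⟩ := h
  exact ⟨cj d, by rwa [← zcj_dirs, nsq_zcj]⟩

lemma half_bound : ∃ K : ℝ, 0 < K ∧ ∀ (t ρ : ℤ) (μ : ℝ) (f e : ℂ → ℝ) (E : Lat → Prop),
    (E = fun z => z.1 ≤ -1) ∨ (E = fun z => 0 ≤ z.1) →
    100 ≤ t → t ≤ ρ → 0 < μ → μ ^ 8 ≤ ρ → (∀ v ∉ annU t ρ, f v = 0) →
    (∀ v z, Good v z → t < nsq z → nsq z ≤ ρ → f v = ∑ d, hsg d v * 4⁻¹ * f (hnb d v) + e v) →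
    (∀ v, |e v| ≤ 1) → (∀ v z, Good v z → ¬ (E z ∧ isOut ρ z) → e v = 0) →
    ∀ v ∈ annU t ρ, |f v| ≤ 32 / μ * (2 * ‖qr v‖ + K) := by
  obtain ⟨K, hK, hb⟩ := gf_bound
  refine ⟨K, hK, ?_⟩
  intro t ρ μ f e E hEE ht htρ hμ hμρ hf0 hfe he1 he0 v hv
  obtain ⟨z, hg, -, -⟩ := good_of_ann (by omega) hv
  have main : ∀ c1 c2 : ℂ, c1 ≠ 0 → c2 ≠ 0 → (c1 ^ 4).im = 0 → (c2 ^ 4).im = 0 → ‖c1‖ ≤ 2 → ‖c2‖ ≤ 2 →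
      (∀ u, rf c2 u = - rf c1 u) →
      (∀ z, E z → ∀ d, ρ < nsq (z + dirs d) → ∀ u, u ^ 4 = toC (z + dirs d) →
        ‖u‖ ≤ 4 * |lam c1 u| ∧ ‖u‖ ≤ 4 * |lam c2 u|) →
      |f v| ≤ 32 / μ * (2 * ‖qr v‖ + K) := by
    intro c1 c2 h1 h2 h14 h24 h1n h2n hrf hgood
    have hsym : ∀ z, (E z ∧ isOut ρ z) ↔ (E (zcj z) ∧ isOut ρ (zcj z)) := by
      have : ∀ z, (E z ∧ isOut ρ z) → (E (zcj z) ∧ isOut ρ (zcj z)) := by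
        rintro z ⟨hz, ho⟩
        refine ⟨?_, isOut_zcj ho⟩
        rcases hEE with h | h <;> rw [h] at hz ⊢ <;> exact hz
      intro z
      refine ⟨this z, fun h => ?_⟩
      have := this _ h
      rwa [zcj_zcj] at this
    have b1 := hb c1 t ρ μ f e (fun z => E z ∧ isOut ρ z) h1 h14 h1n ht hμ hμρ hf0 hfe he1 he0 hsym
      (fun z ⟨hz, d, hd⟩ => ⟨d, hd, fun u hu => (hgood z hz d hd u hu).1⟩) v hv
    have b2 := hb c2 t ρ μ f e (fun z => E z ∧ isOut ρ z) h2 h24 h2n ht hμ hμρ hf0 hfe he1 he0 hsym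
      (fun z ⟨hz, d, hd⟩ => ⟨d, hd, fun u hu => (hgood z hz d hd u hu).2⟩) v hv
    have hps : ∀ c : ℂ, ‖c‖ ≤ 2 → psi K c (qr v) ≤ 2 * ‖qr v‖ + K := by
      intro c hc
      rw [psi]
      have a := lam_le c (qr v)
      have b : ‖c‖ * ‖qr v‖ ≤ 2 * ‖qr v‖ := by gcongr
      have : 0 ≤ 1 / ‖qr v‖ ^ 4 := by positivity
      nlinarith
    have p1 := mul_le_mul_of_nonneg_left (hps c1 h1n) (show 0 ≤ 32 / μ by positivity)
    have p2 := mul_le_mul_of_nonneg_left (hps c2 h2n) (show 0 ≤ 32 / μ by positivity)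
    have e2 : 2 * lf f (qr v) = gf c1 f (qr v) + gf c2 f (qr v) := by
      rw [gf, gf, hrf, lf_neg f (rf_ne h1 (qr_ne v))]; ring
    have e3 := lf_abs f (qr v)
    rw [qr_sq hg.ne] at e3
    have e4 : |2 * lf f (qr v)| = 2 * |lf f (qr v)| := by rw [abs_mul]; norm_num
    rw [e2] at e4
    have := abs_add_le (gf c1 f (qr v)) (gf c2 f (qr v))
    linarith
  rcases hEE with hE | hE
  · refine main 1 Complex.I one_ne_zero Complex.I_ne_zero (by simp) (by simp) (by simp) (by simp)
      ?_ ?_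
    · intro u; simp [rf]
      field_simp
      rw [Complex.I_sq]; ring
    · intro z hz d hd u hu
      apply lam_good_one
      have hz1 : z.1 ≤ -1 := by rw [hE] at hz; exact hz
      rw [hu]
      have : (toC (z + dirs d)).re ≤ 0 := by
        have : (z + dirs d).1 ≤ 0 := by fin_cases d <;> simp [dirs] <;> omega
        simp only [toC]; exact_mod_cast this
      have : 0 ≤ ‖u‖ ^ 4 / 2 := by positivity
      linarith
  · have n1 : ‖1 - Complex.I‖ ≤ 2 := (norm_sub_le _ _).trans (by norm_num)
    have n2 : ‖1 + Complex.I‖ ≤ 2 := (norm_add_le _ _).trans (by norm_num)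
    have z1 : (1 - Complex.I) ≠ 0 := by intro h; have := congrArg Complex.re h; simp at this
    have z2 : (1 + Complex.I) ≠ 0 := by intro h; have := congrArg Complex.re h; simp at this
    refine main (1 - Complex.I) (1 + Complex.I) z1 z2 (by simp [pow_succ]) (by simp [pow_succ]) n1 n2
      ?_ ?_
    · intro u; simp only [rf, map_mul, map_sub, map_add, map_one, Complex.conj_I]
      field_simp
      ring_nf
      simp
    · intro z hz d hd u hu
      apply lam_good_two
      have hz1 : 0 ≤ z.1 := by rw [hE] at hz; exact hz
      rw [hu]
      have : -1 ≤ (toC (z + dirs d)).re := by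
        have : -1 ≤ (z + dirs d).1 := by fin_cases d <;> simp [dirs] <;> omega
        simp only [toC]; exact_mod_cast this
      have h4 := Good.norm4 hu
      have : (100 : ℝ) < nsq (z + dirs d) := by exact_mod_cast (by omega : 100 < nsq (z + dirs d))
      have : 0 ≤ ‖u‖ ^ 4 := by positivity
      nlinarith

lemma nsq_nb_le {z : Lat} {k : ℤ} (hk : 0 ≤ k) (h : nsq z ≤ k ^ 2) (d : Fin 4) :
    nsq (z + dirs d) ≤ (k + 1) ^ 2 := by
  unfold nsq at h
  have hx := abs_le_of_sq_le_sq' (show z.1 ^ 2 ≤ k ^ 2 by nlinarith [sq_nonneg z.2]) hk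
  have hy := abs_le_of_sq_le_sq' (show z.2 ^ 2 ≤ k ^ 2 by nlinarith [sq_nonneg z.1]) hk
  fin_cases d <;> simp [nsq, dirs] <;> nlinarith

lemma dirs_back (z : Lat) (d : Fin 4) : z + dirs d + dirs (dinv d) = z := by
  rw [dirs_dinv]; abel

lemma nsq_nb_gt {z : Lat} {k : ℤ} (hk : 1 ≤ k) (h : k ^ 2 < nsq z) (d : Fin 4) :
    (k - 1) ^ 2 < nsq (z + dirs d) := by
  by_contra hc
  push Not at hc
  have := nsq_nb_le (by omega) hc (dinv d)
  rw [dirs_back] at this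
  have e : k - 1 + 1 = k := by ring
  rw [e] at this
  omega

lemma nsq_half_prod (z : Lat) :
    ∏ d, ((nsq (z + dirs d) : ℝ) - 1 / 2) ≤ ((nsq z : ℝ) - 1 / 2) ^ 4 := by
  simp only [Fin.prod_univ_four]
  simp [nsq, dirs]
  set x : ℝ := ((z.1 : ℤ) : ℝ)
  set y : ℝ := ((z.2 : ℤ) : ℝ)
  have : ((x ^ 2 + y ^ 2 - 2⁻¹) ^ 4) - (((x + 1) ^ 2 + y ^ 2 - 2⁻¹) * ((x + -1) ^ 2 + y ^ 2 - 2⁻¹) * (x ^ 2 + (y + 1) ^ 2 - 2⁻¹) *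
      (x ^ 2 + (y + -1) ^ 2 - 2⁻¹)) = 4 * (x ^ 2 - y ^ 2) ^ 2 := by ring
  nlinarith [sq_nonneg (x ^ 2 - y ^ 2)]

lemma ring_bound {τ ρ : ℤ} (hτ : 10 ≤ τ) {f : ℂ → ℝ} {M : ℝ} (hM : 0 ≤ M)
    (h0 : ∀ v ∉ annU (τ ^ 2) ρ, f v = 0)
    (h1 : ∀ v z, Good v z → τ ^ 2 < nsq z → nsq z ≤ ρ → nsq z ≤ (2 * τ) ^ 2 →
      |f v| ≤ ∑ d, 4⁻¹ * |f (hnb d v)|)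
    (h2 : ∀ v z, Good v z → τ ^ 2 < nsq z → nsq z ≤ ρ → nsq z ≤ (3 * τ) ^ 2 → |f v| ≤ M)
    (v : ℂ) (z : Lat) (hg : Good v z) (hz1 : τ ^ 2 < nsq z) (hz2 : nsq z ≤ ρ) (hin : isIn (τ ^ 2) z) :
    |f v| ≤ M * (8 / τ) := by
  have hτ' : (10 : ℝ) ≤ τ := by exact_mod_cast hτ
  have ht1 : 1 ≤ τ ^ 2 := by nlinarith
  set s0 : ℝ := (τ - 1) ^ 2 - 1 / 2 with hs0
  have hs0p : 0 < s0 := by nlinarith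
  let W : Finset ℂ := (annU_finite (τ ^ 2) ρ).toFinset.filter (fun v => ‖v ^ 2‖ ^ 2 ≤ (2 * τ) ^ 2)
  have hnv : ∀ {v z}, Good v z → ‖v ^ 2‖ ^ 2 = nsq z := fun {v z} h => by rw [h.1, norm_toC_sq]
  have hWm : ∀ v, v ∈ W ↔ ∃ z, Good v z ∧ τ ^ 2 < nsq z ∧ nsq z ≤ ρ ∧ nsq z ≤ (2 * τ) ^ 2 := by
    intro v
    simp only [W, Finset.mem_filter, Set.Finite.mem_toFinset]
    constructor
    · rintro ⟨a, b⟩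
      obtain ⟨z, a1, a2, a3⟩ := good_of_ann ht1 a
      rw [hnv a1] at b
      exact ⟨z, a1, a2, a3, by exact_mod_cast b⟩
    · rintro ⟨z, a1, a2, a3, a4⟩
      refine ⟨⟨z, a1.1, a2, a3⟩, ?_⟩
      rw [hnv a1]; exact_mod_cast a4
  let Ψ : ℂ → ℝ := fun v => M * Real.log ((‖v ^ 2‖ ^ 2 - 1 / 2) / s0)
  have hnh : ∀ {v z}, Good v z → ∀ d, ‖hnb d v ^ 2‖ ^ 2 = nsq (z + dirs d) := fun {v z} h d => by
    rw [h.hnb_sq, norm_toC_sq]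
  have hge : ∀ {z}, τ ^ 2 < nsq z → ∀ d, s0 < (nsq (z + dirs d) : ℝ) - 1 / 2 := by
    intro z hz d
    have := nsq_nb_gt (by omega) hz d
    have : ((τ - 1 : ℤ) : ℝ) ^ 2 < nsq (z + dirs d) := by exact_mod_cast this
    push_cast at this
    rw [hs0]; linarith
  have comp := ann_comp ht1 W (Finset.filter_subset _ _) (fun v => |f v|) Ψ (fun _ => 0) ?_ ?_ ?_
  · have hW : v ∈ W := by
      obtain ⟨d, hd⟩ := hin
      have := nsq_nb_le (by omega) hd (dinv d)
      rw [dirs_back] at this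
      exact (hWm v).2 ⟨z, hg, hz1, hz2, by nlinarith⟩
    refine (comp v hW).trans ?_
    simp only [Ψ]
    apply mul_le_mul_of_nonneg_left _ hM
    rw [hnv hg]
    have hup : (nsq z : ℝ) ≤ (τ + 1) ^ 2 := by
      obtain ⟨d, hd⟩ := hin
      have := nsq_nb_le (by omega) hd (dinv d)
      rw [dirs_back] at this
      exact_mod_cast this
    have hlo : (τ : ℝ) ^ 2 < nsq z := by exact_mod_cast hz1
    have hpos : 0 < ((nsq z : ℝ) - 1 / 2) / s0 := div_pos (by nlinarith) hs0p
    refine (Real.log_le_sub_one_of_pos hpos).trans ?_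
    rw [sub_le_iff_le_add, div_le_iff₀ hs0p]
    have : (8 / (τ : ℝ) + 1) * s0 = (8 * s0) / τ + s0 := by ring
    rw [this]
    have : 4 * τ ≤ (8 * s0) / τ := by
      rw [le_div_iff₀ (by linarith)]; rw [hs0]; nlinarith
    rw [hs0] at this ⊢
    nlinarith
  · intro v hv
    obtain ⟨z, a1, a2, a3, a4⟩ := (hWm v).1 hv
    rw [add_zero]
    exact h1 v z a1 a2 a3 a4
  · intro v hv
    obtain ⟨z, a1, a2, a3, a4⟩ := (hWm v).1 hv
    rw [add_zero]
    simp only [Ψ]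
    have hlo : (τ : ℝ) ^ 2 < nsq z := by exact_mod_cast a2
    have e : ∑ d, 4⁻¹ * (M * Real.log ((‖hnb d v ^ 2‖ ^ 2 - 1 / 2) / s0)) =
        M * (4⁻¹ * ∑ d, (Real.log ((nsq (z + dirs d) : ℝ) - 1 / 2) - Real.log s0)) := by
      rw [Finset.mul_sum, Finset.mul_sum]
      refine Finset.sum_congr rfl fun d _ => ?_
      rw [hnh a1, Real.log_div (by linarith [hge a2 d]) hs0p.ne']; ring
    rw [e]
    apply mul_le_mul_of_nonneg_left _ hM
    rw [hnv a1, Real.log_div (by nlinarith) hs0p.ne', Finset.sum_sub_distrib,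
      ← Real.log_prod (fun d _ => by linarith [hge a2 d])]
    have h4 : Real.log (∏ d, ((nsq (z + dirs d) : ℝ) - 1 / 2)) ≤ 4 * Real.log ((nsq z : ℝ) - 1 / 2) := by
      have := Real.log_le_log (Finset.prod_pos fun d _ => by linarith [hge a2 d]) (nsq_half_prod z)
      rw [Real.log_pow] at this
      exact_mod_cast this
    simp only [Finset.sum_const, Finset.card_univ, Fintype.card_fin, nsmul_eq_mul]
    push_cast
    linarith
  · intro v hv d hd
    obtain ⟨z, a1, a2, a3, a4⟩ := (hWm v).1 hv
    simp only [Ψ]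
    rw [hnh a1]
    by_cases hU : hnb d v ∈ annU (τ ^ 2) ρ
    · obtain ⟨g1, g2, g3⟩ := good_hnb_of_ann ht1 a1 hU
      have hb : (2 * τ) ^ 2 < nsq (z + dirs d) := by
        by_contra hc
        push Not at hc
        exact hd ((hWm _).2 ⟨_, g1, g2, g3, hc⟩)
      have hb' := nsq_nb_le (by omega) a4 d
      refine (h2 _ _ g1 g2 g3 (by nlinarith)).trans ?_
      have hbr : (4 : ℝ) * τ ^ 2 < nsq (z + dirs d) := by
        have : ((2 * τ) ^ 2 : ℝ) < nsq (z + dirs d) := by exact_mod_cast hb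
        linarith
      have : 1 ≤ Real.log (((nsq (z + dirs d) : ℝ) - 1 / 2) / s0) := by
        rw [Real.le_log_iff_exp_le (div_pos (by nlinarith) hs0p), le_div_iff₀ hs0p]
        have := Real.exp_one_lt_d9
        rw [hs0]; nlinarith
      nlinarith
    · rw [h0 _ hU, abs_zero]
      apply mul_nonneg hM
      apply Real.log_nonneg
      rw [le_div_iff₀ hs0p]
      linarith [hge a2 d]

end

section

/-- fourth root -/
def q4 (x : ℝ) : ℝ := Real.sqrt (Real.sqrt x)

lemma q4_pow {x : ℝ} (h : 0 ≤ x) : q4 x ^ 4 = x := by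
  rw [q4, show (4 : ℕ) = 2 * 2 from rfl, pow_mul, Real.sq_sqrt (Real.sqrt_nonneg _), Real.sq_sqrt h]

lemma q4_nonneg (x : ℝ) : 0 ≤ q4 x := Real.sqrt_nonneg _

lemma q4_pos {x : ℝ} (h : 0 < x) : 0 < q4 x := Real.sqrt_pos.2 (Real.sqrt_pos.2 h)

lemma q4_one_le {x : ℝ} (h : 1 ≤ x) : 1 ≤ q4 x := Real.one_le_sqrt.2 (Real.one_le_sqrt.2 h)

/-- the outer layer -/
def outS (t ρ : ℤ) : Finset ℂ :=
  (annU_finite t ρ).toFinset.filter (fun v => ∃ z, v ^ 2 = toC z ∧ isOut ρ z)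

/-- the inner layer -/
def inS (t ρ : ℤ) : Finset ℂ :=
  (annU_finite t ρ).toFinset.filter (fun v => ∃ z, v ^ 2 = toC z ∧ isIn t z)

lemma in_unique {t : ℤ} {z w : Lat} {d : Fin 4} (h1 : nsq (z + dirs d) ≤ t) (h2 : t < nsq z)
    (h3 : nsq (w + dirs d) ≤ t) (h4 : t < nsq w)
    (h : ![z.2, z.2, z.1, z.1] d = ![w.2, w.2, w.1, w.1] d) : z = w := by
  obtain ⟨x, y⟩ := z
  obtain ⟨x', y'⟩ := w
  fin_cases d <;> simp [nsq, dirs] at * <;> subst h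
  · refine ⟨?_, rfl⟩
    rcases lt_trichotomy x x' with hl | hl | hl
    · exfalso; nlinarith
    · exact hl
    · exfalso; nlinarith
  · refine ⟨?_, rfl⟩
    rcases lt_trichotomy x x' with hl | hl | hl
    · exfalso; nlinarith
    · exact hl
    · exfalso; nlinarith
  · refine ⟨rfl, ?_⟩
    rcases lt_trichotomy y y' with hl | hl | hl
    · exfalso; nlinarith
    · exact hl
    · exfalso; nlinarith
  · refine ⟨rfl, ?_⟩
    rcases lt_trichotomy y y' with hl | hl | hl
    · exfalso; nlinarith
    · exact hl
    · exfalso; nlinarith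

lemma in_card {τ ρ : ℤ} (hτ : 1 ≤ τ) : ((inS (τ ^ 2) ρ).card : ℝ) ≤ 24 * τ := by
  have hch : ∀ v : ℂ, ∃ p : Lat × Fin 4, v ∈ inS (τ ^ 2) ρ → v ^ 2 = toC p.1 ∧ τ ^ 2 < nsq p.1 ∧
      nsq (p.1 + dirs p.2) ≤ τ ^ 2 := by
    intro v
    by_cases hv : v ∈ inS (τ ^ 2) ρ
    · simp only [inS, Finset.mem_filter, Set.Finite.mem_toFinset] at hv
      obtain ⟨⟨w, hw1, hw2, hw3⟩, z, hz, d, hd⟩ := hv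
      have := toC_inj (hw1.symm.trans hz)
      subst this
      exact ⟨(w, d), fun _ => ⟨hz, hw2, hd⟩⟩
    · exact ⟨(0, 0), fun h => absurd h hv⟩
  choose p hp using hch
  let F : ℂ → Fin 4 × ℤ × Bool := fun v =>
    ((p v).2, ![(p v).1.2, (p v).1.2, (p v).1.1, (p v).1.1] (p v).2, decide (v = qr (v ^ 2)))
  have h1 : (inS (τ ^ 2) ρ).card ≤
      ((Finset.univ : Finset (Fin 4)) ×ˢ (Finset.Icc (-τ) τ) ×ˢ (Finset.univ : Finset Bool)).card := by
    apply Finset.card_le_card_of_injOn F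
    · intro v hv
      obtain ⟨a, b, c⟩ := hp v hv
      simp only [F, Finset.coe_product, Finset.coe_univ, Set.mem_prod, Set.mem_univ, true_and, and_true,
        Finset.coe_Icc, Set.mem_Icc]
      generalize p v = q at a b c
      obtain ⟨⟨x, y⟩, d⟩ := q
      refine abs_le_of_sq_le_sq' ?_ (by omega)
      fin_cases d <;> simp [nsq, dirs] at c ⊢ <;> nlinarith
    · intro v hv w hw hvw
      obtain ⟨a, b, c⟩ := hp v hv
      obtain ⟨a', b', c'⟩ := hp w hw
      simp only [F, Prod.mk.injEq] at hvw
      obtain ⟨e1, e2, e3⟩ := hvw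
      rw [← e1] at e2 c'
      have hz := in_unique c b c' b' e2
      have hsq : v ^ 2 = w ^ 2 := by rw [a, a', hz]
      have hne : v ≠ 0 := by
        rintro rfl
        have h0 : toC (p 0).1 = 0 := by rw [← a]; simp
        have := norm_toC_sq (p 0).1
        rw [h0] at this
        have h2 : nsq (p 0).1 = 0 := by exact_mod_cast (by simpa using this.symm)
        nlinarith
      rcases sq_eq_sq_iff_eq_or_eq_neg.1 hsq with h | h
      · exact h
      · exfalso
        rw [hsq] at e3
        have e4 : v = qr (w ^ 2) ↔ w = qr (w ^ 2) := by simpa using e3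
        have h5 : qr (w ^ 2) ^ 2 = w ^ 2 := qr_sq (by rw [← hsq]; exact pow_ne_zero 2 hne)
        have h6 : v ≠ w := by
          intro h'; rw [h'] at h
          exact hne (by rw [h']; exact self_eq_neg.1 h)
        rcases sq_eq_sq_iff_eq_or_eq_neg.1 h5 with h7 | h7
        · exact h6 ((e4.2 h7.symm).trans h7)
        · rw [← h] at h7
          exact h6 (h7.symm.trans (e4.1 h7.symm).symm)
  refine (Nat.cast_le.2 h1).trans ?_
  simp only [Finset.card_product, Finset.card_univ, Fintype.card_fin, Int.card_Icc, Fintype.card_bool]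
  have : (((τ + 1 - -τ).toNat : ℕ) : ℝ) = 2 * τ + 1 := by
    have : (((τ + 1 - -τ).toNat : ℕ) : ℤ) = 2 * τ + 1 := by omega
    exact_mod_cast this
  push_cast
  have hτ' : (1 : ℝ) ≤ τ := by exact_mod_cast hτ
  rw [this]; linarith

lemma green_row : ∃ C : ℝ, 0 < C ∧ ∀ (τ m : ℤ) (ht : 1 ≤ τ ^ 2), 10 ≤ τ → 4 * τ ≤ m →
    ∀ v ∈ inS (τ ^ 2) (m ^ 2), ∑ b ∈ outS (τ ^ 2) (m ^ 2),
      |(annG (τ ^ 2) (m ^ 2) ht).g (annG (τ ^ 2) (m ^ 2) ht).U v b| ≤ C * (q4 τ / q4 m) / τ := by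
  obtain ⟨K, hK, hb⟩ := half_bound
  refine ⟨512 * (4 + K), by positivity, ?_⟩
  intro τ m ht hτ hm v hv
  set G := annG (τ ^ 2) (m ^ 2) ht with hG
  have hτr : (10 : ℝ) ≤ τ := by exact_mod_cast hτ
  have hmr : (4 : ℝ) * τ ≤ m := by exact_mod_cast hm
  have hmU : ∀ x, x ∈ G.U ↔ x ∈ annU (τ ^ 2) (m ^ 2) := by
    intro x; rw [hG]; simp [annG]
  have hμ : 0 < q4 m := q4_pos (by linarith)
  have hτ4 : 1 ≤ q4 τ := q4_one_le (by linarith)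
  set M : ℝ := 32 / q4 m * ((4 + K) * q4 τ) with hM
  have hM0 : 0 ≤ M := by positivity
  simp only [inS, Finset.mem_filter, Set.Finite.mem_toFinset] at hv
  obtain ⟨hvU, z, hz, hin⟩ := hv
  obtain ⟨z', hg, hz1, hz2⟩ := good_of_ann ht hvU
  have := toC_inj (hg.1.symm.trans hz)
  subst this
  have half : ∀ E : Lat → Prop, (E = fun z => z.1 ≤ -1) ∨ (E = fun z => 0 ≤ z.1) →
      ∑ b ∈ (outS (τ ^ 2) (m ^ 2)).filter (fun b => ∃ w, b ^ 2 = toC w ∧ E w), |G.g G.U v b| ≤ M * (8 / τ) := by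
    intro E hE
    set O := (outS (τ ^ 2) (m ^ 2)).filter (fun b => ∃ w, b ^ 2 = toC w ∧ E w) with hO
    have hOU : ∀ b ∈ O, b ∈ G.U := by
      intro b hb
      simp only [hO, outS, Finset.mem_filter, Set.Finite.mem_toFinset] at hb
      exact (hmU b).2 hb.1.1
    let ε : ℂ → ℝ := fun b => if 0 ≤ G.g G.U v b then 1 else -1
    have hε : ∀ b, |ε b| ≤ 1 := by intro b; simp only [ε]; split_ifs <;> simp
    let f : ℂ → ℝ := fun x => ∑ b ∈ O, ε b * G.g G.U x b
    let e : ℂ → ℝ := fun x => if x ∈ O then ε x else 0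
    have hf0 : ∀ v ∉ annU (τ ^ 2) (m ^ 2), f v = 0 := by
      intro x hx
      refine Finset.sum_eq_zero fun b _ => ?_
      rw [SG.g_left subset_rfl (fun h => hx ((hmU x).1 h)), mul_zero]
    have hfe : ∀ x w, Good x w → τ ^ 2 < nsq w → nsq w ≤ m ^ 2 →
        f x = ∑ d, hsg d x * 4⁻¹ * f (hnb d x) + e x := by
      intro x w h1 h2 h3
      have hx : x ∈ G.U := (hmU x).2 ⟨w, h1.1, h2, h3⟩
      have : ∀ b ∈ O, ε b * G.g G.U x b = ∑ d, hsg d x * 4⁻¹ * (ε b * G.g G.U (hnb d x) b) +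
          (if x = b then ε b else 0) := by
        intro b hb
        rw [SG.g_eq subset_rfl hx (hOU b hb), mul_add]
        congr 1
        · rw [SG.K, Finset.mul_sum]
          refine Finset.sum_congr rfl fun d _ => ?_
          change ε b * (hsg d x * 4⁻¹ * G.g G.U (hnb d x) b) = _
          ring
        · split_ifs <;> simp
      simp only [f, e]
      rw [Finset.sum_congr rfl this, Finset.sum_add_distrib, Finset.sum_ite_eq, Finset.sum_comm]
      congr 1
      refine Finset.sum_congr rfl fun d _ => ?_
      rw [Finset.mul_sum]
    have he1 : ∀ x, |e x| ≤ 1 := by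
      intro x; simp only [e]; split_ifs
      · exact hε x
      · simp
    have he0 : ∀ x w, Good x w → ¬ (E w ∧ isOut (m ^ 2) w) → e x = 0 := by
      intro x w h1 h2
      have : x ∉ O := by
        intro hx
        simp only [hO, outS, Finset.mem_filter, Set.Finite.mem_toFinset] at hx
        obtain ⟨⟨-, w1, hw1, ho⟩, w2, hw2, hE⟩ := hx
        have a1 := toC_inj (h1.1.symm.trans hw1)
        have a2 := toC_inj (h1.1.symm.trans hw2)
        subst a1; subst a2
        exact h2 ⟨hE, ho⟩
      simp only [e, this, if_false]
    have hμ8 : q4 m ^ 8 ≤ ((m ^ 2 : ℤ) : ℝ) := by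
      have : q4 m ^ 8 = (q4 m ^ 4) ^ 2 := by ring
      rw [this, q4_pow (by linarith)]; push_cast; exact le_rfl
    have hbd := hb (τ ^ 2) (m ^ 2) (q4 m) f e E hE (by nlinarith) (by nlinarith) hμ hμ8 hf0 hfe he1 he0
    have hfv : f v = ∑ b ∈ O, |G.g G.U v b| := by
      refine Finset.sum_congr rfl fun b _ => ?_
      simp only [ε]
      split_ifs with h
      · rw [one_mul, abs_of_nonneg h]
      · rw [abs_of_neg (not_le.1 h)]; ring
    rw [← hfv]
    refine (le_abs_self _).trans (ring_bound hτ hM0 hf0 ?_ ?_ v z' hg hz1 hz2 hin)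
    · intro x w h1 h2 h3 h4
      have : e x = 0 := by
        apply he0 x w h1
        rintro ⟨-, d, hd⟩
        have := nsq_nb_le (by omega) h4 d
        nlinarith
      rw [hfe x w h1 h2 h3, this, add_zero]
      refine (Finset.abs_sum_le_sum_abs _ _).trans (le_of_eq (Finset.sum_congr rfl fun d _ => ?_))
      rw [abs_mul, abs_mul]
      rcases hsg_abs d x with h | h <;> rw [h] <;> norm_num
    · intro x w h1 h2 h3 h4
      refine (hbd x ⟨w, h1.1, h2, h3⟩).trans ?_
      rw [hM]
      apply mul_le_mul_of_nonneg_left _ (by positivity)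
      have hq : ‖qr x‖ ≤ 2 * q4 τ := by
        apply le_of_pow_le_pow_left₀ (n := 8) (by norm_num) (by positivity)
        have a : qr x ^ 4 = toC w := by rw [pow_mul _ 2 2, qr_sq h1.ne, h1.1]
        have b := Good.norm4 a
        have c : (2 * q4 τ) ^ 8 = 256 * (τ : ℝ) ^ 2 := by
          have : (2 * q4 τ) ^ 8 = 256 * (q4 τ ^ 4) ^ 2 := by ring
          rw [this, q4_pow (by linarith)]
        have d : ‖qr x‖ ^ 8 = (‖qr x‖ ^ 4) ^ 2 := by ring
        rw [d, b, c]
        have : (nsq w : ℝ) ≤ (3 * τ) ^ 2 := by exact_mod_cast h4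
        nlinarith
      nlinarith
  have hsplit : ∑ b ∈ outS (τ ^ 2) (m ^ 2), |G.g G.U v b| ≤
      ∑ b ∈ (outS (τ ^ 2) (m ^ 2)).filter (fun b => ∃ w, b ^ 2 = toC w ∧ (fun z : Lat => z.1 ≤ -1) w), |G.g G.U v b| +
      ∑ b ∈ (outS (τ ^ 2) (m ^ 2)).filter (fun b => ∃ w, b ^ 2 = toC w ∧ (fun z : Lat => 0 ≤ z.1) w), |G.g G.U v b| := by
    rw [Finset.sum_filter, Finset.sum_filter, ← Finset.sum_add_distrib]
    refine Finset.sum_le_sum fun b hb => ?_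
    simp only [outS, Finset.mem_filter, Set.Finite.mem_toFinset] at hb
    obtain ⟨-, w, hw, -⟩ := hb
    have := abs_nonneg (G.g G.U v b)
    rcases le_or_gt w.1 (-1) with h | h
    · rw [if_pos ⟨w, hw, h⟩]
      split_ifs <;> linarith
    · rw [if_pos (show ∃ w, b ^ 2 = toC w ∧ (fun z : Lat => 0 ≤ z.1) w from ⟨w, hw, by simp only; omega⟩)]
      split_ifs <;> linarith
  refine hsplit.trans ((add_le_add (half _ (Or.inl rfl)) (half _ (Or.inr rfl))).trans (le_of_eq ?_))
  rw [hM]; ring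

lemma green_sum : ∃ C : ℝ, 0 < C ∧ ∀ (τ m : ℤ) (ht : 1 ≤ τ ^ 2), 10 ≤ τ → 4 * τ ≤ m →
    ∑ a ∈ inS (τ ^ 2) (m ^ 2), ∑ b ∈ outS (τ ^ 2) (m ^ 2),
      |(annG (τ ^ 2) (m ^ 2) ht).g (annG (τ ^ 2) (m ^ 2) ht).U a b| ≤ C * (q4 τ / q4 m) := by
  obtain ⟨C, hC, h⟩ := green_row
  refine ⟨24 * C, by positivity, fun τ m ht hτ hm => ?_⟩
  have hτr : (10 : ℝ) ≤ τ := by exact_mod_cast hτ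
  refine (Finset.sum_le_sum (h τ m ht hτ hm)).trans ?_
  rw [Finset.sum_const, nsmul_eq_mul]
  have h1 := in_card (τ := τ) (ρ := m ^ 2) (by omega)
  have h2 : 0 ≤ C * (q4 τ / q4 m) / τ := by
    have := q4_nonneg (τ : ℝ); have := q4_nonneg (m : ℝ); positivity
  calc _ ≤ 24 * τ * (C * (q4 τ / q4 m) / τ) := mul_le_mul_of_nonneg_right h1 h2
    _ = _ := by field_simp

end

section

/-! ### Pair bound for lattice walks -/

/-- lattice neighbours -/
def lnb (d : Fin 4) (z : Lat) : Lat := z + dirs d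

/-- lattice annulus -/
def ann (t ρ : ℤ) : Set Lat := {z | t < nsq z ∧ nsq z ≤ ρ}

/-- one-step flatness of a section of the double cover -/
def Flat1 (s : Lat → ℂ) (t : ℤ) (u v : Lat) : Prop :=
  t < nsq u → t < nsq v → ∀ d, v = u + dirs d → s v = hnb d (s u)

/-- flatness of a section along a path -/
def Flat (s : Lat → ℂ) (t : ℤ) (l : List Lat) : Prop := l.IsChain (Flat1 s t)

/-- sections -/
def IsSec (s : Lat → ℂ) : Prop := ∀ z, s z ^ 2 = toC z

lemma Walk.lrev {S : Set Lat} {a b : Lat} {l : List Lat} (h : Walk lnb S a b l) :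
    Walk lnb S b a l.reverse := by
  induction h with
  | one h => simpa using Walk.one h
  | @cons x y l d hx hw ih =>
    rw [List.reverse_cons]
    have : lnb (dinv d) (lnb d x) = x := by simp [lnb, dirs_dinv]
    refine ih.append (d := dinv d) ?_
    rw [this]; exact .one hx

lemma hnb_neg (d : Fin 4) (v : ℂ) : hnb d (-v) = - hnb d v := by
  simp [hnb, arc, fac]

lemma Flat1.neg {s : Lat → ℂ} {t : ℤ} {u v : Lat} (h : Flat1 s t u v) : Flat1 (fun z => - s z) t u v := by
  intro h1 h2 d hd
  simp only
  rw [h h1 h2 d hd, hnb_neg]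

lemma Flat1.symm {s : Lat → ℂ} (hs : IsSec s) {t : ℤ} (ht : 1 ≤ t) {u v : Lat} (h : Flat1 s t u v) :
    Flat1 s t v u := by
  intro h1 h2 d hd
  have hv : v = u + dirs (dinv d) := by rw [dirs_dinv, hd]; abel
  have e := h h2 h1 _ hv
  have hg : Good (s u) u := ⟨hs u, by omega⟩
  have hg' : Good (hnb (dinv d) (s u)) (u + dirs (dinv d)) := by
    rw [← e, ← hv]; exact ⟨hs v, by omega⟩
  have := hg.hnb_back _ hg'
  rw [dinv_dinv] at this
  rw [e, this]

lemma Flat.neg {s : Lat → ℂ} {t : ℤ} {l : List Lat} (h : Flat s t l) : Flat (fun z => - s z) t l :=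
  List.IsChain.imp (fun _ _ h => h.neg) h

lemma Flat.rev {s : Lat → ℂ} (hs : IsSec s) {t : ℤ} (ht : 1 ≤ t) {l : List Lat} (h : Flat s t l) :
    Flat s t l.reverse :=
  List.isChain_reverse.2 (List.IsChain.imp (fun _ _ h => h.symm hs ht) h)

lemma Flat.lift {s : Lat → ℂ} (hs : IsSec s) {t ρ : ℤ} {a b : Lat} {l : List Lat}
    (h : Flat s t l) (hw : Walk lnb (ann t ρ) a b l) : Walk hnb (annU t ρ) (s a) (s b) (l.map s) := by
  have hU : ∀ z ∈ ann t ρ, s z ∈ annU t ρ := fun z hz => ⟨z, hs z, hz.1, hz.2⟩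
  induction hw with
  | one hx => exact .one (hU _ hx)
  | @cons x y l d hx hw ih =>
    have hl : Flat s t l := List.IsChain.of_cons h
    have e : s (lnb d x) = hnb d (s x) := by
      have hh := hw.head?
      cases l with
      | nil => simp at hh
      | cons w l =>
        simp at hh
        subst hh
        exact (List.isChain_cons_cons.1 h).1 hx.1 hw.start_in.1 d rfl
    rw [List.map_cons]
    refine .cons d (hU _ hx) ?_
    rw [← e]
    exact ih hl

/-- The pairs of arms. -/
def Pair (t ρ : ℤ) (X Y : List Lat) : Prop :=
  ∃ s : Lat → ℂ, IsSec s ∧ Flat s t X ∧ Flat s t Y ∧ ∃ a b b' a', Walk lnb (ann t ρ) a b X ∧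
    Walk lnb (ann t ρ) b' a' Y ∧ isIn t a ∧ isIn t a' ∧ isOut ρ b ∧ isOut ρ b'

lemma N_le {t ρ : ℤ} (ht : 1 ≤ t) {a a' b b' : ℂ} (ha : a ∈ inS t ρ) (ha' : a' ∈ inS t ρ)
    (hb : b ∈ outS t ρ) (hb' : b' ∈ outS t ρ) :
    SG.N (annG t ρ ht) (annG t ρ ht).U a b a' b' ≤ ENNReal.ofReal
      (|(annG t ρ ht).g (annG t ρ ht).U a b| * |(annG t ρ ht).g (annG t ρ ht).U a' b'| +
      |(annG t ρ ht).g (annG t ρ ht).U a b'| * |(annG t ρ ht).g (annG t ρ ht).U a' b|) := by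
  by_cases haa : a = a'
  · rw [SG.N_zero (Or.inr (Or.inl haa))]; exact zero_le
  by_cases hbb : b = b'
  · rw [SG.N_zero (Or.inr (Or.inr (Or.inl hbb)))]; exact zero_le
  have hin : ∀ a ∈ inS t ρ, a ∈ annU t ρ ∧ ∃ d σ, Tip t ρ a d σ (t + 1 / 2) := by
    intro a ha
    simp only [inS, Finset.mem_filter, Set.Finite.mem_toFinset] at ha
    obtain ⟨h1, z, hz, d, hd⟩ := ha
    obtain ⟨w, hw, h2, h3⟩ := h1
    have : w = z := toC_inj (hw.symm.trans hz)
    subst this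
    obtain ⟨σ, hσ⟩ := tip_in (t := t) (ρ := ρ) (d := d) (v := a) (z := w) ⟨hz, by omega⟩ h2 h3 hd
    exact ⟨⟨w, hw, h2, h3⟩, d, σ, hσ⟩
  have hout : ∀ a ∈ outS t ρ, a ∈ annU t ρ ∧ ∃ d σ, Tip t ρ a d σ (ρ + 1 / 2) := by
    intro a ha
    simp only [outS, Finset.mem_filter, Set.Finite.mem_toFinset] at ha
    obtain ⟨h1, z, hz, d, hd⟩ := ha
    obtain ⟨w, hw, h2, h3⟩ := h1
    have : w = z := toC_inj (hw.symm.trans hz)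
    subst this
    obtain ⟨σ, hσ⟩ := tip_out (t := t) (ρ := ρ) (d := d) (v := a) (z := w) ⟨hz, by omega⟩ h2 h3 hd
    exact ⟨⟨w, hw, h2, h3⟩, d, σ, hσ⟩
  obtain ⟨u1, d1, s1, t1⟩ := hin a ha
  obtain ⟨u2, d2, s2, t2⟩ := hin a' ha'
  obtain ⟨u3, d3, s3, t3⟩ := hout b hb
  obtain ⟨u4, d4, s4, t4⟩ := hout b' hb'
  obtain ⟨σ, hσ, hcoh⟩ := ann_coh ht u1 u2 u3 u4 haa hbb t1 t2 t3 t4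
  have := (SG.fomin (subset_refl _) hσ hcoh).2
  refine le_self_add.trans (this.trans (ENNReal.ofReal_le_ofReal ?_))
  have h0 : σ * SG.D (annG t ρ ht) (annG t ρ ht).U a b a' b' ≤
      |SG.D (annG t ρ ht) (annG t ρ ht).U a b a' b'| := by
    rcases hσ with rfl | rfl
    · simpa using le_abs_self _
    · simpa using neg_le_abs _
  have h1 : |SG.D (annG t ρ ht) (annG t ρ ht).U a b a' b'| ≤
      |(annG t ρ ht).g (annG t ρ ht).U a b| * |(annG t ρ ht).g (annG t ρ ht).U a' b'| +
      |(annG t ρ ht).g (annG t ρ ht).U a b'| * |(annG t ρ ht).g (annG t ρ ht).U a' b| := by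
    rw [← abs_mul, ← abs_mul]; exact abs_sub _ _
  have h2 := abs_nonneg (SG.D (annG t ρ ht) (annG t ρ ht).U a b a' b')
  linarith

lemma pair_le {t ρ : ℤ} (ht : 1 ≤ t) :
    ∑' p : List Lat × List Lat, (if Pair t ρ p.1 p.2 then wt p.1 * wt p.2 else 0) ≤
    ENNReal.ofReal (2 * (∑ a ∈ inS t ρ, ∑ b ∈ outS t ρ,
      |(annG t ρ ht).g (annG t ρ ht).U a b|) ^ 2) := by
  set I := (inS t ρ ×ˢ inS t ρ) ×ˢ (outS t ρ ×ˢ outS t ρ) with hI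
  let pr : ℂ → Lat := fun v => Function.invFun toC (v ^ 2)
  have hpr : ∀ s : Lat → ℂ, IsSec s → ∀ z, pr (s z) = z := by
    intro s hs z
    simp only [pr]
    rw [hs z]
    exact Function.leftInverse_invFun (fun _ _ h => toC_inj h) z
  set g := (annG t ρ ht).g (annG t ρ ht).U with hg
  have step : ∑' p : List Lat × List Lat, (if Pair t ρ p.1 p.2 then wt p.1 * wt p.2 else 0) ≤
      ∑' q : I × (List ℂ × List ℂ), (if Walk (annG t ρ ht).nb (annG t ρ ht).U q.1.1.1.1 q.1.1.2.1 q.2.1 ∧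
        Walk (annG t ρ ht).nb (annG t ρ ht).U q.1.1.1.2 q.1.1.2.2 q.2.2 ∧ q.2.1.Disjoint q.2.2 then
        wt q.2.1 * wt q.2.2 else 0) := by
    refine tsum_le_join _ _ (fun q => (q.2.1.map pr, (q.2.2.map pr).reverse)) ?_
    rintro ⟨X, Y⟩ hne
    have hP : Pair t ρ X Y := by by_contra hc; simp [hc] at hne
    obtain ⟨s, hs, fX, fY, a, b, b', a', wX, wY, ia, ia', ob, ob'⟩ := hP
    have hsn : IsSec (fun z => - s z) := fun z => by simpa using hs z
    have l1 := fX.lift hs wX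
    have l2 := (fY.rev hs ht).neg.lift hsn wY.lrev
    have cU : ((annG t ρ ht).U : Set ℂ) = annU t ρ := by simp [annG]
    have mI : ∀ z ∈ ann t ρ, isIn t z → ∀ s, IsSec s → s z ∈ inS t ρ := by
      intro z hz hi s hs
      simp only [inS, Finset.mem_filter, Set.Finite.mem_toFinset]
      exact ⟨⟨z, hs z, hz.1, hz.2⟩, z, hs z, hi⟩
    have mO : ∀ z ∈ ann t ρ, isOut ρ z → ∀ s, IsSec s → s z ∈ outS t ρ := by
      intro z hz hi s hs
      simp only [outS, Finset.mem_filter, Set.Finite.mem_toFinset]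
      exact ⟨⟨z, hs z, hz.1, hz.2⟩, z, hs z, hi⟩
    refine ⟨(⟨((s a, - s a'), (s b, - s b')), ?_⟩, (X.map s, Y.reverse.map (fun z => - s z))), ?_, ?_⟩
    · simp only [hI, Finset.mem_product]
      exact ⟨⟨mI a wX.start_in ia s hs, mI a' wY.end_in ia' _ hsn⟩,
        mO b wX.end_in ob s hs, mO b' wY.start_in ob' _ hsn⟩
    · simp only [List.map_map, List.map_reverse, List.reverse_reverse, Prod.mk.injEq]
      constructor
      · conv_rhs => rw [← List.map_id X]
        exact List.map_congr_left (fun z _ => hpr s hs z)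
      · conv_rhs => rw [← List.map_id Y]
        exact List.map_congr_left (fun z _ => hpr _ hsn z)
    · have hdis : (X.map s).Disjoint (Y.reverse.map (fun z => - s z)) := by
        intro v h1 h2
        obtain ⟨x, hx, rfl⟩ := List.mem_map.1 h1
        obtain ⟨y, hy, hxy⟩ := List.mem_map.1 h2
        have e : toC y = toC x := by rw [← hs x, ← hs y, ← hxy]; ring
        have e' := toC_inj e
        subst e'
        have h0 : s y = 0 := self_eq_neg.1 hxy.symm
        have := wX.mem y hx
        have hG : Good (s y) y := ⟨hs y, by have := this.1; omega⟩
        exact hG.ne h0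
      rw [if_pos (show Pair t ρ (X, Y).1 (X, Y).2 from
        ⟨s, hs, fX, fY, a, b, b', a', wX, wY, ia, ia', ob, ob'⟩)]
      rw [if_pos]
      · simp [wt_map, wt_reverse]
      · refine ⟨?_, ?_, hdis⟩
        · rw [cU]; exact l1
        · rw [cU]; exact l2
  refine step.trans ?_
  rw [ENNReal.tsum_prod']
  rw [tsum_fintype]
  have h2 : ∀ i : I, ∑' q : List ℂ × List ℂ, (if Walk (annG t ρ ht).nb (annG t ρ ht).U i.1.1.1 i.1.2.1 q.1 ∧
        Walk (annG t ρ ht).nb (annG t ρ ht).U i.1.1.2 i.1.2.2 q.2 ∧ q.1.Disjoint q.2 then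
        wt q.1 * wt q.2 else 0) ≤ ENNReal.ofReal (|g i.1.1.1 i.1.2.1| * |g i.1.1.2 i.1.2.2| +
          |g i.1.1.1 i.1.2.2| * |g i.1.1.2 i.1.2.1|) := by
    intro i
    have hi := i.2
    simp only [hI, Finset.mem_product] at hi
    exact N_le ht hi.1.1 hi.1.2 hi.2.1 hi.2.2
  refine (Finset.sum_le_sum (fun i _ => h2 i)).trans ?_
  rw [← ENNReal.ofReal_sum_of_nonneg (fun i _ => by positivity)]
  apply ENNReal.ofReal_le_ofReal
  rw [Finset.sum_coe_sort I (fun i => |g i.1.1 i.2.1| * |g i.1.2 i.2.2| + |g i.1.1 i.2.2| * |g i.1.2 i.2.1|)]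
  apply le_of_eq
  rw [hI, Finset.sum_add_distrib, two_mul]
  have e1 : ∑ i ∈ (inS t ρ ×ˢ inS t ρ) ×ˢ (outS t ρ ×ˢ outS t ρ), |g i.1.1 i.2.1| * |g i.1.2 i.2.2| =
      (∑ a ∈ inS t ρ, ∑ b ∈ outS t ρ, |g a b|) ^ 2 := by
    rw [Finset.sum_product, sq, Finset.sum_mul_sum, Finset.sum_product]
    refine Finset.sum_congr rfl fun a _ => Finset.sum_congr rfl fun a' _ => ?_
    rw [Finset.sum_mul_sum, Finset.sum_product]
  have e2 : ∑ i ∈ (inS t ρ ×ˢ inS t ρ) ×ˢ (outS t ρ ×ˢ outS t ρ), |g i.1.1 i.2.2| * |g i.1.2 i.2.1| =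
      (∑ a ∈ inS t ρ, ∑ b ∈ outS t ρ, |g a b|) ^ 2 := by
    rw [Finset.sum_product, sq, Finset.sum_mul_sum, Finset.sum_product]
    refine Finset.sum_congr rfl fun a _ => Finset.sum_congr rfl fun a' _ => ?_
    rw [Finset.sum_mul_sum, Finset.sum_product, Finset.sum_comm]
  rw [e1, e2]

theorem pair_bound : ∃ C : ℝ, 0 < C ∧ ∀ (τ m : ℤ), 10 ≤ τ → 4 * τ ≤ m →
    ∑' p : List Lat × List Lat, (if Pair (τ ^ 2) (m ^ 2) p.1 p.2 then wt p.1 * wt p.2 else 0) ≤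
    ENNReal.ofReal (C * Real.sqrt (τ / m)) := by
  obtain ⟨C, hC, h⟩ := green_sum
  refine ⟨2 * C ^ 2, by positivity, fun τ m hτ hm => ?_⟩
  have ht : 1 ≤ τ ^ 2 := by nlinarith
  refine (pair_le ht).trans (ENNReal.ofReal_le_ofReal ?_)
  have h0 : 0 ≤ ∑ a ∈ inS (τ ^ 2) (m ^ 2), ∑ b ∈ outS (τ ^ 2) (m ^ 2),
      |(annG (τ ^ 2) (m ^ 2) ht).g (annG (τ ^ 2) (m ^ 2) ht).U a b| :=
    Finset.sum_nonneg fun a _ => Finset.sum_nonneg fun b _ => abs_nonneg _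
  have h1 := pow_le_pow_left₀ h0 (h τ m ht hτ hm) 2
  have hτr : (0 : ℝ) ≤ τ := by exact_mod_cast (by omega : 0 ≤ τ)
  have h2 : (q4 τ / q4 m) ^ 2 = Real.sqrt (τ / m) := by
    rw [div_pow, q4, q4, Real.sq_sqrt (Real.sqrt_nonneg _), Real.sq_sqrt (Real.sqrt_nonneg _),
      Real.sqrt_div hτr]
  rw [mul_pow, h2] at h1
  linarith

end

section

/-! ### Splitting walks -/

section Split
variable {V : Type*} {nb : Fin 4 → V → V} {S : Set V}

lemma Walk.last_set (P : Set V) {a b : V} {l : List V} (h : Walk nb S a b l) (hb : b ∉ P) :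
    Walk nb (S \ P) a b l ∨ ∃ l1 l2 e d, l = l1 ++ l2 ∧ Walk nb S a e l1 ∧ e ∈ P ∧
      Walk nb (S \ P) (nb d e) b l2 := by
  induction h with
  | one h => exact Or.inl (.one ⟨h, hb⟩)
  | @cons x y l d hx hw ih =>
    rcases ih hb with h | ⟨l1, l2, e, d', rfl, h1, h2, h3⟩
    · by_cases hxP : x ∈ P
      · exact Or.inr ⟨[x], l, x, d, rfl, .one hx, hxP, h⟩
      · exact Or.inl (.cons d ⟨hx, hxP⟩ h)
    · exact Or.inr ⟨x :: l1, l2, e, d', rfl, .cons d hx h1, h2, h3⟩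

lemma Walk.first_set (Q : Set V) {a b : V} {l : List V} (h : Walk nb S a b l) (ha : a ∉ Q)
    (hQ : ∃ q ∈ l, q ∈ Q) : ∃ l1 l2 e d, l = l1 ++ l2 ∧ Walk nb (S \ Q) a e l1 ∧ nb d e ∈ Q ∧
      Walk nb S (nb d e) b l2 := by
  induction h with
  | one h => obtain ⟨q, hq, hq'⟩ := hQ; simp at hq; subst hq; exact absurd hq' ha
  | @cons x y l d hx hw ih =>
    by_cases hn : nb d x ∈ Q
    · exact ⟨[x], l, x, d, rfl, .one ⟨hx, ha⟩, hn, hw⟩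
    · have : ∃ q ∈ l, q ∈ Q := by
        obtain ⟨q, hq, hq'⟩ := hQ
        rcases List.mem_cons.1 hq with rfl | hq
        · exact absurd hq' ha
        · exact ⟨q, hq, hq'⟩
      obtain ⟨l1, l2, e, d', rfl, h1, h2, h3⟩ := ih hn this
      exact ⟨x :: l1, l2, e, d', rfl, .cons d ⟨hx, ha⟩ h1, h2, h3⟩

lemma Walk.split_at {a b q : V} {l : List V} (h : Walk nb S a b l) (hq : q ∈ l) :
    ∃ l1 l2, l = l1 ++ l2.tail ∧ Walk nb S a q l1 ∧ Walk nb S q b l2 := by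
  induction h with
  | @one x h => simp at hq; subst hq; exact ⟨[q], [q], rfl, .one h, .one h⟩
  | @cons x y l d hx hw ih =>
    by_cases hqx : q = x
    · subst hqx; exact ⟨[q], q :: l, rfl, .one hx, .cons d hx hw⟩
    · have : q ∈ l := by simpa [hqx] using hq
      obtain ⟨l1, l2, rfl, h1, h2⟩ := ih this
      exact ⟨x :: l1, l2, rfl, .cons d hx h1, h2⟩

end Split

lemma lnb_back (d : Fin 4) (x : Lat) : lnb (dinv d) (lnb d x) = x := by simp [lnb, dirs_dinv]

lemma half_split {S : Set Lat} {τ m : ℤ} (hτ : 0 ≤ τ) (hm : τ + 1 ≤ m) {a q : Lat} {A : List Lat}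
    (h : Walk lnb S a q A) (ha : nsq a ≤ τ ^ 2) (hq : m ^ 2 < nsq q) :
    ∃ S1 X O e x y o d1 d2, A = S1 ++ X ++ O ∧ Walk lnb S a e S1 ∧ nsq e ≤ τ ^ 2 ∧ x = lnb d1 e ∧
      Walk lnb (S ∩ ann (τ ^ 2) (m ^ 2)) x y X ∧ o = lnb d2 y ∧ m ^ 2 < nsq o ∧ Walk lnb S o q O := by
  have hτm : τ ^ 2 ≤ m ^ 2 := by nlinarith
  rcases h.last_set {z | nsq z ≤ τ ^ 2} (by simp; omega) with h1 | ⟨S1, A', e, d1, rfl, h1, h2, h3⟩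
  · have := h1.start_in.2
    exact absurd ha this
  · have hnq : ∀ d, ¬ m ^ 2 < nsq (lnb d e) := by
      intro d hc
      have := nsq_nb_le hτ h2 d
      have : (τ + 1) ^ 2 ≤ m ^ 2 := by nlinarith
      change m ^ 2 < nsq (e + dirs d) at hc
      omega
    obtain ⟨X, O, y, d2, rfl, h4, h5, h6⟩ := h3.first_set {z | m ^ 2 < nsq z} (hnq d1)
      ⟨q, h3.end_mem, hq⟩
    refine ⟨S1, X, O, e, _, y, _, d1, d2, by simp, h1, h2, rfl, h4.mono' ?_, rfl, h5, h6.mono' ?_⟩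
    · rintro z ⟨⟨z1, z2⟩, z3⟩
      simp only [Set.mem_ofPred_eq, not_le, not_lt] at z2 z3
      exact ⟨z1, z2, z3⟩
    · rintro z ⟨z1, _⟩; exact z1

/-- The data of a split. -/
structure SplitData (S : Set Lat) (τ m : ℤ) (a b : Lat) (S1 X O Y S2 : List Lat) (q : Lat)
    (e1 x1 x2 o1 o2 y1 y2 e2 : Lat) (d1 d2 d3 d4 : Fin 4) : Prop where
  wS1 : Walk lnb S a e1 S1
  ne1 : nsq e1 ≤ τ ^ 2
  hx1 : x1 = lnb d1 e1
  wX : Walk lnb (S ∩ ann (τ ^ 2) (m ^ 2)) x1 x2 X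
  ho1 : o1 = lnb d2 x2
  no1 : m ^ 2 < nsq o1
  wO : Walk lnb S o1 o2 O
  qO : q ∈ O
  no2 : m ^ 2 < nsq o2
  hy1 : y1 = lnb d3 o2
  wY : Walk lnb (S ∩ ann (τ ^ 2) (m ^ 2)) y1 y2 Y
  he2 : e2 = lnb d4 y2
  ne2 : nsq e2 ≤ τ ^ 2
  wS2 : Walk lnb S e2 b S2

lemma full_split {S : Set Lat} {τ m : ℤ} (hτ : 0 ≤ τ) (hm : τ + 1 ≤ m) {a b q : Lat} {A : List Lat}
    (h : Walk lnb S a b A) (ha : nsq a ≤ τ ^ 2) (hb : nsq b ≤ τ ^ 2) (hqA : q ∈ A)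
    (hq : m ^ 2 < nsq q) :
    ∃ S1 X O Y S2 e1 x1 x2 o1 o2 y1 y2 e2 d1 d2 d3 d4, A = S1 ++ (X ++ O ++ Y) ++ S2 ∧
      SplitData S τ m a b S1 X O Y S2 q e1 x1 x2 o1 o2 y1 y2 e2 d1 d2 d3 d4 := by
  obtain ⟨l1, l2, rfl, w1, w2⟩ := h.split_at hqA
  obtain ⟨S1, X, O, e, x, y, o, d1, d2, rfl, h1, h2, h3, h4, h5, h6, h7⟩ :=
    half_split hτ hm w1 ha hq
  obtain ⟨S2, Y, O', e', x', y', o', d1', d2', hr, k1, k2, k3, k4, k5, k6, k7⟩ :=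
    half_split hτ hm w2.lrev hb hq
  have hO' := k7.lrev
  have hl2 : l2 = O'.reverse ++ Y.reverse ++ S2.reverse := by
    have := congrArg List.reverse hr
    simpa using this
  have htail : l2.tail = O'.reverse.tail ++ Y.reverse ++ S2.reverse := by
    rw [hl2, List.append_assoc, List.tail_append_of_ne_nil hO'.ne_nil, List.append_assoc]
  refine ⟨S1, X, O ++ O'.reverse.tail, Y.reverse, S2.reverse, e, x, y, o, o', y', x', e', d1, d2,
    dinv d2', dinv d1', ?_, h1, h2, h3, h4, h5, h6, h7.join hO', ?_, k6, ?_, k4.lrev, ?_, k2, k1.lrev⟩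
  · rw [htail]; simp
  · exact List.mem_append_left _ h7.end_mem
  · rw [k5, lnb_back]
  · rw [k3, lnb_back]

end

section

/-! ### Green function and first passage bounds -/

lemma fp_sum {V : Type*} (nb : Fin 4 → V → V) (S Q : Set V) (hSQ : Disjoint S Q) (a : V)
    (W : V → List V → Prop) (C : ℝ≥0∞)
    (hW : ∀ x ∈ Q, ∑' l : List V, (if W x l then wt l else 0) ≤ C) :
    ∑' l : List V, (if ∃ l1 l2 e d, l = l1 ++ l2 ∧ Walk nb S a e l1 ∧ nb d e ∈ Q ∧ W (nb d e) l2
      then wt l else 0) ≤ C := by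
  by_cases ha : a ∈ S
  swap
  · rw [ENNReal.tsum_eq_zero.2]
    · exact zero_le
    · intro l
      rw [if_neg]
      rintro ⟨l1, l2, e, d, _, h, _⟩
      exact ha h.start_in
  have h1 : ∑' l : List V, (if ∃ l1 l2 e d, l = l1 ++ l2 ∧ Walk nb S a e l1 ∧ nb d e ∈ Q ∧
      W (nb d e) l2 then wt l else 0) ≤ ∑' p : (List V × V) × Fin 4 × List V,
      (if Walk nb S a p.1.2 p.1.1 then wt p.1.1 else 0) * ((if nb p.2.1 p.1.2 ∈ Q then 1 else 0) *
        (if W (nb p.2.1 p.1.2) p.2.2 then wt p.2.2 else 0)) := by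
    refine tsum_le_join _ _ (fun p => p.1.1 ++ p.2.2) ?_
    intro l hl
    have hl' : ∃ l1 l2 e d, l = l1 ++ l2 ∧ Walk nb S a e l1 ∧ nb d e ∈ Q ∧ W (nb d e) l2 := by
      by_contra hc; rw [if_neg hc] at hl; exact hl rfl
    rw [if_pos hl']
    obtain ⟨l1, l2, e, d, rfl, h1, h2, h3⟩ := hl'
    refine ⟨((l1, e), d, l2), rfl, ?_⟩
    simp only
    rw [if_pos h1, if_pos h2, if_pos h3, wt_append, one_mul]
  refine h1.trans ?_
  rw [ENNReal.tsum_prod']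
  set ψ : V → ℝ≥0∞ := fun x => ∑ d, if nb d x ∈ Q then 1 else 0 with hψ
  have h2 : ∀ p : List V × V, ∑' q : Fin 4 × List V,
      (if Walk nb S a p.2 p.1 then wt p.1 else 0) * ((if nb q.1 p.2 ∈ Q then 1 else 0) *
        (if W (nb q.1 p.2) q.2 then wt q.2 else 0)) ≤
      (if Walk nb S a p.2 p.1 then wt p.1 * ψ p.2 else 0) * C := by
    intro p
    rw [ENNReal.tsum_mul_left, ENNReal.tsum_prod', tsum_fintype]
    have : ∀ d, ∑' l : List V, (if nb d p.2 ∈ Q then (1 : ℝ≥0∞) else 0) *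
        (if W (nb d p.2) l then wt l else 0) ≤ (if nb d p.2 ∈ Q then 1 else 0) * C := by
      intro d
      rw [ENNReal.tsum_mul_left]
      by_cases hd : nb d p.2 ∈ Q
      · rw [if_pos hd, one_mul, one_mul]; exact hW _ hd
      · rw [if_neg hd, zero_mul, zero_mul]
    refine (mul_le_mul' le_rfl (Finset.sum_le_sum fun d _ => this d)).trans ?_
    rw [← Finset.sum_mul, ← mul_assoc]
    apply le_of_eq
    congr 1
    split_ifs
    · rfl
    · simp
  refine (ENNReal.tsum_le_tsum h2).trans ?_
  rw [ENNReal.tsum_mul_right]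
  have h3 := walk_sum nb S ψ (fun _ => 1) ?_ a ha
  · calc _ ≤ 1 * C := mul_le_mul' h3 le_rfl
      _ = C := one_mul C
  · intro x hx
    rw [hψ, Finset.mul_sum, ← Finset.sum_add_distrib]
    calc _ ≤ ∑ _d : Fin 4, (4 : ℝ≥0∞)⁻¹ := by
          refine Finset.sum_le_sum fun d _ => ?_
          by_cases h1 : nb d x ∈ S
          · have : nb d x ∉ Q := Set.disjoint_left.1 hSQ h1
            simp [h1, this]
          · by_cases h2 : nb d x ∈ Q <;> simp [h1, h2]
      _ = 1 := quarter_four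

lemma log_sup {w1 w2 : ℝ} {s : ℝ} (hs : s = w1 ^ 2 + w2 ^ 2 + 1) :
    4 * Real.log s ≤ Real.log (s + 1 + 2 * w1) + Real.log (s + 1 - 2 * w1) +
      Real.log (s + 1 + 2 * w2) + Real.log (s + 1 - 2 * w2) := by
  have p1 : 0 < s + 1 + 2 * w1 := by nlinarith [sq_nonneg (w1 + 1), sq_nonneg w2]
  have p2 : 0 < s + 1 - 2 * w1 := by nlinarith [sq_nonneg (w1 - 1), sq_nonneg w2]
  have p3 : 0 < s + 1 + 2 * w2 := by nlinarith [sq_nonneg (w2 + 1), sq_nonneg w1]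
  have p4 : 0 < s + 1 - 2 * w2 := by nlinarith [sq_nonneg (w2 - 1), sq_nonneg w1]
  have p0 : 0 < s := by nlinarith [sq_nonneg w2, sq_nonneg w1]
  rw [← Real.log_mul p1.ne' p2.ne', ← Real.log_mul (by positivity) p3.ne',
    ← Real.log_mul (by positivity) p4.ne']
  rw [show (4 : ℝ) * Real.log s = Real.log (s ^ 4) by rw [Real.log_pow]; push_cast; ring]
  apply Real.log_le_log (by positivity)
  have : (s + 1 + 2 * w1) * (s + 1 - 2 * w1) * (s + 1 + 2 * w2) * (s + 1 - 2 * w2) =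
      (s + 1) ^ 4 - 4 * (s + 1) ^ 2 * (s - 1) + 16 * (w1 * w2) ^ 2 := by
    rw [show s - 1 = w1 ^ 2 + w2 ^ 2 by rw [hs]; ring]; ring
  rw [this]
  nlinarith [sq_nonneg (w1 * w2), sq_nonneg s, p0]

lemma nsq_sub_dirs (x y : Lat) :
    ((nsq (lnb 0 x - y) : ℝ) = nsq (x - y) + 1 + 2 * ((x.1 : ℝ) - y.1)) ∧
    ((nsq (lnb 1 x - y) : ℝ) = nsq (x - y) + 1 - 2 * ((x.1 : ℝ) - y.1)) ∧
    ((nsq (lnb 2 x - y) : ℝ) = nsq (x - y) + 1 + 2 * ((x.2 : ℝ) - y.2)) ∧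
    ((nsq (lnb 3 x - y) : ℝ) = nsq (x - y) + 1 - 2 * ((x.2 : ℝ) - y.2)) := by
  refine ⟨?_, ?_, ?_, ?_⟩ <;> simp [nsq, lnb, dirs] <;> ring

lemma nsq_sub_le (x y : Lat) : nsq (x - y) ≤ 2 * nsq x + 2 * nsq y := by
  simp only [nsq, Prod.fst_sub, Prod.snd_sub]
  nlinarith [sq_nonneg (x.1 + y.1), sq_nonneg (x.2 + y.2)]

lemma nsq_nonneg (x : Lat) : 0 ≤ nsq x := by simp only [nsq]; positivity

lemma green_le {M : ℤ} (hM : 1 ≤ M) (x y : Lat) :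
    ∑' l : List Lat, (if Walk lnb {z | nsq z < 16 * M ^ 2} x y l then wt l else 0) ≤
      ENNReal.ofReal (Real.log (100 * M ^ 2 / (nsq (x - y) + 1))) := by
  by_cases hx : x ∈ {z | nsq z < 16 * M ^ 2}
  swap
  · rw [ENNReal.tsum_eq_zero.2]
    · exact zero_le
    · intro l; rw [if_neg]; exact fun h => hx h.start_in
  by_cases hy : y ∈ {z | nsq z < 16 * M ^ 2}
  swap
  · rw [ENNReal.tsum_eq_zero.2]
    · exact zero_le
    · intro l; rw [if_neg]; exact fun h => hy h.end_in
  refine walk_sum_to lnb _ y (fun x => ENNReal.ofReal (Real.log (100 * M ^ 2 / (nsq (x - y) + 1)))) ?_ x hx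
  clear hx x
  intro x hx
  simp only [Set.mem_ofPred_eq] at hx hy
  have hMr : (1 : ℝ) ≤ M := by exact_mod_cast hM
  set f : Lat → ℝ := fun x => Real.log (100 * M ^ 2 / (nsq (x - y) + 1)) with hf
  have hs0 : ∀ z : Lat, (0 : ℝ) < nsq (z - y) + 1 := by
    intro z
    have : (0 : ℝ) ≤ nsq (z - y) := by exact_mod_cast nsq_nonneg _
    linarith
  have hfe : ∀ z, f z = Real.log (100 * M ^ 2) - Real.log (nsq (z - y) + 1) := by
    intro z; rw [hf]; exact Real.log_div (by positivity) (hs0 z).ne'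
  have hf0 : ∀ z : Lat, nsq z < 16 * M ^ 2 → 0 ≤ f z := by
    intro z hz
    apply Real.log_nonneg
    rw [le_div_iff₀ (hs0 z), one_mul]
    have h1 := nsq_sub_le z y
    have h2 : (nsq (z - y) : ℝ) ≤ 64 * M ^ 2 := by exact_mod_cast (by omega : nsq (z - y) ≤ 64 * M ^ 2)
    nlinarith
  have hfn : ∀ d, 0 ≤ f (lnb d x) := by
    intro d
    apply Real.log_nonneg
    rw [le_div_iff₀ (hs0 _), one_mul]
    have h1 := nsq_sub_le x y
    have h3 : nsq (x - y) ≤ (8 * M) ^ 2 := by nlinarith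
    have h4 := nsq_nb_le (by omega : 0 ≤ 8 * M) h3 d
    have h5 : nsq (lnb d x - y) = nsq (x - y + dirs d) := by congr 1; simp only [lnb]; abel
    have h2 : (nsq (lnb d x - y) : ℝ) ≤ (8 * M + 1) ^ 2 := by rw [h5]; exact_mod_cast h4
    nlinarith
  have hsum : (if x = y then (1 : ℝ) / 4 else 0) + ∑ d, 4⁻¹ * f (lnb d x) ≤ f x := by
    obtain ⟨e0, e1, e2, e3⟩ := nsq_sub_dirs x y
    rw [Fin.sum_univ_four, hfe, hfe, hfe, hfe, hfe, e0, e1, e2, e3]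
    by_cases hxy : x = y
    · subst hxy
      simp [nsq]
      rw [show (1 : ℝ) + 1 = 2 by norm_num]
      linarith [Real.log_two_gt_d9]
    · rw [if_neg hxy]
      have := log_sup (w1 := (x.1 : ℝ) - y.1) (w2 := (x.2 : ℝ) - y.2) (s := nsq (x - y) + 1)
        (by simp [nsq])
      rw [show (nsq (x - y) : ℝ) + 1 + 2 * ((x.1 : ℝ) - y.1) + 1 = nsq (x - y) + 1 + 1 + 2 * ((x.1 : ℝ) - y.1) by ring,
        show (nsq (x - y) : ℝ) + 1 - 2 * ((x.1 : ℝ) - y.1) + 1 = nsq (x - y) + 1 + 1 - 2 * ((x.1 : ℝ) - y.1) by ring,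
        show (nsq (x - y) : ℝ) + 1 + 2 * ((x.2 : ℝ) - y.2) + 1 = nsq (x - y) + 1 + 1 + 2 * ((x.2 : ℝ) - y.2) by ring,
        show (nsq (x - y) : ℝ) + 1 - 2 * ((x.2 : ℝ) - y.2) + 1 = nsq (x - y) + 1 + 1 - 2 * ((x.2 : ℝ) - y.2) by ring]
      linarith
  have h4 : (4 : ℝ≥0∞)⁻¹ = ENNReal.ofReal 4⁻¹ := by
    rw [ENNReal.ofReal_inv_of_pos (by norm_num)]; norm_num
  refine le_trans ?_ (ENNReal.ofReal_le_ofReal hsum)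
  rw [ENNReal.ofReal_add (by split_ifs <;> norm_num)
    (Finset.sum_nonneg fun d _ => mul_nonneg (by norm_num) (hfn d)),
    ENNReal.ofReal_sum_of_nonneg (fun d _ => mul_nonneg (by norm_num) (hfn d))]
  refine add_le_add ?_ (Finset.sum_le_sum fun d _ => ?_)
  · split_ifs
    · rw [mul_one, h4]; apply le_of_eq; norm_num
    · simp
  · rw [ENNReal.ofReal_mul (by norm_num), h4]
    refine mul_le_mul' le_rfl ?_
    split_ifs
    · exact le_rfl
    · exact zero_le

end

section

/-! ### Bounds for the connecting pieces -/

lemma tsum_fiber {A B : Type*} (f : A → ℝ≥0∞) (g : A → B → ℝ≥0∞) (C : ℝ≥0∞)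
    (h : ∀ a, f a ≠ 0 → ∑' b, g a b ≤ C) : ∑' p : A × B, f p.1 * g p.1 p.2 ≤ (∑' a, f a) * C := by
  rw [ENNReal.tsum_prod', ← ENNReal.tsum_mul_right]
  refine ENNReal.tsum_le_tsum fun a => ?_
  simp only
  rw [ENNReal.tsum_mul_left]
  by_cases ha : f a = 0
  · simp [ha]
  · exact mul_le_mul' le_rfl (h a ha)

lemma tsum_dir {A : Type*} (P : Fin 4 → List A → Prop) (C : ℝ≥0∞) [∀ d l, Decidable (P d l)]
    [∀ l, Decidable (∃ d, P d l)]
    (h : ∀ d, ∑' l, (if P d l then wt l else 0) ≤ C) :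
    ∑' l, (if ∃ d, P d l then wt l else 0) ≤ 4 * C := by
  have h1 : ∑' l, (if ∃ d, P d l then wt l else 0) ≤ ∑' l, ∑ d, (if P d l then wt l else 0) := by
    refine ENNReal.tsum_le_tsum fun l => ?_
    split_ifs with hd
    · obtain ⟨d, hd⟩ := hd
      calc wt l = (if P d l then wt l else 0) := by rw [if_pos hd]
        _ ≤ _ := Finset.single_le_sum (f := fun d => if P d l then wt l else 0)
          (fun _ _ => zero_le) (Finset.mem_univ d)
    · exact zero_le
  refine h1.trans ?_
  rw [Summable.tsum_finsetSum (fun _ _ => ENNReal.summable)]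
  refine (Finset.sum_le_sum fun d _ => h d).trans ?_
  simp

/-- outer excursions -/
def OB (m : ℤ) (o1 o2 : Lat) (O : List Lat) : Prop :=
  Walk lnb {z | nsq z < 16 * m ^ 2} o1 o2 O ∧ ∃ q ∈ O, 4 * m ^ 2 ≤ nsq q

lemma nsq_tri (x y : Lat) : nsq x ≤ 2 * nsq (x - y) + 2 * nsq y := by
  simp only [nsq, Prod.fst_sub, Prod.snd_sub]
  nlinarith [sq_nonneg (x.1 - 2 * y.1), sq_nonneg (x.2 - 2 * y.2)]

lemma nsq_tri3 (x y : Lat) : 2 * nsq x ≤ 6 * nsq (x - y) + 3 * nsq y := by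
  simp only [nsq, Prod.fst_sub, Prod.snd_sub]
  nlinarith [sq_nonneg (2 * x.1 - 3 * y.1), sq_nonneg (2 * x.2 - 3 * y.2)]

lemma nsq_sub_comm (x y : Lat) : nsq (x - y) = nsq (y - x) := by
  simp only [nsq, Prod.fst_sub, Prod.snd_sub]; ring

lemma green_le' {M : ℤ} (hM : 1 ≤ M) (x y : Lat) (K : ℝ) (hK : 100 * (M : ℝ) ^ 2 ≤ K * (nsq (x - y) + 1)) :
    ∑' l : List Lat, (if Walk lnb {z | nsq z < 16 * M ^ 2} x y l then wt l else 0) ≤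
      ENNReal.ofReal (Real.log K) := by
  refine (green_le hM x y).trans (ENNReal.ofReal_le_ofReal ?_)
  have h0 : (0 : ℝ) ≤ nsq (x - y) := by exact_mod_cast nsq_nonneg _
  have hMr : (1 : ℝ) ≤ M := by exact_mod_cast hM
  apply Real.log_le_log (by positivity)
  rw [div_le_iff₀ (by linarith)]
  exact hK

lemma O_bound {m : ℤ} (hm : 4 ≤ m) {o1 o2 : Lat} (h1 : nsq o1 ≤ (m + 1) ^ 2) (h2 : nsq o2 ≤ (m + 1) ^ 2) :
    ∑' l : List Lat, (if OB m o1 o2 l then wt l else 0) ≤ ENNReal.ofReal (Real.log 400) := by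
  refine le_trans (ENNReal.tsum_le_tsum fun l => ?_) (fp_sum lnb ({z | nsq z < 16 * m ^ 2} \ {z | 4 * m ^ 2 ≤ nsq z})
    {z | 4 * m ^ 2 ≤ nsq z} disjoint_sdiff_left o1
    (fun x l => Walk lnb {z | nsq z < 16 * m ^ 2} x o2 l) _ ?_)
  · by_cases h : OB m o1 o2 l
    · rw [if_pos h, if_pos]
      obtain ⟨hw, q, hq, hq'⟩ := h
      exact hw.first_set {z | 4 * m ^ 2 ≤ nsq z} (by simp only [Set.mem_ofPred_eq]; nlinarith) ⟨q, hq, hq'⟩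
    · rw [if_neg h]; exact zero_le
  · intro x hx
    apply green_le' (by omega)
    simp only [Set.mem_ofPred_eq] at hx
    have := nsq_tri x o2
    have h3 : m ^ 2 ≤ 4 * nsq (x - o2) := by nlinarith
    have : (m : ℝ) ^ 2 ≤ 4 * nsq (x - o2) := by exact_mod_cast h3
    linarith

lemma bounded_list (l : List Lat) : ∃ n : ℕ, ∀ z ∈ l, nsq z < n := by
  induction l with
  | nil => exact ⟨0, by simp⟩
  | cons a l ih =>
    obtain ⟨n, hn⟩ := ih
    refine ⟨max n ((nsq a).toNat + 1), ?_⟩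
    intro z hz
    push_cast
    rcases List.mem_cons.1 hz with rfl | hz
    · have := nsq_nonneg z
      exact lt_max_of_lt_right (by omega)
    · exact lt_max_of_lt_left (hn z hz)

lemma level {l : List Lat} {c : ℤ} (hc : 1 ≤ c) (h : ∃ q ∈ l, c ≤ nsq q) :
    ∃ j : ℕ, (∃ q ∈ l, c * 4 ^ j ≤ nsq q) ∧ ∀ z ∈ l, nsq z < c * 4 ^ (j + 1) := by
  have hex : ∃ j : ℕ, ∀ z ∈ l, nsq z < c * 4 ^ (j + 1) := by
    obtain ⟨n, hn⟩ := bounded_list l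
    refine ⟨n, fun z hz => (hn z hz).trans ?_⟩
    have h1 : n + 1 < 4 ^ (n + 1) := Nat.lt_pow_self (by norm_num)
    have h2 : ((n : ℤ) + 1) < 4 ^ (n + 1) := by exact_mod_cast h1
    nlinarith
  refine ⟨Nat.find hex, ?_, Nat.find_spec hex⟩
  rcases hj : Nat.find hex with _ | k
  · simpa using h
  · have := Nat.find_min hex (m := k) (by omega)
    push Not at this
    exact this

/-- inner pieces -/
def RB (τ : ℤ) (x y : Lat) (l : List Lat) : Prop :=
  Walk lnb Set.univ x y l ∧ ∃ s, IsSec s ∧ Flat s (τ ^ 2) l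

lemma Flat.mono {s : Lat → ℂ} {t t' : ℤ} (h : t ≤ t') {l : List Lat} (hf : Flat s t l) : Flat s t' l :=
  List.IsChain.imp (fun _ _ hh a b => hh (by omega) (by omega)) hf

lemma Flat.sub {s : Lat → ℂ} {t : ℤ} {l l' : List Lat} (hf : Flat s t l) (h : l' <:+: l) : Flat s t l' := by
  obtain ⟨a, b, rfl⟩ := h
  unfold Flat at hf ⊢
  exact (List.isChain_append.1 (List.isChain_append.1 hf).1).2.1

end

section

/-! ### The inner piece -/

/-- first vertex -/
def hd (l : List Lat) : Lat := l.head?.getD 0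
/-- last vertex -/
def lst (l : List Lat) : Lat := l.getLast?.getD 0

lemma Walk.hd_eq {S : Set Lat} {a b : Lat} {l : List Lat} (h : Walk lnb S a b l) : hd l = a := by
  simp [hd, h.head?]

lemma Walk.lst_eq {S : Set Lat} {a b : Lat} {l : List Lat} (h : Walk lnb S a b l) : lst l = b := by
  simp [lst, h.getLast?]

lemma Pair.ends {t ρ : ℤ} {X Y : List Lat} (h : Pair t ρ X Y) :
    hd X ∈ ann t ρ ∧ lst X ∈ ann t ρ ∧ hd Y ∈ ann t ρ ∧ lst Y ∈ ann t ρ := by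
  obtain ⟨s, hs, _, _, a, b, b', a', wX, wY, _⟩ := h
  rw [wX.hd_eq, wX.lst_eq, wY.hd_eq, wY.lst_eq]
  exact ⟨wX.start_in, wX.end_in, wY.start_in, wY.end_in⟩

lemma SplitData.pair {S : Set Lat} {τ m : ℤ} {a b : Lat} {S1 X O Y S2 : List Lat} {q : Lat}
    {e1 x1 x2 o1 o2 y1 y2 e2 : Lat} {d1 d2 d3 d4 : Fin 4}
    (h : SplitData S τ m a b S1 X O Y S2 q e1 x1 x2 o1 o2 y1 y2 e2 d1 d2 d3 d4)
    {s : Lat → ℂ} (hs : IsSec s) (hX : Flat s (τ ^ 2) X) (hY : Flat s (τ ^ 2) Y) :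
    Pair (τ ^ 2) (m ^ 2) X Y := by
  refine ⟨s, hs, hX, hY, x1, x2, y1, y2, h.wX.mono' inter_subset_right, h.wY.mono' inter_subset_right,
    ⟨dinv d1, ?_⟩, ⟨d4, ?_⟩, ⟨d2, ?_⟩, ⟨dinv d3, ?_⟩⟩
  · have := lnb_back d1 e1
    rw [← h.hx1] at this
    change nsq (lnb (dinv d1) x1) ≤ _
    rw [this]; exact h.ne1
  · change nsq (lnb d4 y2) ≤ _
    rw [← h.he2]; exact h.ne2
  · change _ < nsq (lnb d2 x2)
    rw [← h.ho1]; exact h.no1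
  · have := lnb_back d3 o2
    rw [← h.hy1] at this
    change _ < nsq (lnb (dinv d3) y1)
    rw [this]; exact h.no2

/-- connection through the outside -/
def CO (m : ℤ) (X Y O : List Lat) : Prop :=
  ∃ d d', OB m (lnb d (lst X)) (lnb d' (hd Y)) O

lemma SplitData.co {S : Set Lat} {τ m : ℤ} {a b : Lat} {S1 X O Y S2 : List Lat} {q : Lat}
    {e1 x1 x2 o1 o2 y1 y2 e2 : Lat} {d1 d2 d3 d4 : Fin 4}
    (h : SplitData S τ m a b S1 X O Y S2 q e1 x1 x2 o1 o2 y1 y2 e2 d1 d2 d3 d4)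
    (hq : 4 * m ^ 2 ≤ nsq q) (hS : S ⊆ {z | nsq z < 16 * m ^ 2}) : CO m X Y O := by
  refine ⟨d2, dinv d3, ?_, q, h.qO, hq⟩
  rw [h.wX.lst_eq, h.wY.hd_eq, ← h.ho1]
  have := lnb_back d3 o2
  rw [← h.hy1] at this
  rw [this]; exact h.wO.mono' hS

lemma CO_bound {t m : ℤ} (hm : 4 ≤ m) {X Y : List Lat} (h : Pair t (m ^ 2) X Y) :
    ∑' O, (if CO m X Y O then wt O else 0) ≤ 4 * (4 * ENNReal.ofReal (Real.log 400)) := by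
  obtain ⟨_, h2, h3, _⟩ := h.ends
  have key := tsum_dir (fun d O => ∃ d', OB m (lnb d (lst X)) (lnb d' (hd Y)) O)
    (4 * ENNReal.ofReal (Real.log 400)) fun d =>
    tsum_dir (fun d' O => OB m (lnb d (lst X)) (lnb d' (hd Y)) O) (ENNReal.ofReal (Real.log 400))
      fun d' => O_bound hm (nsq_nb_le (by omega) h2.2 d) (nsq_nb_le (by omega) h3.2 d')
  convert key using 6
  exact Iff.rfl

lemma log_level (j : ℕ) : Real.log (10000 * 4 ^ j) ≤ 10 * (j + 1) := by
  rw [Real.log_mul (by norm_num) (by positivity), Real.log_pow]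
  have h1 : Real.log 4 ≤ 4 - 1 := Real.log_le_sub_one_of_pos (by norm_num)
  have h2 : Real.log 10000 ≤ 10 := by
    rw [show (10000 : ℝ) = (10 : ℝ) ^ 4 by norm_num, Real.log_pow]
    have : Real.log 10 ≤ 2.5 := by
      rw [Real.log_le_iff_le_exp (by norm_num)]
      have : (2.7 : ℝ) ≤ Real.exp 1 := by linarith [Real.exp_one_gt_d9]
      have h3 : Real.exp 2.5 ^ 2 = Real.exp 1 ^ 5 := by
        rw [← Real.exp_nat_mul, ← Real.exp_nat_mul]; norm_num
      have h4 : (2.7 : ℝ) ^ 5 ≤ Real.exp 1 ^ 5 := pow_le_pow_left₀ (by norm_num) this 5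
      have h5 : (10 : ℝ) ^ 2 ≤ Real.exp 2.5 ^ 2 := by rw [h3]; refine le_trans ?_ h4; norm_num
      exact le_of_sq_le_sq h5 (Real.exp_pos _).le
    push_cast; linarith
  have : (0 : ℝ) ≤ j := by positivity
  nlinarith

/-- summability constant -/
lemma level_sum : ∃ B : ℝ, 0 < B ∧ ∑' j : ℕ, ENNReal.ofReal (((j : ℝ) + 1) ^ 2 * Real.sqrt (1 / 2) ^ j) ≤
    ENNReal.ofReal B := by
  set ρ := Real.sqrt (1 / 2) with hρ
  have h0 : 0 ≤ ρ := Real.sqrt_nonneg _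
  have h1 : ρ < 1 := by rw [hρ, Real.sqrt_lt' (by norm_num)]; norm_num
  have hn : ‖ρ‖ < 1 := by rwa [Real.norm_of_nonneg h0]
  have hs : Summable (fun j : ℕ => ((j : ℝ) + 1) ^ 2 * ρ ^ j) := by
    have e2 := summable_pow_mul_geometric_of_norm_lt_one 2 hn
    have e1 := summable_pow_mul_geometric_of_norm_lt_one 1 hn
    have e0 := summable_geometric_of_lt_one h0 h1
    refine ((e2.add (e1.mul_left 2)).add e0).congr fun j => ?_
    ring
  refine ⟨(∑' j : ℕ, ((j : ℝ) + 1) ^ 2 * ρ ^ j) + 1, ?_, ?_⟩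
  · have : 0 ≤ ∑' j : ℕ, ((j : ℝ) + 1) ^ 2 * ρ ^ j := tsum_nonneg fun j => by positivity
    linarith
  · rw [← ENNReal.ofReal_tsum_of_nonneg (fun j => by positivity) hs]
    exact ENNReal.ofReal_le_ofReal (by linarith)

lemma sqrt_level {x : ℝ} (j : ℕ) (h : x = (1 / 2) ^ j) : Real.sqrt x = Real.sqrt (1 / 2) ^ j := by
  rw [h, Real.sqrt_eq_iff_mul_self_eq (by positivity) (by positivity), ← mul_pow,
    Real.mul_self_sqrt (by norm_num)]

lemma R2_bound : ∃ C : ℝ, 0 < C ∧ ∀ τ : ℤ, 10 ≤ τ → ∀ x y : Lat, 100 * nsq x ≤ τ ^ 2 →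
    (τ - 1) ^ 2 < nsq y → nsq y ≤ τ ^ 2 →
    ∑' l, (if RB τ x y l then wt l else 0) ≤ ENNReal.ofReal C := by
  obtain ⟨Cp, hCp, hpair⟩ := pair_bound
  obtain ⟨B, hB, hBs⟩ := level_sum
  have hl400 : 0 < Real.log 400 := Real.log_pos (by norm_num)
  have hl5 : 0 < Real.log 10000 := Real.log_pos (by norm_num)
  refine ⟨Real.log 10000 + Cp * (40 * 16 * Real.log 400 * 40) * B, by positivity, fun τ hτ x y hx hy1 hy2 => ?_⟩
  have hτr : (10 : ℝ) ≤ τ := by exact_mod_cast hτ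
  -- the levels
  set m : ℕ → ℤ := fun j => 8 * τ * 2 ^ j with hm
  have hpow : ∀ j : ℕ, (1 : ℤ) ≤ 2 ^ j := fun j => one_le_pow₀ (by norm_num)
  have hm8 : ∀ j, 8 * τ ≤ m j := fun j => by
    have := hpow j
    simp only [hm]; nlinarith
  let F : ℕ → (((List Lat × List Lat) × List Lat) × List Lat) × List Lat → ℝ≥0∞ := fun j p =>
    (((if Pair ((2 * τ) ^ 2) (m j ^ 2) p.1.1.1.1 p.1.1.1.2 then wt p.1.1.1.1 * wt p.1.1.1.2 else 0) *
      (if ∃ d, Walk lnb {z | nsq z < 16 * m j ^ 2} x (lnb d (hd p.1.1.1.1)) p.1.1.2 then wt p.1.1.2 else 0)) *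
      (if CO (m j) p.1.1.1.1 p.1.1.1.2 p.1.2 then wt p.1.2 else 0)) *
      (if ∃ d, Walk lnb {z | nsq z < 16 * m j ^ 2} (lnb d (lst p.1.1.1.2)) y p.2 then wt p.2 else 0)
  have key : ∀ l, (if RB τ x y l then wt l else 0) ≤
      (if Walk lnb {z | nsq z < 16 * (4 * τ) ^ 2} x y l then wt l else 0) +
      (if RB τ x y l ∧ ∃ q ∈ l, 16 * (4 * τ) ^ 2 ≤ nsq q then wt l else 0) := by
    intro l
    by_cases h : RB τ x y l
    · by_cases h2 : ∃ q ∈ l, 16 * (4 * τ) ^ 2 ≤ nsq q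
      · rw [if_pos h, if_pos (⟨h, h2⟩ : RB τ x y l ∧ _)]; exact le_add_self
      · push Not at h2
        rw [if_pos h, if_pos (h.1.mono (T := {z | nsq z < 16 * (4 * τ) ^ 2}) h2)]; exact le_self_add
    · rw [if_neg h]; exact zero_le
  refine (ENNReal.tsum_le_tsum key).trans ?_
  rw [ENNReal.tsum_add, ENNReal.ofReal_add (by positivity) (by positivity)]
  refine add_le_add ?_ ?_
  · apply green_le' (by omega)
    have h1 := nsq_tri y x
    rw [nsq_sub_comm] at h1
    have h2 : 39 * τ ^ 2 ≤ 100 * nsq (x - y) := by nlinarith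
    have h3 : 39 * (τ : ℝ) ^ 2 ≤ 100 * nsq (x - y) := by exact_mod_cast h2
    push_cast
    nlinarith
  · have step : ∑' l, (if RB τ x y l ∧ ∃ q ∈ l, 16 * (4 * τ) ^ 2 ≤ nsq q then wt l else 0) ≤
        ∑' p : ℕ × ((((List Lat × List Lat) × List Lat) × List Lat) × List Lat), F p.1 p.2 := by
      refine tsum_le_join _ _ (fun p => p.2.1.1.2 ++ (p.2.1.1.1.1 ++ p.2.1.2 ++ p.2.1.1.1.2) ++ p.2.2) ?_
      intro l hl
      have hl' : RB τ x y l ∧ ∃ q ∈ l, 16 * (4 * τ) ^ 2 ≤ nsq q := by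
        by_contra hc; rw [if_neg hc] at hl; exact hl rfl
      rw [if_pos hl']
      obtain ⟨⟨hw, s, hs, hf⟩, hq⟩ := hl'
      obtain ⟨j, ⟨q, hq, hq'⟩, hz⟩ := level (by nlinarith : 1 ≤ 16 * (4 * τ) ^ 2) hq
      have e4 : (4 : ℤ) ^ j = (2 ^ j) ^ 2 := by rw [← pow_mul, mul_comm, pow_mul]; norm_num
      have hq2 : 4 * m j ^ 2 ≤ nsq q := by
        refine le_trans (le_of_eq ?_) hq'
        simp only [hm]; rw [e4]; ring
      have hz2 : ∀ z ∈ l, nsq z < 16 * m j ^ 2 := by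
        intro z hz'
        refine (hz z hz').trans_le (le_of_eq ?_)
        simp only [hm]; rw [pow_succ 4 j, e4]; ring
      have hmj := hm8 j
      obtain ⟨S1, X, O, Y, S2, e1, x1, x2, o1, o2, y1, y2, e2, d1, d2, d3, d4, hL, hD⟩ :=
        full_split (τ := 2 * τ) (m := m j) (S := {z | nsq z < 16 * m j ^ 2}) (by omega) (by omega)
          (hw.mono hz2) (by nlinarith) (by nlinarith) hq (by nlinarith)
      have hfX : Flat s ((2 * τ) ^ 2) X := (hf.mono (by nlinarith)).sub
        ⟨S1, O ++ Y ++ S2, by rw [hL]; simp⟩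
      have hfY : Flat s ((2 * τ) ^ 2) Y := (hf.mono (by nlinarith)).sub
        ⟨S1 ++ X ++ O, S2, by rw [hL]; simp⟩
      refine ⟨(j, ((((X, Y), S1), O), S2)), hL.symm, ?_⟩
      have c1 : ∃ d, Walk lnb {z | nsq z < 16 * m j ^ 2} x (lnb d (hd X)) S1 := by
        refine ⟨dinv d1, ?_⟩
        rw [hD.wX.hd_eq, hD.hx1, lnb_back]; exact hD.wS1
      have c2 : ∃ d, Walk lnb {z | nsq z < 16 * m j ^ 2} (lnb d (lst Y)) y S2 := by
        refine ⟨d4, ?_⟩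
        rw [hD.wY.lst_eq, ← hD.he2]; exact hD.wS2
      simp only [F]
      rw [if_pos (hD.pair hs hfX hfY), if_pos c1, if_pos c2, if_pos (hD.co hq2 subset_rfl), hL]
      simp only [wt_append]
      apply le_of_eq; ring
    refine step.trans ?_
    rw [ENNReal.tsum_prod']
    have hj : ∀ j, ∑' p, F j p ≤ ENNReal.ofReal (Cp * (40 * 16 * Real.log 400 * 40)) *
        ENNReal.ofReal (((j : ℝ) + 1) ^ 2 * Real.sqrt (1 / 2) ^ j) := by
      intro j
      have hmj := hm8 j
      have hmr : (m j : ℝ) = 8 * τ * 2 ^ j := by simp only [hm]; push_cast; ring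
      have e4 : (4 : ℝ) ^ j = (2 ^ j) ^ 2 := by rw [← pow_mul, mul_comm, pow_mul]; norm_num
      have hsep : ∀ u v : Lat, 2 * τ ^ 2 ≤ 3 * nsq (u - v) →
          100 * (m j : ℝ) ^ 2 ≤ 10000 * 4 ^ j * (nsq (u - v) + 1) := by
        intro u v h
        have h' : 2 * (τ : ℝ) ^ 2 ≤ 3 * nsq (u - v) := by exact_mod_cast h
        rw [hmr, e4]
        have : (0 : ℝ) < (2 ^ j) ^ 2 := by positivity
        have h0 : (0:ℝ) ≤ nsq (u - v) := by exact_mod_cast nsq_nonneg _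
        have : 6400 * (τ : ℝ) ^ 2 ≤ 10000 * (nsq (u - v) + 1) := by linarith
        nlinarith
      have hgr : ∀ u v : Lat, 2 * τ ^ 2 ≤ 3 * nsq (u - v) →
          ∑' l : List Lat, (if Walk lnb {z | nsq z < 16 * m j ^ 2} u v l then wt l else 0) ≤
          ENNReal.ofReal (10 * (j + 1)) := fun u v h =>
        (green_le' (by omega) u v _ (hsep u v h)).trans (ENNReal.ofReal_le_ofReal (log_level j))
      have ne_pair : ∀ X Y : List Lat, (if Pair ((2 * τ) ^ 2) (m j ^ 2) X Y then wt X * wt Y else 0) ≠ 0 →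
          Pair ((2 * τ) ^ 2) (m j ^ 2) X Y := by
        intro X Y h; by_contra hc; rw [if_neg hc] at h; exact h rfl
      refine (tsum_fiber (fun (p : ((List Lat × List Lat) × List Lat) × List Lat) =>
        ((if Pair ((2 * τ) ^ 2) (m j ^ 2) p.1.1.1 p.1.1.2 then wt p.1.1.1 * wt p.1.1.2 else 0) *
        (if ∃ d, Walk lnb {z | nsq z < 16 * m j ^ 2} x (lnb d (hd p.1.1.1)) p.1.2 then wt p.1.2 else 0)) *
        (if CO (m j) p.1.1.1 p.1.1.2 p.2 then wt p.2 else 0))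
        (fun (p : ((List Lat × List Lat) × List Lat) × List Lat) S2 => if ∃ d, Walk lnb {z | nsq z < 16 * m j ^ 2} (lnb d (lst p.1.1.2)) y S2
        then wt S2 else 0) (4 * ENNReal.ofReal (10 * (j + 1))) ?_).trans ?_
      · rintro ⟨⟨⟨X, Y⟩, S1⟩, O⟩ hne
        refine tsum_dir _ _ fun d => hgr _ _ ?_
        have hP := ne_pair X Y (left_ne_zero_of_mul (left_ne_zero_of_mul hne))
        have h1 := nsq_nb_gt (by omega) hP.ends.2.2.2.1 d
        change (2 * τ - 1) ^ 2 < nsq (lnb d (lst Y)) at h1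
        have h2 := nsq_tri3 (lnb d (lst Y)) y
        nlinarith
      refine (mul_le_mul' (tsum_fiber (fun (p : (List Lat × List Lat) × List Lat) =>
        ((if Pair ((2 * τ) ^ 2) (m j ^ 2) p.1.1 p.1.2 then wt p.1.1 * wt p.1.2 else 0) *
        (if ∃ d, Walk lnb {z | nsq z < 16 * m j ^ 2} x (lnb d (hd p.1.1)) p.2 then wt p.2 else 0)))
        (fun (p : (List Lat × List Lat) × List Lat) O => if CO (m j) p.1.1 p.1.2 O then wt O else 0)
        (4 * (4 * ENNReal.ofReal (Real.log 400))) ?_) le_rfl).trans ?_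
      · rintro ⟨⟨X, Y⟩, S1⟩ hne
        exact CO_bound (by omega) (ne_pair X Y (left_ne_zero_of_mul hne))
      refine (mul_le_mul' (mul_le_mul' (tsum_fiber (fun (p : List Lat × List Lat) =>
        (if Pair ((2 * τ) ^ 2) (m j ^ 2) p.1 p.2 then wt p.1 * wt p.2 else 0))
        (fun (p : List Lat × List Lat) S1 =>
        if ∃ d, Walk lnb {z | nsq z < 16 * m j ^ 2} x (lnb d (hd p.1)) S1 then wt S1 else 0)
        (4 * ENNReal.ofReal (10 * (j + 1))) ?_) le_rfl) le_rfl).trans ?_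
      · rintro ⟨X, Y⟩ hne
        refine tsum_dir _ _ fun d => hgr _ _ ?_
        have hP := ne_pair X Y hne
        have h1 := nsq_nb_gt (by omega) hP.ends.1.1 d
        change (2 * τ - 1) ^ 2 < nsq (lnb d (hd X)) at h1
        have h2 := nsq_tri (lnb d (hd X)) x
        rw [nsq_sub_comm] at h2
        nlinarith
      have hp := hpair (2 * τ) (m j) (by omega) (by omega)
      refine (mul_le_mul' (mul_le_mul' (mul_le_mul' hp le_rfl) le_rfl) le_rfl).trans ?_
      rw [show (4 : ℝ≥0∞) = ENNReal.ofReal 4 by norm_num]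
      have hj0 : (0 : ℝ) ≤ j := by positivity
      repeat rw [← ENNReal.ofReal_mul (by positivity)]
      apply ENNReal.ofReal_le_ofReal
      have hsq : Real.sqrt (((2 * τ : ℤ) : ℝ) / m j) ≤ Real.sqrt (1 / 2) ^ j := by
        rw [← sqrt_level j rfl]
        apply Real.sqrt_le_sqrt
        rw [hmr, div_pow, one_pow]
        push_cast
        rw [div_le_div_iff₀ (by positivity) (by positivity)]
        have : (0 : ℝ) < 2 ^ j := by positivity
        nlinarith
      calc _ = (Cp * (40 * 16 * Real.log 400 * 40) * ((j : ℝ) + 1) ^ 2) * Real.sqrt (((2 * τ : ℤ) : ℝ) / m j) := by ring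
        _ ≤ (Cp * (40 * 16 * Real.log 400 * 40) * ((j : ℝ) + 1) ^ 2) * Real.sqrt (1 / 2) ^ j :=
          mul_le_mul_of_nonneg_left hsq (by positivity)
        _ = _ := by ring
    refine (ENNReal.tsum_le_tsum hj).trans ?_
    rw [ENNReal.tsum_mul_left, ENNReal.ofReal_mul (q := B) (by positivity)]
    exact mul_le_mul' le_rfl hBs

end

section

/-- return path -/
def RC (τ r : ℤ) (e2 e1 : Lat) (l : List Lat) : Prop :=
  nsq e1 ≤ τ ^ 2 ∧ RB τ e2 e1 l ∧ ∃ p ∈ l, nsq p ≤ 2 * r ^ 2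

lemma RC_bound : ∃ C : ℝ, 0 < C ∧ ∀ τ r : ℤ, 10 ≤ τ → 200 * r ^ 2 ≤ τ ^ 2 → ∀ x y : Lat,
    (τ - 1) ^ 2 < nsq x → (τ - 1) ^ 2 < nsq y →
    ∑' l, (if RC τ r x y l then wt l else 0) ≤ ENNReal.ofReal C := by
  obtain ⟨C, hC, hb⟩ := R2_bound
  refine ⟨C, hC, fun τ r hτ hr x y hx hy => ?_⟩
  by_cases hy' : nsq y ≤ τ ^ 2
  swap
  · rw [ENNReal.tsum_eq_zero.2]
    · exact zero_le
    · intro l; rw [if_neg]; exact fun h => hy' h.1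
  refine le_trans (ENNReal.tsum_le_tsum fun l => ?_) (fp_sum lnb (univ \ {z | nsq z ≤ 2 * r ^ 2})
    {z | nsq z ≤ 2 * r ^ 2} disjoint_sdiff_left x (fun x l => RB τ x y l) _ ?_)
  · by_cases h : RC τ r x y l
    · rw [if_pos h, if_pos]
      obtain ⟨-, ⟨hw, s, hs, hf⟩, p, hp, hp'⟩ := h
      obtain ⟨l1, l2, e, d, hl, h1, h2, h3⟩ := hw.first_set {z | nsq z ≤ 2 * r ^ 2}
        (by simp only [Set.mem_ofPred_eq, not_le]; nlinarith) ⟨p, hp, hp'⟩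
      exact ⟨l1, l2, e, d, hl, h1, h2, h3, s, hs, hf.sub ⟨l1, [], by rw [hl]; simp⟩⟩
    · rw [if_neg h]; exact zero_le
  · intro z hz
    exact hb τ hτ z y (by simp only [Set.mem_ofPred_eq] at hz; omega) hy hy'

/-- closing path of a pair -/
def CR (τ r : ℤ) (X Y R : List Lat) : Prop :=
  ∃ d d', RC τ r (lnb d (lst Y)) (lnb d' (hd X)) R

lemma CR_bound : ∃ C : ℝ, 0 < C ∧ ∀ τ r m : ℤ, 10 ≤ τ → 200 * r ^ 2 ≤ τ ^ 2 → ∀ X Y : List Lat,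
    Pair (τ ^ 2) m X Y → ∑' l, (if CR τ r X Y l then wt l else 0) ≤ ENNReal.ofReal C := by
  obtain ⟨C, hC, hb⟩ := RC_bound
  refine ⟨4 * (4 * C), by positivity, fun τ r m hτ hr X Y h => ?_⟩
  obtain ⟨h1, _, _, h4⟩ := h.ends
  have key := tsum_dir (fun d O => ∃ d', RC τ r (lnb d (lst Y)) (lnb d' (hd X)) O)
    (4 * ENNReal.ofReal C) fun d =>
    tsum_dir (fun d' O => RC τ r (lnb d (lst Y)) (lnb d' (hd X)) O) (ENNReal.ofReal C)
      fun d' => hb τ r hτ hr _ _ (nsq_nb_gt (by omega) h4.1 d) (nsq_nb_gt (by omega) h1.1 d')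
  rw [ENNReal.ofReal_mul (by norm_num), ENNReal.ofReal_mul (by norm_num),
    show ENNReal.ofReal 4 = 4 by norm_num]
  convert key using 6
  exact Iff.rfl

lemma chain_rot {α : Type*} {r : α → α → Prop} {l l' : List α} (h : (l ++ l.take 1).IsChain r)
    (hr : l ~r l') : (l' ++ l'.take 1).IsChain r := by
  obtain ⟨n, rfl⟩ := hr
  induction n with
  | zero => simpa using h
  | succ n ih =>
    rw [← List.rotate_rotate]
    generalize l.rotate n = w at ih
    match w with
    | [] => simp
    | [a] => simpa using ih
    | a :: b :: w =>
      simp only [List.rotate_cons_succ, List.rotate_zero]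
      simp only [List.take_succ_cons, List.take_zero, List.cons_append] at ih ⊢
      rw [List.isChain_cons_cons] at ih
      obtain ⟨h1, h2⟩ := ih
      have h3 : ((b :: w) ++ [a]).IsChain r := h2
      rw [← List.cons_append, ← List.cons_append, List.append_assoc]
      have h4 : [a, b].IsChain r := by simpa using h1
      have := h3.append_overlap (l₂ := [a]) (l₃ := [b]) h4 (by simp)
      simpa using this

lemma adj_dir {u v : Lat} (h : Adj u v) : ∃ d, lnb d u = v := by
  obtain ⟨a, b⟩ := u; obtain ⟨c, e⟩ := v
  simp only [Adj] at h
  have h1 : a - c ≤ 1 := by nlinarith [sq_nonneg (b - e)]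
  have h2 : -1 ≤ a - c := by nlinarith [sq_nonneg (b - e)]
  have h3 : b - e ≤ 1 := by nlinarith [sq_nonneg (a - c)]
  have h4 : -1 ≤ b - e := by nlinarith [sq_nonneg (a - c)]
  generalize hx : a - c = x at *
  generalize hy : b - e = y at *
  have ha : a = c + x := by omega
  have hb : b = e + y := by omega
  subst ha hb
  interval_cases x <;> interval_cases y <;> simp at h
  · exact ⟨0, by simp [lnb, dirs]⟩
  · exact ⟨2, by simp [lnb, dirs]⟩
  · exact ⟨3, by simp [lnb, dirs]⟩
  · exact ⟨1, by simp [lnb, dirs]⟩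

lemma walk_of_chain {a b : Lat} (l : List Lat) (h : (a :: l ++ [b]).IsChain Adj) :
    Walk lnb univ a b (a :: l ++ [b]) := by
  induction l generalizing a with
  | nil =>
    simp at h
    obtain ⟨d, hd⟩ := adj_dir h
    subst hd
    exact .cons d trivial (.one trivial)
  | cons c l ih =>
    simp only [List.cons_append] at h
    rw [List.isChain_cons_cons] at h
    obtain ⟨d, hd⟩ := adj_dir h.1
    subst hd
    exact .cons d trivial (ih h.2)

/-- Loops relevant for the crossing event. -/
def Bad (r R : ℤ) (γ : ULoop) : Prop :=
  (∃ p ∈ γ.out.word, nsq p ≤ 2 * r ^ 2) ∧ (∃ q ∈ γ.out.word, R ^ 2 ≤ nsq q) ∧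
    ∃ s, IsSec s ∧ Flat s ((100 * r) ^ 2) (γ.out.word ++ γ.out.word.take 1)

/-- some loop -/
def loop0 : RootedLoop := ⟨[(0, 0), (1, 0)], by simp, by
  have : List.IsChain Adj [(0, 0), (1, 0), (0, 0)] := by simp [Adj]
  exact this⟩

/-- the class of a word -/
def mkLoop (l : List Lat) : ULoop := show Quot loopRot from
  if h : ∃ L : RootedLoop, L.word = l then (Quot.mk _ h.choose : Quot loopRot) else (Quot.mk _ loop0 : Quot loopRot)

lemma mkLoop_eq {γ : ULoop} {l : List Lat} (h : γ.out.word ~r l) : mkLoop l = γ := by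
  have hex : ∃ L : RootedLoop, L.word = l := by
    refine ⟨⟨l, ?_, chain_rot γ.out.adj h⟩, rfl⟩
    intro h0
    rw [h0] at h
    exact γ.out.ne (List.isRotated_nil_iff.1 h)
  obtain ⟨k, hk⟩ := h
  have : loopRot γ.out hex.choose := ⟨k, by rw [hex.choose_spec, hk]⟩
  exact (dif_pos hex).trans ((Quot.sound this).symm.trans (Quot.out_eq γ))

lemma mass_bound : ∃ C : ℝ, 0 < C ∧ ∀ r R : ℤ, 1 ≤ r → 1000 * r ≤ R →
    ∑' γ : ULoop, (if Bad r R γ then (4 : ℝ≥0∞)⁻¹ ^ γ.steps else 0) ≤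
      ENNReal.ofReal (C * Real.sqrt ((r : ℝ) / R)) := by
  obtain ⟨Cp, hCp, hpair⟩ := pair_bound
  obtain ⟨Cr, hCr, hcr⟩ := CR_bound
  obtain ⟨B, hB, hBs⟩ := level_sum
  have hl400 : 0 < Real.log 400 := Real.log_pos (by norm_num)
  refine ⟨Cp * (16 * Real.log 400 * Cr) * Real.sqrt 300 * B, by positivity, fun r R hr hR => ?_⟩
  obtain ⟨h, hh1, hh2⟩ : ∃ h : ℤ, 2 * h ≤ R ∧ R ≤ 2 * h + 1 := ⟨R / 2, by omega, by omega⟩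
  set τ := 100 * r with hτ
  set m : ℕ → ℤ := fun j => h * 2 ^ j with hm
  have hpow : ∀ j : ℕ, (1 : ℤ) ≤ 2 ^ j := fun j => one_le_pow₀ (by norm_num)
  have hm8 : ∀ j, h ≤ m j := fun j => by
    have := hpow j
    simp only [hm]; nlinarith
  let F : ℕ → ((List Lat × List Lat) × List Lat) × List Lat → ℝ≥0∞ := fun j p =>
    ((if Pair (τ ^ 2) (m j ^ 2) p.1.1.1 p.1.1.2 then wt p.1.1.1 * wt p.1.1.2 else 0) *
      (if CO (m j) p.1.1.1 p.1.1.2 p.1.2 then wt p.1.2 else 0)) *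
      (if CR τ r p.1.1.1 p.1.1.2 p.2 then wt p.2 else 0)
  have step : ∑' γ : ULoop, (if Bad r R γ then (4 : ℝ≥0∞)⁻¹ ^ γ.steps else 0) ≤
        ∑' p : ℕ × (((List Lat × List Lat) × List Lat) × List Lat), F p.1 p.2 := by
    refine tsum_le_join _ _ (fun p => mkLoop (p.2.1.1.1 ++ p.2.1.2 ++ p.2.1.1.2 ++ p.2.2)) ?_
    intro γ hγ
    have hbad : Bad r R γ := by
      by_contra hc; rw [if_neg hc] at hγ; exact hγ rfl
    rw [if_pos hbad]
    obtain ⟨⟨p, hp, hp'⟩, ⟨q0, hq0, hq0'⟩, s, hs, hf⟩ := hbad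
    obtain ⟨A, D, hAD⟩ := List.append_of_mem hp
    have hrot : γ.out.word ~r (p :: D ++ A) := by rw [hAD]; exact List.isRotated_append
    have hch := chain_rot γ.out.adj hrot
    simp only [List.take_succ_cons, List.take_zero, List.cons_append] at hch
    have hw := walk_of_chain (D ++ A) (a := p) (b := p) (by simpa using hch)
    have hqL : q0 ∈ p :: (D ++ A) ++ [p] := by
      have := hrot.mem_iff.1 hq0
      simp only [List.mem_append, List.mem_cons] at this ⊢
      tauto
    have hc1 : 1 ≤ 4 * h ^ 2 := by nlinarith
    obtain ⟨j, ⟨q, hq, hq'⟩, hz⟩ := level hc1 ⟨q0, hqL, by nlinarith⟩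
    have e4 : (4 : ℤ) ^ j = (2 ^ j) ^ 2 := by rw [← pow_mul, mul_comm, pow_mul]; norm_num
    have hq2 : 4 * m j ^ 2 ≤ nsq q := by
      refine le_trans (le_of_eq ?_) hq'
      simp only [hm]; rw [e4]; ring
    have hz2 : ∀ z ∈ p :: (D ++ A) ++ [p], nsq z < 16 * m j ^ 2 := by
      intro z hz'
      refine (hz z hz').trans_le (le_of_eq ?_)
      simp only [hm]; rw [pow_succ 4 j, e4]; ring
    have hmj := hm8 j
    obtain ⟨S1, X, O, Y, S2, e1, x1, x2, o1, o2, y1, y2, e2, d1, d2, d3, d4, hL, hD⟩ :=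
      full_split (τ := τ) (m := m j) (S := {z | nsq z < 16 * m j ^ 2}) (by omega) (by omega)
        (hw.mono hz2) (by nlinarith) (by nlinarith) hq (by nlinarith)
    obtain ⟨S1', rfl⟩ : ∃ S1', S1 = p :: S1' := by
      have := hD.wS1.head?
      cases S1 with
      | nil => simp at this
      | cons a l => simp at this; exact ⟨l, by rw [this]⟩
    obtain ⟨T, rfl⟩ : ∃ T, S2 = T ++ [p] := by
      have := hD.wS2.getLast?
      rcases List.eq_nil_or_concat S2 with h0 | ⟨T, a, h0⟩
      · rw [h0] at this; simp at this
      · rw [h0] at this; simp at this; exact ⟨T, by rw [h0, this]; simp⟩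
    have hL' : p :: (D ++ A) = p :: S1' ++ ((X ++ O ++ Y) ++ T) := by
      apply List.append_cancel_right (bs := [p])
      rw [hL]; simp
    have hrot2 : γ.out.word ~r (X ++ O ++ Y ++ (T ++ (p :: S1'))) := by
      refine hrot.trans ?_
      rw [List.cons_append, hL']
      have := List.isRotated_append (l := p :: S1') (l' := X ++ O ++ Y ++ T)
      simpa using this
    have hf2 := chain_rot hf hrot2
    have hfi : ∀ l, l <:+: (X ++ O ++ Y ++ (T ++ (p :: S1'))) → Flat s (τ ^ 2) l := fun l hl =>
      Flat.sub (s := s) (t := τ ^ 2) hf2 (hl.trans ⟨[], _, by simp; rfl⟩)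
    have hfX := hfi X ⟨[], O ++ Y ++ (T ++ (p :: S1')), by simp⟩
    have hfY := hfi Y ⟨X ++ O, (T ++ (p :: S1')), by simp⟩
    have hfR := hfi (T ++ (p :: S1')) ⟨X ++ O ++ Y, [], by simp⟩
    refine ⟨(j, (((X, Y), O), T ++ (p :: S1'))), mkLoop_eq hrot2, ?_⟩
    have hwR := hD.wS2.join hD.wS1
    have c1 : CR τ r X Y (T ++ (p :: S1')) := by
      refine ⟨d4, dinv d1, ?_⟩
      rw [hD.wY.lst_eq, ← hD.he2, hD.wX.hd_eq, hD.hx1, lnb_back]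
      refine ⟨hD.ne1, ⟨?_, s, hs, hfR⟩, p, by simp, hp'⟩
      have := hwR.mono' (subset_univ _)
      simpa using this
    simp only [F]
    rw [if_pos (hD.pair hs hfX hfY), if_pos (hD.co hq2 subset_rfl), if_pos c1]
    have hlen : (4 : ℝ≥0∞)⁻¹ ^ γ.steps = wt (X ++ O ++ Y ++ (T ++ (p :: S1'))) := by
      rw [wt, ULoop.steps, hrot2.perm.length_eq]
    rw [hlen]
    simp only [wt_append]
    apply le_of_eq; ring
  refine step.trans ?_
  rw [ENNReal.tsum_prod']
  have hj : ∀ j, ∑' p, F j p ≤ ENNReal.ofReal (Cp * (16 * Real.log 400 * Cr) * Real.sqrt 300 * Real.sqrt (r / R)) *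
      ENNReal.ofReal (((j : ℝ) + 1) ^ 2 * Real.sqrt (1 / 2) ^ j) := by
    intro j
    have hmj := hm8 j
    have hmr : (m j : ℝ) = h * 2 ^ j := by simp only [hm]; push_cast; ring
    have ne_pair : ∀ X Y : List Lat, (if Pair (τ ^ 2) (m j ^ 2) X Y then wt X * wt Y else 0) ≠ 0 →
        Pair (τ ^ 2) (m j ^ 2) X Y := by
      intro X Y h; by_contra hc; rw [if_neg hc] at h; exact h rfl
    refine (tsum_fiber (fun (p : (List Lat × List Lat) × List Lat) =>
      (if Pair (τ ^ 2) (m j ^ 2) p.1.1 p.1.2 then wt p.1.1 * wt p.1.2 else 0) *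
      (if CO (m j) p.1.1 p.1.2 p.2 then wt p.2 else 0))
      (fun (p : (List Lat × List Lat) × List Lat) S2 => if CR τ r p.1.1 p.1.2 S2
      then wt S2 else 0) (ENNReal.ofReal Cr) ?_).trans ?_
    · rintro ⟨⟨X, Y⟩, O⟩ hne
      exact hcr τ r _ (by omega) (by nlinarith) X Y (ne_pair X Y (left_ne_zero_of_mul hne))
    refine (mul_le_mul' (tsum_fiber (fun (p : List Lat × List Lat) =>
      (if Pair (τ ^ 2) (m j ^ 2) p.1 p.2 then wt p.1 * wt p.2 else 0))
      (fun (p : List Lat × List Lat) O => if CO (m j) p.1 p.2 O then wt O else 0)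
      (4 * (4 * ENNReal.ofReal (Real.log 400))) ?_) le_rfl).trans ?_
    · rintro ⟨X, Y⟩ hne
      exact CO_bound (by omega) (ne_pair X Y hne)
    have hp := hpair τ (m j) (by omega) (by omega)
    refine (mul_le_mul' (mul_le_mul' hp le_rfl) le_rfl).trans ?_
    rw [show (4 : ℝ≥0∞) = ENNReal.ofReal 4 by norm_num]
    have hj0 : (0 : ℝ) ≤ j := by positivity
    repeat rw [← ENNReal.ofReal_mul (by positivity)]
    apply ENNReal.ofReal_le_ofReal
    have hsq : Real.sqrt ((τ : ℝ) / m j) ≤ Real.sqrt 300 * Real.sqrt (r / R) * Real.sqrt (1 / 2) ^ j := by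
      have hR0 : (0 : ℝ) < R := by exact_mod_cast (by omega : 0 < R)
      have hr0 : (0 : ℝ) < r := by exact_mod_cast (by omega : 0 < r)
      rw [← sqrt_level j rfl, ← Real.sqrt_mul (by norm_num), ← Real.sqrt_mul (by positivity)]
      apply Real.sqrt_le_sqrt
      have h3 : (R : ℝ) ≤ 3 * h := by exact_mod_cast (by omega : R ≤ 3 * h)
      have hR0 : (0 : ℝ) < R := by exact_mod_cast (by omega : 0 < R)
      have hr0 : (0 : ℝ) < r := by exact_mod_cast (by omega : 0 < r)
      have hh0 : (0 : ℝ) < h := by exact_mod_cast (by omega : 0 < h)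
      rw [hmr, div_pow, one_pow, hτ, Int.cast_mul, Int.cast_ofNat]
      have h2 : (0 : ℝ) < 2 ^ j := by positivity
      rw [show 300 * ((r : ℝ) / R) * (1 / 2 ^ j) = (300 * r) / (R * 2 ^ j) by field_simp, div_le_div_iff₀ (by positivity) (by positivity)]
      have : (r : ℝ) * R ≤ r * (3 * h) := by nlinarith
      nlinarith [mul_le_mul_of_nonneg_right this h2.le]
    have h1j : (1 : ℝ) ≤ ((j : ℝ) + 1) ^ 2 := by nlinarith
    calc _ = (Cp * (16 * Real.log 400 * Cr)) * Real.sqrt ((τ : ℝ) / m j) := by ring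
      _ ≤ (Cp * (16 * Real.log 400 * Cr)) * (Real.sqrt 300 * Real.sqrt (r / R) * Real.sqrt (1 / 2) ^ j) :=
        mul_le_mul_of_nonneg_left hsq (by positivity)
      _ = (Cp * (16 * Real.log 400 * Cr) * Real.sqrt 300 * Real.sqrt (r / R)) * (1 * Real.sqrt (1 / 2) ^ j) := by ring
      _ ≤ _ := by gcongr
  refine (ENNReal.tsum_le_tsum hj).trans ?_
  rw [ENNReal.tsum_mul_left]
  refine (mul_le_mul' le_rfl hBs).trans ?_
  rw [← ENNReal.ofReal_mul (by positivity)]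
  apply le_of_eq; congr 1; ring

end

section

instance : Countable RootedLoop := by
  have : Function.Injective (RootedLoop.word) := by
    rintro ⟨a, _, _⟩ ⟨b, _, _⟩ h; cases h; rfl
  exact this.countable

instance : Countable ULoop := by unfold ULoop; infer_instance

lemma loopWeight_le (γ : ULoop) : (loopWeight γ : ℝ≥0∞) ≤ (4 : ℝ≥0∞)⁻¹ ^ γ.steps := by
  have h : loopWeight γ ≤ (4 : ℝ≥0)⁻¹ ^ γ.steps := by
    unfold loopWeight
    rcases Nat.eq_zero_or_pos γ.mult with h | h
    · rw [h]; simp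
    · exact div_le_self zero_le (by exact_mod_cast h)
  calc (loopWeight γ : ℝ≥0∞) ≤ (((4 : ℝ≥0)⁻¹ ^ γ.steps : ℝ≥0) : ℝ≥0∞) := by exact_mod_cast h
    _ = _ := by rw [ENNReal.coe_pow, ENNReal.coe_inv (by norm_num)]; rfl

lemma prob_ne {D : Set Lat} {P : Measure Config} (hP : IsLoopSoup D 1 P) (γ : ULoop) :
    P {ω | ω γ ≠ 0} ≤ (4 : ℝ≥0∞)⁻¹ ^ γ.steps := by
  haveI := hP.1
  have h0 := hP.2 {γ} (fun _ => 0)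
  simp only [Finset.mem_singleton, forall_eq, Finset.prod_singleton, Real.toNNReal_one, one_mul] at h0
  have hm : MeasurableSet {ω : Config | ω γ = 0} := measurable_pi_apply γ (measurableSet_singleton 0)
  have hc : {ω : Config | ω γ ≠ 0} = {ω : Config | ω γ = 0}ᶜ := rfl
  rw [hc, prob_compl_eq_one_sub hm, h0, poissonProb]
  simp only [pow_zero, mul_one, Nat.factorial_zero, Nat.cast_one, div_one]
  rw [← ENNReal.ofReal_one, ← ENNReal.ofReal_sub _ (Real.exp_pos _).le]
  have h1 : ENNReal.ofReal (1 - Real.exp (-(nuD D γ : ℝ))) ≤ (nuD D γ : ℝ≥0∞) := by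
    rw [← ENNReal.ofReal_coe_nnreal]
    apply ENNReal.ofReal_le_ofReal
    linarith [Real.add_one_le_exp (-(nuD D γ : ℝ))]
  refine h1.trans (le_trans ?_ (loopWeight_le γ))
  unfold nuD
  split_ifs <;> simp

lemma prob_le {D : Set Lat} {P : Measure Config} (hP : IsLoopSoup D 1 P) (E : ULoop → Prop) :
    P {ω | ∃ γ ∈ Config.loops ω, E γ} ≤ ∑' γ : ULoop, (if E γ then (4 : ℝ≥0∞)⁻¹ ^ γ.steps else 0) := by
  have hsub : {ω | ∃ γ ∈ Config.loops ω, E γ} ⊆ ⋃ γ, {ω : Config | E γ ∧ ω γ ≠ 0} := by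
    rintro ω ⟨γ, h1, h2⟩
    exact mem_iUnion.2 ⟨γ, h2, h1⟩
  refine (measure_mono hsub).trans ((measure_iUnion_le _).trans (ENNReal.tsum_le_tsum fun γ => ?_))
  split_ifs with h
  · refine le_trans (measure_mono ?_) (prob_ne hP γ)
    rintro ω ⟨_, h⟩; exact h
  · simp [h]

lemma final_of (hcross : ∀ r R : ℤ, 1 ≤ r → r < R → ∀ γ : ULoop, CrossesAnn (loopFrontier γ) 0 r R → Bad r R γ) :
    ∃ c : ℝ, 0 < c ∧ ∀ (r R R' : ℤ) (P : Measure Config), 1 ≤ r → r < R → R < R' →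
      IsLoopSoup (box 0 R') 1 P →
      P {ω | ∃ γ ∈ Config.loops ω, CrossesAnn (loopFrontier γ) 0 r R} ≤
        ENNReal.ofReal (c * Real.sqrt ((r : ℝ) / (R : ℝ))) := by
  obtain ⟨C, hC, hb⟩ := mass_bound
  refine ⟨C + 100, by positivity, fun r R R' P hr hrR hRR hP => ?_⟩
  have hR0 : (0 : ℝ) < R := by exact_mod_cast (by omega : 0 < R)
  have hr0 : (0 : ℝ) < r := by exact_mod_cast (by omega : 0 < r)
  have hs := Real.sqrt_nonneg ((r : ℝ) / R)
  by_cases h : 1000 * r ≤ R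
  · refine (prob_le hP _).trans (le_trans ?_ ((hb r R hr h).trans (ENNReal.ofReal_le_ofReal (by nlinarith))))
    refine ENNReal.tsum_le_tsum fun γ => ?_
    by_cases hc : CrossesAnn (loopFrontier γ) 0 r R
    · rw [if_pos hc, if_pos (hcross r R hr hrR γ hc)]
    · rw [if_neg hc]; exact zero_le
  · haveI := hP.1
    refine prob_le_one.trans ?_
    rw [← ENNReal.ofReal_one]
    apply ENNReal.ofReal_le_ofReal
    have h1 : (1 / 100 : ℝ) ≤ Real.sqrt ((r : ℝ) / R) := by
      apply Real.le_sqrt_of_sq_le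
      rw [le_div_iff₀ hR0]
      have : (R : ℝ) ≤ 1000 * r := by exact_mod_cast (by omega : R ≤ 1000 * r)
      nlinarith
    nlinarith

end

section

/-! ### Square roots on the trace of a loop -/

/-- identification of the plane with `ℂ` -/
def pC (x : Plane) : ℂ := ⟨x 0, x 1⟩

lemma pC_emb (z : Lat) : pC (emb z) = toC z := by
  simp [pC, emb, toC]

lemma pC_dist (x y : Plane) : ‖pC x - pC y‖ = dist x y := by
  rw [EuclideanSpace.dist_eq, Complex.norm_eq_sqrt_sq_add_sq]
  simp [pC, Real.dist_eq, sq_abs]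

lemma pC_inj {x y : Plane} (h : pC x = pC y) : x = y := by
  rw [← dist_eq_zero, ← pC_dist, h]; simp

lemma pC_cont : Continuous pC := by
  refine LipschitzWith.continuous (K := 1) (LipschitzWith.of_dist_le_mul fun x y => ?_)
  rw [dist_eq_norm, pC_dist]; simp

lemma emb_inj {z w : Lat} (h : emb z = emb w) : z = w := by
  apply toC_inj; rw [← pC_emb, ← pC_emb, h]

lemma pC_line (x y : Plane) (t : ℝ) : pC (x + t • (y - x)) = pC x + t * (pC y - pC x) := by
  apply Complex.ext <;> simp [pC]

/-- `z - x` has a continuous square root on `A` -/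
def HasSqrt (A : Set Plane) (x : Plane) : Prop :=
  ∃ f : Plane → ℂ, ContinuousOn f A ∧ ∀ z ∈ A, f z ^ 2 = pC z - pC x

lemma slit_shift {a b : ℂ} (h : ‖b‖ < ‖a‖) : (a + b) / a ∈ Complex.slitPlane := by
  have ha : a ≠ 0 := by rintro rfl; simp at h; linarith [norm_nonneg b]
  rw [add_div, div_self ha]
  apply Complex.mem_slitPlane_of_norm_lt_one
  rw [norm_div, div_lt_one (by linarith [norm_nonneg b])]
  exact h

/-- multiplying a square root by the root of a ratio close to one -/
lemma sqrt_shift {A : Set Plane} {f a : Plane → ℂ} {b : ℂ} (hf : ContinuousOn f A)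
    (ha : ContinuousOn a A) (h2 : ∀ z ∈ A, f z ^ 2 = a z) (hb : ∀ z ∈ A, ‖b‖ < ‖a z‖) :
    ContinuousOn (fun z => f z * Complex.exp (Complex.log ((a z + b) / a z) / 2)) A ∧
    ∀ z ∈ A, (f z * Complex.exp (Complex.log ((a z + b) / a z) / 2)) ^ 2 = a z + b := by
  have hne : ∀ z ∈ A, a z ≠ 0 := fun z hz h => by
    have := hb z hz
    rw [h] at this; simp at this; linarith [norm_nonneg b]
  constructor
  · refine hf.mul (Complex.continuous_exp.comp_continuousOn (ContinuousOn.div_const ?_ _))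
    refine ContinuousOn.clog ((ha.add continuousOn_const).div ha hne) fun z hz => slit_shift (hb z hz)
  · intro z hz
    have hs := slit_shift (hb z hz)
    rw [mul_pow, exp_half_sq, Complex.exp_log (Complex.slitPlane_ne_zero hs), h2 z hz]
    have := hne z hz
    field_simp

lemma HasSqrt.shift {A : Set Plane} {x x' : Plane} (h : HasSqrt A x)
    (hx : ∀ z ∈ A, dist x x' < dist z x) : HasSqrt A x' := by
  obtain ⟨f, hf, h2⟩ := h
  obtain ⟨h3, h4⟩ := sqrt_shift (a := fun z => pC z - pC x) (b := pC x - pC x') hf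
    (pC_cont.continuousOn.sub continuousOn_const) h2
    (fun z hz => by rw [pC_dist, pC_dist]; exact hx z hz)
  refine ⟨_, h3, fun z hz => ?_⟩
  rw [h4 z hz]; ring

lemma HasSqrt.far {A : Set Plane} {x : Plane} (h : ∀ z ∈ A, ‖pC z‖ < ‖pC x‖) : HasSqrt A x := by
  obtain ⟨w, hw⟩ := IsAlgClosed.exists_pow_nat_eq (-pC x) (n := 2) (by norm_num)
  -- multiply the constant root by the root of the ratio
  refine ⟨fun z => w * Complex.exp (Complex.log ((-pC x + pC z) / (-pC x)) / 2), ?_, ?_⟩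
  · refine continuousOn_const.mul (Complex.continuous_exp.comp_continuousOn (ContinuousOn.div_const ?_ _))
    refine ContinuousOn.clog ((continuousOn_const.add pC_cont.continuousOn).div_const _) fun z hz =>
      slit_shift (by rw [norm_neg]; exact h z hz)
  · intro z hz
    have hs := slit_shift (a := -pC x) (b := pC z) (by rw [norm_neg]; exact h z hz)
    have hne : pC x ≠ 0 := fun h0 => by
      have := h z hz
      rw [h0] at this; simp at this; linarith [norm_nonneg (pC z)]
    rw [mul_pow, exp_half_sq, Complex.exp_log (Complex.slitPlane_ne_zero hs), hw]
    field_simp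
    ring

lemma exists_ball {A : Set Plane} (hA : IsClosed A) {x : Plane} (hx : x ∉ A) :
    ∃ ε > 0, ∀ z ∈ A, ε ≤ dist z x := by
  obtain ⟨ε, hε, h⟩ := Metric.isOpen_iff.1 hA.isOpen_compl x hx
  refine ⟨ε, hε, fun z hz => ?_⟩
  by_contra hc
  push Not at hc
  exact h (Metric.mem_ball.2 hc) hz

lemma HasSqrt.of_not_fill {A : Set Plane} (hA : IsCompact A) {x : Plane} (hx : x ∉ Fill A) :
    HasSqrt A x := by
  simp only [Fill, Set.mem_ofPred_eq] at hx
  push Not at hx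
  obtain ⟨C, hC, hconn, hxC, hunb⟩ := hx
  rw [hA.isClosed.closure_eq] at hC
  have key : ∀ y ∉ A, ∃ ε > 0, ∀ y' ∈ Metric.ball y ε, y' ∉ A ∧ (HasSqrt A y ↔ HasSqrt A y') := by
    intro y hy
    obtain ⟨ε, hε, h⟩ := exists_ball hA.isClosed hy
    refine ⟨ε / 2, by linarith, fun y' hy' => ?_⟩
    rw [Metric.mem_ball] at hy'
    have h1 : ∀ z ∈ A, dist y' y < dist z y := fun z hz => by linarith [h z hz]
    have h2 : ∀ z ∈ A, dist y' y < dist z y' := fun z hz => by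
      linarith [h z hz, dist_triangle z y' y]
    exact ⟨fun h0 => by linarith [h1 _ h0], fun h0 => h0.shift fun z hz => by rw [dist_comm y y']; exact h1 z hz,
      fun h0 => h0.shift h2⟩
  obtain ⟨M, hM⟩ := (hA.image pC_cont).isBounded.exists_norm_le
  have hfar : ∃ y ∈ C, HasSqrt A y := by
    by_contra hc
    push Not at hc
    apply hunb
    rw [Metric.isBounded_iff_subset_closedBall (0 : Plane)]
    refine ⟨M, fun y hy => ?_⟩
    have h0 : ‖pC y‖ = dist y 0 := by rw [← pC_dist]; simp [pC, Complex.ext_iff, ← Complex.mk_eq_add_mul_I, show (⟨0, 0⟩ : ℂ) = 0 from rfl]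
    rw [Metric.mem_closedBall, ← h0]
    by_contra hlt
    push Not at hlt
    exact hc y hy (HasSqrt.far fun z hz => (hM _ (mem_image_of_mem _ hz)).trans_lt hlt)
  have o1 : IsOpen {y | y ∉ A ∧ HasSqrt A y} := by
    rw [Metric.isOpen_iff]
    rintro y ⟨h1, h2⟩
    obtain ⟨ε, hε, h⟩ := key y h1
    exact ⟨ε, hε, fun y' hy' => ⟨(h y' hy').1, (h y' hy').2.1 h2⟩⟩
  have o2 : IsOpen {y | y ∉ A ∧ ¬ HasSqrt A y} := by
    rw [Metric.isOpen_iff]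
    rintro y ⟨h1, h2⟩
    obtain ⟨ε, hε, h⟩ := key y h1
    exact ⟨ε, hε, fun y' hy' => ⟨(h y' hy').1, fun h3 => h2 ((h y' hy').2.2 h3)⟩⟩
  have hd : Disjoint {y | y ∉ A ∧ HasSqrt A y} {y | y ∉ A ∧ ¬ HasSqrt A y} :=
    Set.disjoint_left.2 fun y h1 h2 => h2.2 h1.2
  have hsub := hconn.isPreconnected.subset_left_of_subset_union o1 o2 hd
    (fun y hy => by
      by_cases h : HasSqrt A y
      · exact Or.inl ⟨hC hy, h⟩
      · exact Or.inr ⟨hC hy, h⟩)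
    (by obtain ⟨y, hy, h⟩ := hfar; exact ⟨y, hy, hC hy, h⟩)
  exact (hsub hxC).2

lemma frontier_fill {A : Set Plane} (hA : IsClosed A) {x : Plane} (hx : x ∈ frontier (Fill A)) : x ∈ A := by
  by_contra hxA
  obtain ⟨ε, hε, h⟩ := exists_ball hA hxA
  have hB : Metric.ball x ε ⊆ Aᶜ := fun y hy hyA => by
    have := h y hyA; rw [Metric.mem_ball] at hy; linarith
  have hBc : IsConnected (Metric.ball x ε) := Metric.isConnected_ball hε
  have hxB : x ∈ Metric.ball x ε := Metric.mem_ball_self hε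
  have tr : ∀ y ∈ Metric.ball x ε, ∀ y' ∈ Metric.ball x ε, y ∈ Fill A → y' ∈ Fill A := by
    intro y hy y' hy' hF C hC hconn hyC
    have := hF (C ∪ Metric.ball x ε) ?_ ?_ (Or.inr hy)
    · exact this.subset subset_union_left
    · rw [hA.closure_eq] at hC ⊢
      exact union_subset hC hB
    · exact IsConnected.union ⟨y', hyC, hy'⟩ hconn hBc
  have hmem := Metric.isOpen_ball.mem_nhds hxB
  rw [frontier_eq_closure_inter_closure] at hx
  obtain ⟨y, hy, hyF⟩ := mem_closure_iff_nhds.1 hx.1 _ hmem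
  obtain ⟨y', hy', hyF'⟩ := mem_closure_iff_nhds.1 hx.2 _ hmem
  exact hyF' (tr y hy y' hy' hyF)

end

section

lemma seg_compact (x y : Plane) : IsCompact (segment ℝ x y) := by
  rw [segment_eq_image']
  exact isCompact_Icc.image (by fun_prop)

lemma trace_compact (l : List Lat) : IsCompact (traceL l) := by
  refine IsCompact.union ?_ ?_
  · exact (List.finite_toSet l).isCompact_biUnion fun _ _ => isCompact_singleton
  · exact (List.finite_toSet (l.zip l.tail)).isCompact_biUnion fun _ _ => seg_compact _ _

lemma chain_zip {α : Type*} {R : α → α → Prop} (l : List α) (h : ∀ p ∈ l.zip l.tail, R p.1 p.2) :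
    l.IsChain R := by
  induction l with
  | nil => simp
  | cons a l ih =>
    cases l with
    | nil => simp
    | cons b l =>
      rw [List.isChain_cons_cons]
      simp only [List.tail_cons, List.zip_cons_cons, List.mem_cons] at h ih
      exact ⟨h (a, b) (Or.inl rfl), ih fun p hp => h p (Or.inr hp)⟩

lemma zip_chain {α : Type*} {R : α → α → Prop} (l : List α) (hl : l.IsChain R) :
    ∀ p ∈ l.zip l.tail, R p.1 p.2 := by
  induction l with
  | nil => simp
  | cons a l ih =>
    cases l with
    | nil => simp
    | cons b l =>
      rw [List.isChain_cons_cons] at hl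
      intro p hp
      simp only [List.tail_cons, List.zip_cons_cons, List.mem_cons] at hp ih
      rcases hp with rfl | hp
      · exact hl.1
      · exact ih hl.2 p hp

lemma mem_trace {l : List Lat} (hl : l.IsChain Adj) {p : Lat} (h : emb p ∈ traceL l) : p ∈ l := by
  rcases h with h | h
  · simp only [mem_iUnion, mem_singleton_iff] at h
    obtain ⟨z, hz, h⟩ := h
    rw [emb_inj h]; exact hz
  · simp only [mem_iUnion] at h
    obtain ⟨⟨u, v⟩, huv, h⟩ := h
    have hu : u ∈ l := (List.of_mem_zip huv).1
    have hv : v ∈ l := List.mem_of_mem_tail (List.of_mem_zip huv).2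
    obtain ⟨d, hd⟩ := adj_dir (zip_chain l hl _ huv)
    rw [segment_eq_image'] at h
    obtain ⟨t, ⟨ht0, ht1⟩, ht⟩ := h
    have h1 := congrArg pC ht
    simp only [] at h1 hd
    rw [pC_line, pC_emb, pC_emb, pC_emb, ← hd, lnb, toC_add] at h1
    have h2 : toC (p - u) = t * dC d := by
      have : toC p = toC (p - u) + toC u := by rw [← toC_add]; simp
      rw [this] at h1
      rw [dC]
      linear_combination -h1
    have h3 := norm_toC_sq (p - u)
    rw [h2, norm_mul, norm_dC, mul_one, Complex.norm_real, Real.norm_eq_abs, sq_abs] at h3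
    have h4 : (nsq (p - u) : ℝ) ≤ 1 := by nlinarith
    have h5 : nsq (p - u) ≤ 1 := by exact_mod_cast h4
    have h6 := nsq_nonneg (p - u)
    rcases (by omega : nsq (p - u) = 0 ∨ nsq (p - u) = 1) with h7 | h7
    · rw [h7] at h3
      have ht : t = 0 := by simpa using h3
      rw [ht] at h1
      have : toC p = toC u := by rw [← h1]; simp
      rw [toC_inj this]; exact hu
    · rw [h7] at h3
      have ht : t = 1 := by push_cast at h3; nlinarith
      rw [ht] at h1
      have : toC p = toC v := by rw [← h1, ← hd, lnb, toC_add]; simp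
      rw [toC_inj this]; exact hv

lemma emb_add (u : Lat) (d : Fin 4) (t : ℝ) : pC (emb u + t • (emb (u + dirs d) - emb u)) = toC u + t * dC d := by
  rw [pC_line, pC_emb, pC_emb, toC_add, dC]; ring

/-- the continuous section over the trace gives a flat lattice section -/
lemma flat_of_sqrt {l : List Lat} {x : Plane} (h : HasSqrt (traceL l) x) {t : ℤ} (ht : 1 ≤ t)
    (hxt : 2 * ‖pC x‖ + 1 < t) : ∃ s, IsSec s ∧ Flat s (t ^ 2) l := by
  set A := traceL l with hA
  obtain ⟨f, hf, h2⟩ := h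
  set D := {z ∈ A | ‖pC x‖ < ‖pC z - pC x‖} with hD
  have hDA : D ⊆ A := fun z hz => hz.1
  obtain ⟨h3, h4⟩ := sqrt_shift (A := D) (a := fun z => pC z - pC x) (b := pC x) (hf.mono hDA)
    (pC_cont.continuousOn.sub continuousOn_const) (fun z hz => h2 z hz.1) (fun z hz => hz.2)
  set F : Plane → ℂ := fun z => f z * Complex.exp (Complex.log ((pC z - pC x + pC x) / (pC z - pC x)) / 2) with hF
  have hroot : ∀ z : Lat, ∃ w : ℂ, w ^ 2 = toC z := fun z =>
    IsAlgClosed.exists_pow_nat_eq (toC z) (n := 2) (by norm_num)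
  choose g hg using hroot
  refine ⟨fun z => if emb z ∈ D then F (emb z) else g z, ?_, ?_⟩
  · intro z
    simp only
    split_ifs with hz
    · have := h4 _ hz
      simp only [sub_add_cancel, pC_emb] at this
      simp only [hF, sub_add_cancel, pC_emb]
      exact this
    · exact hg z
  · refine chain_zip l ?_
    rintro ⟨u, v⟩ huv h5 h6 d hd
    simp only at h5 h6 hd ⊢
    subst hd
    have hseg : ∀ τ ∈ Icc (0 : ℝ) 1, emb u + τ • (emb (u + dirs d) - emb u) ∈ D := by
      intro τ hτ
      refine ⟨Or.inr ?_, ?_⟩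
      · simp only [mem_iUnion]
        refine ⟨(u, u + dirs d), huv, ?_⟩
        rw [segment_eq_image']
        exact ⟨τ, hτ, rfl⟩
      · rw [emb_add]
        have e1 : (t : ℝ) < ‖toC u‖ := by
          have e2 := norm_toC_sq u
          have e3 : (t : ℝ) ^ 2 < nsq u := by exact_mod_cast h5
          rw [← e2] at e3
          exact lt_of_pow_lt_pow_left₀ 2 (norm_nonneg _) e3
        have e4 : ‖(τ : ℂ) * dC d‖ ≤ 1 := by
          rw [norm_mul, norm_dC, mul_one, Complex.norm_real, Real.norm_eq_abs, abs_of_nonneg hτ.1]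
          exact hτ.2
        have e5 : ‖toC u‖ ≤ ‖toC u + τ * dC d - pC x‖ + ‖(τ : ℂ) * dC d‖ + ‖pC x‖ := by
          have e6 : toC u = (toC u + τ * dC d - pC x) - τ * dC d + pC x := by ring
          calc ‖toC u‖ = ‖(toC u + τ * dC d - pC x) - τ * dC d + pC x‖ := by rw [← e6]
            _ ≤ _ := (norm_add_le _ _).trans (add_le_add (norm_sub_le _ _) le_rfl)
        linarith
    have hu : emb u ∈ D := by simpa using hseg 0 ⟨le_rfl, zero_le_one⟩
    have hv : emb (u + dirs d) ∈ D := by simpa using hseg 1 ⟨zero_le_one, le_rfl⟩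
    rw [if_pos hu, if_pos hv]
    have hFsq : ∀ z ∈ D, F z ^ 2 = pC z := fun z hz => by
      have := h4 z hz
      rw [sub_add_cancel] at this
      simp only [hF, sub_add_cancel]
      simpa using this
    have hgood : Good (F (emb u)) u := ⟨by rw [hFsq _ hu, pC_emb], by nlinarith⟩
    have hEq : EqOn (fun τ : ℝ => F (emb u + τ • (emb (u + dirs d) - emb u))) (fun τ : ℝ => arc (F (emb u)) d τ)
        (Icc 0 1) := by
      refine IsPreconnected.eq_of_sq_eq isPreconnected_Icc ?_ ?_ ?_ ?_ (left_mem_Icc.2 zero_le_one) ?_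
      · refine ContinuousOn.comp h3 (Continuous.continuousOn (by fun_prop)) hseg
      · refine continuousOn_const.mul (Complex.continuous_exp.comp_continuousOn (ContinuousOn.div_const ?_ _))
        refine ContinuousOn.clog (Continuous.continuousOn ?_) fun τ hτ => Or.inl (hgood.fac_re d hτ.1 hτ.2)
        unfold fac
        fun_prop
      · intro τ hτ
        simp only [Pi.pow_apply]
        rw [hFsq _ (hseg τ hτ), hgood.arc_sq d hτ.1 hτ.2, emb_add]
      · intro τ _
        exact hgood.arc_ne d τ
      · simp [arc_zero]
    have := hEq (right_mem_Icc.2 zero_le_one)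
    simpa [hnb] using this

lemma bdry_linf {r : ℤ} {p : Lat} (h : p ∈ bdry (box 0 r)) : linf p = r := by
  obtain ⟨h1, w, h2, h3⟩ := h
  simp only [box, sub_zero, Set.mem_ofPred_eq, not_le] at h1 h2
  simp only [linf, Prod.fst_sub, Prod.snd_sub] at *
  have a1 := abs_sub_abs_le_abs_sub w.1 p.1
  have a2 := abs_sub_abs_le_abs_sub w.2 p.2
  rw [abs_sub_comm] at a1 a2
  omega

lemma cross_bad (r R : ℤ) (hr : 1 ≤ r) (hR : r < R) (γ : ULoop)
    (h : CrossesAnn (loopFrontier γ) 0 r R) : Bad r R γ := by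
  have hch : (γ.out.word ++ γ.out.word.take 1).IsChain Adj := γ.out.adj
  have hcomp := trace_compact (γ.out.word ++ γ.out.word.take 1)
  have hmem : ∀ p : Lat, emb p ∈ loopFrontier γ → p ∈ γ.out.word := by
    intro p hp
    have := mem_trace hch (frontier_fill hcomp.isClosed hp)
    rcases List.mem_append.1 this with h | h
    · exact h
    · exact List.mem_of_mem_take h
  obtain ⟨⟨_, hp, p, hpb, rfl⟩, _, hq, q, hqb, rfl⟩ := h
  have lp := bdry_linf hpb
  have lq := bdry_linf hqb
  have lp' := lp
  simp only [linf] at lp'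
  have a1 := abs_le.1 (le_max_left |p.1| |p.2|)
  have a2 := abs_le.1 (le_max_right |p.1| |p.2|)
  rw [lp'] at a1 a2
  have hp1 : p.1 ^ 2 ≤ r ^ 2 := sq_le_sq' (by omega) (by omega)
  have hp2 : p.2 ^ 2 ≤ r ^ 2 := sq_le_sq' (by omega) (by omega)
  have hnp : nsq p ≤ 2 * r ^ 2 := by simp only [nsq]; omega
  refine ⟨⟨p, hmem p hp, hnp⟩, ⟨q, hmem q hq, ?_⟩, ?_⟩
  · simp only [linf] at lq
    rcases max_choice |q.1| |q.2| with h | h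
    · rw [h] at lq; rw [← lq, sq_abs, nsq]; nlinarith [sq_nonneg q.2]
    · rw [h] at lq; rw [← lq, sq_abs, nsq]; nlinarith [sq_nonneg q.1]
  · have hp' := hp
    rw [loopFrontier, frontier_eq_closure_inter_closure] at hp'
    obtain ⟨x, hx, hxF⟩ := mem_closure_iff_nhds.1 hp'.2 _ (Metric.ball_mem_nhds (emb p) one_pos)
    rw [Metric.mem_ball, ← pC_dist, pC_emb] at hx
    have hr' : (1 : ℝ) ≤ r := by exact_mod_cast hr
    have hn : ‖toC p‖ ≤ 2 * r := by
      have e := norm_toC_sq p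
      have e2 : (nsq p : ℝ) ≤ 2 * r ^ 2 := by exact_mod_cast hnp
      rw [← e] at e2
      nlinarith [norm_nonneg (toC p)]
    have hxn : ‖pC x‖ ≤ 2 * r + 1 := by
      have : pC x = toC p + (pC x - toC p) := by ring
      rw [this]
      exact (norm_add_le _ _).trans (by linarith)
    exact flat_of_sqrt (HasSqrt.of_not_fill hcomp hxF) (t := 100 * r) (by omega) (by push_cast; linarith)

end

/-- There is a universal constant `c > 0` such that for all
`1 ≤ r < R < R'`, for the frontier loop soup of the random walk loop soup in `B_{R'}`
with intensity `1`, the probability that some loop frontier crosses `A_{r,R}` is at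
most `c·(r/R)^{1/2}`. -/
theorem crossing_frontier_probability :
    ∃ c : ℝ, 0 < c ∧
      ∀ (r R R' : ℤ) (P : Measure Config),
        1 ≤ r → r < R → R < R' → IsLoopSoup (box 0 R') 1 P →
        P {ω | ∃ γ ∈ Config.loops ω, CrossesAnn (loopFrontier γ) 0 r R} ≤
          ENNReal.ofReal (c * Real.sqrt ((r : ℝ) / (R : ℝ))) := by
  exact final_of cross_bad

end RWLSPaper
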